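/- If p₁ is a quadratic residue modulo p₂, then Cl₂(K₁) and Cl₂(K₂) are both isomorphic to ℤ/2ℤ × ℤ/2ℤ × ℤ/2ℤ; if p₁ is a quadratic nonresidue modulo p₂, then Cl₂(K₁) and Cl₂(K₂) are both isomorphic to ℤ/2ℤ × ℤ/4ℤ. -/

import Mathlib

open NumberField IntermediateField

set_option linter.unusedSectionVars false

theorem zmod_pow_four_ne_neg_one {l : ℕ} [Fact l.Prime] (hl : l % 8 = 5) (x : ZMod l) :
    x ^ 4 ≠ -1 := by
  intro h
  have hx : x ≠ 0 := by
    rintro rfl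
    simp at h
  have h1 := ZMod.pow_card_sub_one_eq_one hx
  have h2 : l - 1 = 4 * (2 * (l / 8) + 1) := by omega
  rw [h2, pow_mul, h, Odd.neg_one_pow ⟨l / 8, rfl⟩] at h1
  have : Fact (2 < l) := ⟨by omega⟩
  exact ZMod.neg_one_ne_one h1

theorem zmod_two_not_isSquare {l : ℕ} [Fact l.Prime] (hl : l % 8 = 5) :
    ¬ IsSquare (2 : ZMod l) := by
  rw [ZMod.exists_sq_eq_two_iff (by omega)]
  omega

theorem zmod_neg_one_isSquare {l : ℕ} [Fact l.Prime] (hl : l % 8 = 5) :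
    IsSquare (-1 : ZMod l) := by
  rw [ZMod.exists_sq_eq_neg_one_iff]
  omega

theorem quadraticChar_two' {l : ℕ} [Fact l.Prime] (hl : l % 8 = 5) :
    quadraticChar (ZMod l) 2 = -1 := by
  rw [quadraticChar_neg_one_iff_not_isSquare]
  exact zmod_two_not_isSquare hl

theorem quadraticChar_neg_one' {l : ℕ} [Fact l.Prime] (hl : l % 8 = 5) :
    quadraticChar (ZMod l) (-1) = 1 := by
  have : Fact (2 < l) := ⟨by omega⟩
  rw [quadraticChar_one_iff_isSquare (neg_ne_zero.mpr one_ne_zero)]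
  exact zmod_neg_one_isSquare hl

theorem quadraticChar_sqrt_neg_one {l : ℕ} [Fact l.Prime] (hl : l % 8 = 5) {t : ZMod l}
    (ht : t * t = -1) : quadraticChar (ZMod l) t = -1 := by
  rw [quadraticChar_neg_one_iff_not_isSquare]
  rintro ⟨y, rfl⟩
  exact zmod_pow_four_ne_neg_one hl y (by rw [← ht]; ring)

theorem quadraticChar_swap {p q : ℕ} [Fact p.Prime] [Fact q.Prime] (hp : p % 8 = 5)
    (hq : q % 8 = 5) :
    quadraticChar (ZMod p) q = quadraticChar (ZMod q) p := by
  have := legendreSym.quadratic_reciprocity_one_mod_four (p := p) (q := q) (by omega) (by omega)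
  simpa [legendreSym] using this.symm

/-- Pell descent: the fundamental unit of `ℚ(√D)` gives a factorization of `D`. -/
theorem pell_split {D : ℕ} (hD : 1 < D) (hsf : Squarefree D)
    (hodd : ∀ x y : ℤ, x ^ 2 - D * y ^ 2 = 1 → Odd x) :
    ∃ d e : ℕ, d * e = D ∧ e ≠ 1 ∧ ∃ u v : ℤ, e * v ^ 2 - d * u ^ 2 = 1 := by
  have hns : ¬ IsSquare (D : ℤ) := by
    rintro ⟨r, hr⟩
    have h1 : D = r.natAbs * r.natAbs := by
      rw [← Int.natAbs_mul, ← hr]; simp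
    have := hsf r.natAbs ⟨1, by rw [mul_one]; exact h1⟩
    rw [Nat.isUnit_iff] at this
    rw [this] at h1
    omega
  obtain ⟨s, hs⟩ := Pell.IsFundamental.exists_of_not_isSquare (by exact_mod_cast (by omega : 0 < D)) hns
  have hxy := s.prop
  obtain ⟨m, hm⟩ := hodd _ _ hxy
  have hx1 := hs.1
  have hm0 : 0 < m := by omega
  have hy : Even s.y := by
    by_contra hy
    rw [Int.not_even_iff_odd] at hy
    obtain ⟨n, hn⟩ := hy
    have : (4 : ℤ) ∣ D := by
      rw [hm, hn] at hxy
      exact ⟨m ^ 2 + m - D * (n ^ 2 + n), by linear_combination -hxy⟩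
    have h4 : 2 * 2 ∣ D := by exact_mod_cast this
    exact absurd (hsf 2 h4) (by decide)
  obtain ⟨n, hn⟩ := hy
  have key : m * (m + 1) = D * n ^ 2 := by
    rw [hm, hn] at hxy
    linarith [hxy]
  obtain ⟨M, rfl⟩ := Int.eq_ofNat_of_zero_le hm0.le
  have keyN : M * (M + 1) = D * n.natAbs ^ 2 := by
    zify
    rw [sq_abs]
    exact_mod_cast key
  obtain ⟨e, he⟩ := Nat.gcd_dvd_left D M
  set d := Nat.gcd D M with hd
  have hde : d.Coprime e := by
    have := hsf
    rw [he] at this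
    exact Nat.coprime_of_squarefree_mul this
  obtain ⟨m₁, hm₁⟩ : d ∣ M := Nat.gcd_dvd_right D M
  have hd0 : 0 < d := Nat.gcd_pos_of_pos_left _ (by omega)
  have heM : e.Coprime M := by
    have h1 : Nat.gcd e M ∣ d := Nat.dvd_gcd ((Nat.gcd_dvd_left e M).trans ⟨d, by rw [he]; ring⟩) (Nat.gcd_dvd_right _ _)
    have h2 : Nat.gcd e M ∣ e := Nat.gcd_dvd_left e M
    exact Nat.dvd_one.mp (hde ▸ Nat.dvd_gcd h1 h2)
  obtain ⟨m₂, hm₂⟩ : e ∣ M + 1 := by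
    refine heM.dvd_of_dvd_mul_left (keyN ▸ ?_)
    exact Dvd.dvd.mul_right ⟨d, by rw [he]; ring⟩ _
  have hprod : m₁ * m₂ = n.natAbs ^ 2 := by
    have he0 : 0 < e := Nat.pos_of_ne_zero (by rintro rfl; omega)
    rw [hm₂] at keyN
    have : (d * e) * (m₁ * m₂) = (d * e) * n.natAbs ^ 2 := by
      rw [← he, ← keyN, he]
      nlinarith [hm₁]
    exact Nat.eq_of_mul_eq_mul_left (by positivity) this
  have hcop : m₁.Coprime m₂ := by
    have : M.Coprime (M + 1) := by simp
    rw [hm₂] at this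
    exact (this.coprime_dvd_left ⟨d, by rw [mul_comm]; exact hm₁⟩).coprime_dvd_right ⟨e, by ring⟩
  obtain ⟨u, hu⟩ := exists_associated_pow_of_mul_eq_pow (Nat.isUnit_iff.mpr hcop) hprod
  obtain ⟨v, hv⟩ := exists_associated_pow_of_mul_eq_pow (Nat.isUnit_iff.mpr hcop.symm)
    (mul_comm m₁ m₂ ▸ hprod)
  rw [associated_iff_eq] at hu hv
  have hfin : (e : ℤ) * (v : ℤ) ^ 2 - d * (u : ℤ) ^ 2 = 1 := by
    have h1 : d * u ^ 2 + 1 = e * v ^ 2 := by rw [hu, hv, ← hm₁, ← hm₂]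
    zify at h1
    linarith
  refine ⟨d, e, he.symm, ?_, u, v, hfin⟩
  rintro rfl
  have hDd : (D : ℤ) = d := by rw [he]; push_cast; ring
  have h1 : ((v : ℤ)) ^ 2 - (D : ℤ) * (u : ℤ) ^ 2 = 1 := by
    have := hfin
    push_cast at this
    rw [hDd]
    linarith
  have hv2 : v ^ 2 = M + 1 := by rw [hv, hm₂, one_mul]
  have hlt : 1 < v := by
    by_contra h
    have : v ^ 2 ≤ 1 ^ 2 := Nat.pow_le_pow_left (by omega) 2
    have : 0 < M := by exact_mod_cast hm0
    omega
  have := hs.x_le_x (a := Pell.Solution₁.mk v u h1) (by simpa using hlt)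
  rw [Pell.Solution₁.x_mk, hm] at this
  have hvv : v * v = M + 1 := by rw [← hv2]; ring
  zify at hvv hlt
  nlinarith

theorem mul_eq_prime_mul {l d e n : ℕ} (hl : l.Prime) (h : d * e = l * n) :
    (∃ d', d = l * d' ∧ d' * e = n) ∨ ∃ e', e = l * e' ∧ d * e' = n := by
  rcases hl.dvd_mul.mp (Dvd.intro n h.symm : l ∣ d * e) with ⟨d', rfl⟩ | ⟨e', rfl⟩
  · exact Or.inl ⟨d', rfl, Nat.eq_of_mul_eq_mul_left hl.pos (by rw [← h]; ring)⟩
  · exact Or.inr ⟨e', rfl, Nat.eq_of_mul_eq_mul_left hl.pos (by rw [← h]; ring)⟩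

theorem quadraticChar_of_split_left {l d e : ℕ} [Fact l.Prime] (hld : l ∣ d) {u v : ℤ}
    (h : e * v ^ 2 - d * u ^ 2 = 1) : quadraticChar (ZMod l) e = 1 := by
  have h1 : (e : ZMod l) * (v : ZMod l) ^ 2 = 1 := by
    have := congrArg (Int.cast : ℤ → ZMod l) h
    push_cast at this
    rw [(ZMod.natCast_eq_zero_iff d l).mpr hld] at this
    simpa using this
  have h2 := congrArg (quadraticChar (ZMod l)) h1
  have hv : (v : ZMod l) ≠ 0 := by
    intro h0
    simp [h0] at h1
  rwa [map_mul, map_pow, quadraticChar_sq_one hv, mul_one, map_one] at h2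

theorem quadraticChar_of_split_right {l d e : ℕ} [Fact l.Prime] (hl : l % 8 = 5) (hle : l ∣ e)
    {u v : ℤ} (h : e * v ^ 2 - d * u ^ 2 = 1) : quadraticChar (ZMod l) d = 1 := by
  have h1 : -1 * (d : ZMod l) * (u : ZMod l) ^ 2 = 1 := by
    have := congrArg (Int.cast : ℤ → ZMod l) h
    push_cast at this
    rw [(ZMod.natCast_eq_zero_iff e l).mpr hle] at this
    linear_combination this
  have h2 := congrArg (quadraticChar (ZMod l)) h1
  have hu : (u : ZMod l) ≠ 0 := by
    intro h0
    simp [h0] at h1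
  rwa [map_mul, map_mul, map_pow, quadraticChar_sq_one hu, mul_one, map_one,
    quadraticChar_neg_one' hl, one_mul] at h2

theorem odd_of_pell {D : ℕ} (hD : D % 8 = 5 ∨ D % 2 = 0) (x y : ℤ)
    (h : x ^ 2 - D * y ^ 2 = 1) : Odd x := by
  by_contra hx
  rw [Int.not_odd_iff_even] at hx
  obtain ⟨m, rfl⟩ := hx
  rcases hD with hD | hD
  · obtain ⟨k, hk⟩ : ∃ k : ℤ, (D : ℤ) = 8 * k + 5 := ⟨(D / 8 : ℕ), by omega⟩
    rw [hk] at h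
    rcases Int.even_or_odd' y with ⟨n, rfl | rfl⟩
    · have : 2 * (2 * m ^ 2 - 2 * (8 * k + 5) * n ^ 2) = 1 := by linarith [h]
      omega
    · have : 4 * (m ^ 2 - 2 * k - (8 * k + 5) * (n ^ 2 + n)) = 6 := by linarith [h]
      omega
  · obtain ⟨k, hk⟩ : ∃ k : ℤ, (D : ℤ) = 2 * k := ⟨(D / 2 : ℕ), by omega⟩
    rw [hk] at h
    have : 2 * (2 * m ^ 2 - k * y ^ 2) = 1 := by linarith [h]
    omega

theorem neg_pell_prime {p : ℕ} [Fact p.Prime] (hp : p % 8 = 5) :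
    ∃ a b : ℤ, a ^ 2 + 1 = p * b ^ 2 := by
  have hpp : p.Prime := Fact.out
  obtain ⟨d, e, hde, he, u, v, h⟩ := pell_split hpp.one_lt hpp.squarefree
    (odd_of_pell (Or.inl hp))
  rcases mul_eq_prime_mul (n := 1) hpp (by rw [hde, mul_one]) with ⟨d', rfl, h1⟩ | ⟨e', rfl, h1⟩
  · exact absurd (Nat.eq_one_of_mul_eq_one_left h1) he
  · rw [mul_eq_one] at h1
    obtain ⟨rfl, rfl⟩ := h1
    refine ⟨u, v, ?_⟩
    push_cast at h
    linarith

theorem neg_pell_two_mul {q : ℕ} [Fact q.Prime] (hq : q % 8 = 5) :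
    ∃ a b : ℤ, a ^ 2 + 1 = 2 * q * b ^ 2 := by
  have hqp : q.Prime := Fact.out
  have h2q : Nat.Coprime 2 q := (Nat.coprime_primes Nat.prime_two hqp).mpr (by omega)
  obtain ⟨d, e, hde, he, u, v, h⟩ := pell_split (D := 2 * q) (by omega)
    ((Nat.squarefree_mul h2q).mpr ⟨Nat.prime_two.squarefree, hqp.squarefree⟩)
    (odd_of_pell (Or.inr (by omega)))
  have c2 := quadraticChar_two' hq
  rcases mul_eq_prime_mul Nat.prime_two hde with ⟨d', rfl, h1⟩ | ⟨e', rfl, h1⟩ <;>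
  rcases mul_eq_prime_mul (n := 1) hqp (by rw [h1, mul_one]) with ⟨d', rfl, h2⟩ | ⟨e', rfl, h2⟩ <;>
  rw [mul_eq_one] at h2 <;> obtain ⟨rfl, rfl⟩ := h2
  · exact absurd rfl he
  · have := quadraticChar_of_split_right hq (Dvd.intro _ rfl) h
    simp [-quadraticChar_apply, c2] at this
  · have := quadraticChar_of_split_left (Dvd.intro _ rfl) h
    simp [-quadraticChar_apply, c2] at this
  · refine ⟨u, v, ?_⟩
    push_cast at h
    linarith

theorem neg_pell_two_mul_mul {p q : ℕ} [Fact p.Prime] [Fact q.Prime] (hp : p % 8 = 5)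
    (hq : q % 8 = 5) (hne : p ≠ q) : ∃ a b : ℤ, a ^ 2 + 1 = 2 * p * q * b ^ 2 := by
  have hpp : p.Prime := Fact.out
  have hqp : q.Prime := Fact.out
  have h2q : Nat.Coprime 2 q := (Nat.coprime_primes Nat.prime_two hqp).mpr (by omega)
  have h2p : Nat.Coprime 2 p := (Nat.coprime_primes Nat.prime_two hpp).mpr (by omega)
  have hpq : Nat.Coprime p q := (Nat.coprime_primes hpp hqp).mpr hne
  obtain ⟨d, e, hde, he, u, v, h⟩ := pell_split (D := 2 * (p * q))
    (by nlinarith [hpp.one_lt, hqp.one_lt])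
    ((Nat.squarefree_mul (h2p.mul_right h2q)).mpr ⟨Nat.prime_two.squarefree,
      (Nat.squarefree_mul hpq).mpr ⟨hpp.squarefree, hqp.squarefree⟩⟩)
    (odd_of_pell (Or.inr (by omega)))
  have c2 := quadraticChar_two' hq
  have c2' := quadraticChar_two' hp
  have hs := quadraticChar_swap hp hq
  have Lp := fun h' => quadraticChar_of_split_left (l := p) (d := d) (e := e) h' h
  have Lq := fun h' => quadraticChar_of_split_left (l := q) (d := d) (e := e) h' h
  have Rp := fun h' => quadraticChar_of_split_right (l := p) (d := d) (e := e) hp h' h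
  have Rq := fun h' => quadraticChar_of_split_right (l := q) (d := d) (e := e) hq h' h
  rcases mul_eq_prime_mul Nat.prime_two hde with ⟨d', rfl, h1⟩ | ⟨e', rfl, h1⟩ <;>
  rcases mul_eq_prime_mul hpp h1 with ⟨d', rfl, h2⟩ | ⟨e', rfl, h2⟩ <;>
  rcases mul_eq_prime_mul (n := 1) hqp (by rw [h2, mul_one]) with ⟨d', rfl, h3⟩ | ⟨e', rfl, h3⟩ <;>
  rw [mul_eq_one] at h3 <;> obtain ⟨rfl, rfl⟩ := h3
  · exact absurd rfl he
  · have h4 := Lp ⟨2, by ring⟩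
    have h5 := Rq ⟨1, by ring⟩
    simp [-quadraticChar_apply, c2] at h4 h5
    rw [hs] at h4
    omega
  · have h4 := Rp ⟨1, by ring⟩
    have h5 := Lq ⟨2, by ring⟩
    simp [-quadraticChar_apply, c2'] at h4 h5
    rw [hs] at h4
    omega
  · have h4 := Rp ⟨q, by ring⟩
    simp [-quadraticChar_apply, c2'] at h4
  · have h4 := Lp ⟨q, by ring⟩
    simp [-quadraticChar_apply, c2'] at h4
  · have h4 := Lp ⟨1, by ring⟩
    have h5 := Rq ⟨2, by ring⟩
    simp [-quadraticChar_apply, c2'] at h4 h5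
    rw [hs] at h4
    omega
  · have h4 := Rp ⟨2, by ring⟩
    have h5 := Lq ⟨1, by ring⟩
    simp [-quadraticChar_apply, c2] at h4 h5
    rw [hs] at h4
    omega
  · refine ⟨u, v, ?_⟩
    push_cast at h
    linarith

/-- A Gaussian prime `v` of norm `l`, with reduction map onto `ZMod l`. -/
structure GaussPrime (l : ℕ) [Fact l.Prime] where
  v : GaussianInt
  red : GaussianInt →+* ZMod l
  red_eq_zero : ∀ z, red z = 0 ↔ v ∣ z
  norm_v : v.norm = l
  char_star : quadraticChar (ZMod l) (red (star v)) = -1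

namespace GaussPrime

variable {l : ℕ} [Fact l.Prime] (P : GaussPrime l)

/-- The complex conjugate prime. -/
def conj : GaussPrime l where
  v := star P.v
  red := P.red.comp (starRingEnd GaussianInt)
  red_eq_zero z := by
    change P.red (star z) = 0 ↔ _
    rw [P.red_eq_zero]
    constructor
    · rintro ⟨w, hw⟩
      exact ⟨star w, by rw [← star_mul', ← hw, star_star]⟩
    · rintro ⟨w, hw⟩
      exact ⟨star w, by rw [hw, star_mul', star_star]⟩
  norm_v := by rw [Zsqrtd.norm_conj, P.norm_v]
  char_star := by
    change quadraticChar (ZMod l) (P.red (star (star (star P.v)))) = -1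
    rw [star_star, P.char_star]

theorem conj_v : P.conj.v = star P.v := rfl

theorem conj_conj_v : P.conj.conj.v = P.v := star_star _

theorem conj_red (z : GaussianInt) : P.conj.red z = P.red (star z) := rfl

theorem mul_conj : P.v * P.conj.v = l := by
  rw [conj_v, ← Zsqrtd.norm_eq_mul_conj, P.norm_v]
  simp

theorem red_v : P.red P.v = 0 := (P.red_eq_zero _).2 dvd_rfl

theorem red_norm (z : GaussianInt) : ((z.norm : ℤ) : ZMod l) = P.red z * P.conj.red z := by
  rw [conj_red, ← map_mul, ← Zsqrtd.norm_eq_mul_conj, map_intCast]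

theorem prime : Prime P.v := by
  refine ⟨?_, ?_, ?_⟩
  · intro h
    have := P.norm_v
    rw [h, Zsqrtd.norm_zero] at this
    exact (Fact.out : l.Prime).ne_zero (by exact_mod_cast this.symm)
  · intro h
    have h1 := (P.red_eq_zero 1).2 (isUnit_iff_dvd_one.mp h)
    simp at h1
  · intro a b
    rw [← P.red_eq_zero, ← P.red_eq_zero, ← P.red_eq_zero, map_mul, mul_eq_zero]
    exact id

theorem char_I (hl : l % 8 = 5) : quadraticChar (ZMod l) (P.red ⟨0, 1⟩) = -1 := by
  apply quadraticChar_sqrt_neg_one hl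
  rw [← map_mul]
  have : (⟨0, 1⟩ : GaussianInt) * ⟨0, 1⟩ = -1 := by decide
  rw [this, map_neg, map_one]

end GaussPrime

theorem quadraticChar_odd_part {l x y : ℕ} [Fact l.Prime] (hl : l % 8 = 5)
    (h : x ^ 2 + y ^ 2 = l) (hx : x % 2 = 1) : quadraticChar (ZMod l) (x : ZMod l) = 1 := by
  have hlp : l.Prime := Fact.out
  have hcop : Nat.gcd y x = 1 := by
    have h1 : Nat.gcd y x * Nat.gcd y x ∣ l := by
      rw [← h, sq, sq]
      exact dvd_add (mul_dvd_mul (Nat.gcd_dvd_right _ _) (Nat.gcd_dvd_right _ _))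
        (mul_dvd_mul (Nat.gcd_dvd_left _ _) (Nat.gcd_dvd_left _ _))
    exact Nat.isUnit_iff.mp (hlp.prime.squarefree _ h1)
  have h1 := jacobiSym.quadratic_reciprocity_one_mod_four (a := l) (b := x) (by omega)
    (Nat.odd_iff.mpr hx)
  have h2 : jacobiSym (l : ℤ) x = 1 := by
    rw [jacobiSym.mod_left' (a₂ := (y : ℤ) ^ 2), jacobiSym.sq_one' (by simpa using hcop)]
    rw [← h]
    push_cast
    rw [sq (x : ℤ), Int.mul_add_emod_self_left]
  rw [h2, ← jacobiSym.legendreSym.to_jacobiSym] at h1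
  simpa [legendreSym] using h1.symm

theorem exists_gaussPrime {l : ℕ} [Fact l.Prime] (hl : l % 8 = 5) : Nonempty (GaussPrime l) := by
  have hlp : l.Prime := Fact.out
  obtain ⟨x, y, hxy, hx⟩ : ∃ x y : ℕ, x ^ 2 + y ^ 2 = l ∧ x % 2 = 1 := by
    obtain ⟨x, y, h⟩ := Nat.Prime.sq_add_sq (p := l) (by omega)
    rcases Nat.mod_two_eq_zero_or_one x with hx | hx
    · refine ⟨y, x, by rw [← h, add_comm], ?_⟩
      by_contra hy
      have h1 : 2 ∣ x ^ 2 := Dvd.dvd.pow (Nat.dvd_of_mod_eq_zero hx) (by norm_num)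
      have h2 : 2 ∣ y ^ 2 := Dvd.dvd.pow (by omega) (by norm_num)
      omega
    · exact ⟨x, y, h, hx⟩
  have hxy' : (x : ZMod l) ^ 2 + (y : ZMod l) ^ 2 = 0 := by
    have := congrArg (Nat.cast : ℕ → ZMod l) hxy
    simpa using this
  have hy0 : (y : ZMod l) ≠ 0 := by
    intro h
    rw [ZMod.natCast_eq_zero_iff] at h
    have hy := Nat.le_of_dvd (Nat.pos_of_ne_zero ?_) h
    · have : 0 < x := by omega
      rw [← hxy] at hy
      have h1 := Nat.le_self_pow two_ne_zero y
      have h2 : 0 < x ^ 2 := by positivity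
      omega
    · rintro rfl
      have : ¬ IsSquare l := hlp.prime.irreducible.not_isSquare
      exact this ⟨x, by rw [← hxy]; ring⟩
  set t : ZMod l := -x * (y : ZMod l)⁻¹ with ht
  have hty : t * y = -x := by rw [ht]; field_simp
  have htt : t * t = ((-1 : ℤ) : ZMod l) := by
    have : (t * t + 1) * (y : ZMod l) ^ 2 = 0 := by linear_combination (t * y - x) * hty + hxy'
    rw [mul_eq_zero, or_iff_left (pow_ne_zero 2 hy0)] at this
    push_cast
    linear_combination this
  refine ⟨⟨⟨x, y⟩, Zsqrtd.lift ⟨t, htt⟩, ?_, ?_, ?_⟩⟩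
  · rintro ⟨a, b⟩
    rw [Zsqrtd.lift_apply_apply]
    push_cast at htt ⊢
    constructor
    · intro h
      have h1 : (l : ℤ) ∣ a * x + b * y := by
        rw [← ZMod.intCast_zmod_eq_zero_iff_dvd _ l]
        push_cast
        linear_combination (x : ZMod l) * h - (b : ZMod l) * t * hty + b * y * htt
      have h2 : (l : ℤ) ∣ b * x - a * y := by
        rw [← ZMod.intCast_zmod_eq_zero_iff_dvd _ l]
        push_cast
        linear_combination (-y : ZMod l) * h + (b : ZMod l) * hty
      obtain ⟨m, hm⟩ := h1
      obtain ⟨n, hn⟩ := h2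
      have hlz : (x : ℤ) ^ 2 + (y : ℤ) ^ 2 = l := by exact_mod_cast hxy
      have hl0 : (l : ℤ) ≠ 0 := by exact_mod_cast hlp.ne_zero
      refine ⟨⟨m, n⟩, ?_⟩
      ext
      · apply mul_left_cancel₀ hl0
        rw [Zsqrtd.re_mul]
        push_cast
        linear_combination -(a : ℤ) * hlz + x * hm - y * hn
      · apply mul_left_cancel₀ hl0
        rw [Zsqrtd.im_mul]
        push_cast
        linear_combination -(b : ℤ) * hlz + y * hm + x * hn
    · rintro ⟨⟨m, n⟩, h⟩
      have h1 := congrArg Zsqrtd.re h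
      have h2 := congrArg Zsqrtd.im h
      simp at h1 h2
      subst h1 h2
      push_cast
      linear_combination (m + n * t : ZMod l) * hty - n * y * htt
  · simp [Zsqrtd.norm_def]
    zify at hxy
    linarith
  · have h1 : Zsqrtd.lift ⟨t, htt⟩ (star (⟨x, y⟩ : GaussianInt)) = (2 : ZMod l) * x := by
      rw [Zsqrtd.lift_apply_apply]
      simp
      linear_combination -hty
    rw [h1, map_mul, quadraticChar_two' hl, quadraticChar_odd_part hl hxy hx, mul_one]

abbrev gI : GaussianInt := ⟨0, 1⟩

theorem gI_mul_gI : gI * gI = -1 := by decide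

theorem gaussianInt_isUnit {u : GaussianInt} (hu : IsUnit u) : ∃ k : ℕ, u = gI ^ k := by
  have h1 : u.norm.natAbs = 1 := Zsqrtd.norm_eq_one_iff.mpr hu
  obtain ⟨x, y⟩ := u
  rw [Zsqrtd.norm_def] at h1
  have h2 : x * x + y * y = 1 := by
    have : 0 ≤ x * x + y * y := by nlinarith
    simp at h1 ⊢
    omega
  have hx1 : x ≤ 1 := by nlinarith
  have hx2 : -1 ≤ x := by nlinarith
  have hy1 : y ≤ 1 := by nlinarith
  have hy2 : -1 ≤ y := by nlinarith
  interval_cases x <;> interval_cases y <;> simp at h2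
  · exact ⟨2, by decide⟩
  · exact ⟨3, by decide⟩
  · exact ⟨1, by decide⟩
  · exact ⟨0, by decide⟩

theorem gI_isUnit : IsUnit gI := IsUnit.of_mul_eq_one (-gI) (by decide)

/-- Solvability of a ternary quadratic form forces a residue symbol at `v`. -/
theorem ternary_descent {l : ℕ} [Fact l.Prime] (P : GaussPrime l) {a b c : GaussianInt}
    (ha : P.red a ≠ 0) (hc : P.red c ≠ 0) {x y z : GaussianInt}
    (h : a * x ^ 2 + b * y ^ 2 + P.v * c * z ^ 2 = 0) (hne : x ≠ 0 ∨ y ≠ 0 ∨ z ≠ 0) :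
    IsSquare (P.red (-(a * b))) := by
  by_contra hns
  have key : ∀ n : ℕ, ∀ x y z : GaussianInt, a * x ^ 2 + b * y ^ 2 + P.v * c * z ^ 2 = 0 →
      x.norm.natAbs + y.norm.natAbs + z.norm.natAbs ≤ n → x = 0 ∧ y = 0 ∧ z = 0 := by
    intro n
    induction n with
    | zero =>
      intro x y z _ hn
      have e : ∀ w : GaussianInt, w.norm.natAbs = 0 → w = 0 := by
        intro w hw
        exact (GaussianInt.norm_eq_zero).mp (Int.natAbs_eq_zero.mp hw)
      exact ⟨e x (by omega), e y (by omega), e z (by omega)⟩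
    | succ n ih =>
      intro x y z h hn
      have h1 : P.red a * P.red x ^ 2 + P.red b * P.red y ^ 2 = 0 := by
        have := congrArg P.red h
        simpa [P.red_v] using this
      have hy : P.red y = 0 := by
        by_contra hy
        apply hns
        refine ⟨P.red a * P.red x / P.red y, ?_⟩
        rw [map_neg, map_mul]
        field_simp
        linear_combination -h1
      have hx : P.red x = 0 := by
        rw [hy] at h1
        simpa [ha] using h1
      rw [P.red_eq_zero] at hx hy
      obtain ⟨x', rfl⟩ := hx
      obtain ⟨y', rfl⟩ := hy
      have hv := P.prime
      have h2 : c * z ^ 2 = P.v * (-(a * x' ^ 2 + b * y' ^ 2)) := by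
        apply mul_left_cancel₀ hv.ne_zero
        linear_combination h
      have hz : P.v ∣ z := by
        rcases hv.dvd_or_dvd (Dvd.intro _ h2.symm : P.v ∣ c * z ^ 2) with h3 | h3
        · exact absurd ((P.red_eq_zero c).2 h3) hc
        · exact hv.dvd_of_dvd_pow h3
      obtain ⟨z', rfl⟩ := hz
      have h3 : a * x' ^ 2 + b * y' ^ 2 + P.v * c * z' ^ 2 = 0 := by
        apply mul_left_cancel₀ (pow_ne_zero 2 hv.ne_zero)
        linear_combination h
      simp only [Zsqrtd.norm_mul, Int.natAbs_mul, P.norm_v, Int.natAbs_natCast] at hn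
      have hl : 2 ≤ l := (Fact.out : l.Prime).two_le
      by_cases h0 : x'.norm.natAbs + y'.norm.natAbs + z'.norm.natAbs = 0
      · obtain ⟨rfl, rfl, rfl⟩ := ih x' y' z' h3 (by omega)
        simp
      · obtain ⟨rfl, rfl, rfl⟩ := ih x' y' z' h3 (by nlinarith)
        simp
  obtain ⟨rfl, rfl, rfl⟩ := key _ x y z h le_rfl
  simp at hne

theorem isSquare_red_of_norm {l : ℕ} [Fact l.Prime] (P : GaussPrime l) {d' m x y z : GaussianInt}
    (hd : P.red d' ≠ 0) (h : x ^ 2 - P.v * d' * y ^ 2 = m * z ^ 2) (hz : z ≠ 0) :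
    IsSquare (P.red m) := by
  by_cases hm : P.red m = 0
  · rw [hm]; exact IsSquare.zero
  have := ternary_descent P (a := 1) (b := -m) (c := -d') (x := x) (y := z) (z := y) (by simp)
    (by simpa using hd) (by linear_combination h) (Or.inr (Or.inl hz))
  simpa using this

theorem isSquare_red_of_norm_ramified {l : ℕ} [Fact l.Prime] (P : GaussPrime l)
    {d' m' x y z : GaussianInt} (hd : P.red d' ≠ 0)
    (h : x ^ 2 - P.v * d' * y ^ 2 = P.v * m' * z ^ 2) (hz : z ≠ 0) :
    IsSquare (P.red (-(d' * m'))) := by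
  obtain ⟨x', rfl⟩ : P.v ∣ x := P.prime.dvd_of_dvd_pow (n := 2)
    ⟨d' * y ^ 2 + m' * z ^ 2, by linear_combination h⟩
  exact ternary_descent P (c := -1) (x := y) (y := z) (z := x') hd (by simp)
    (mul_left_cancel₀ P.prime.ne_zero (by linear_combination -h)) (Or.inr (Or.inl hz))

theorem quadraticChar_of_isSquare {l : ℕ} [Fact l.Prime] {x : ZMod l} (h : IsSquare x)
    (hx : x ≠ 0) : quadraticChar (ZMod l) x = 1 :=
  (quadraticChar_one_iff_isSquare hx).mpr h

theorem natCast_prime_ne_zero {l m : ℕ} [Fact l.Prime] [Fact m.Prime] (h : l ≠ m) :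
    (m : ZMod l) ≠ 0 := by
  rw [Ne, ZMod.natCast_eq_zero_iff]
  intro h1
  exact h ((Nat.prime_dvd_prime_iff_eq Fact.out Fact.out).mp h1)

theorem two_ne_zero_zmod {l : ℕ} [Fact l.Prime] (hl : l % 8 = 5) : (2 : ZMod l) ≠ 0 := by
  intro h
  have := quadraticChar_two' hl
  simp [h] at this

namespace GaussPrime

variable {l : ℕ} [Fact l.Prime] (P : GaussPrime l)

theorem red_gI_ne_zero : P.red gI ≠ 0 := by
  intro h
  have := congrArg P.red gI_mul_gI
  simp [h] at this

theorem red_star_ne_zero : P.red P.conj.v ≠ 0 := by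
  intro h
  have := P.char_star
  rw [← conj_v, h] at this
  simp at this

theorem red_one_add_gI_ne_zero (hl : l % 8 = 5) : P.red (1 + gI) ≠ 0 := by
  intro h
  have h1 : (1 + gI) * (1 - gI) = 2 := by decide
  have := congrArg P.red h1
  rw [map_mul, h, zero_mul] at this
  rw [map_ofNat] at this
  exact two_ne_zero_zmod hl this.symm

theorem char_one_add_gI (hl : l % 8 = 5) : quadraticChar (ZMod l) (P.red (1 + gI)) *
    quadraticChar (ZMod l) (P.conj.red (1 + gI)) = -1 := by
  rw [← map_mul, ← P.red_norm]
  have : (1 + gI : GaussianInt).norm = 2 := by decide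
  rw [this]
  exact_mod_cast quadraticChar_two' hl

theorem char_conj : quadraticChar (ZMod l) (P.red P.conj.v) = -1 := P.char_star

end GaussPrime

section norms

variable {p q : ℕ} [Fact p.Prime] [Fact q.Prime]

/-- The condition at `P` for `i^e π₁^a π₂^b (1+i)^c` to be a norm. -/
theorem char_condition (hp : p % 8 = 5) (hne : p ≠ q) (P : GaussPrime p)
    {e a b c : ℕ} (ha : a ≤ 1) {x y z : GaussianInt} (hz : z ≠ 0)
    (h : x ^ 2 - (-gI * (p * q)) * y ^ 2 =
      gI ^ e * P.v ^ a * P.conj.v ^ b * (1 + gI) ^ c * z ^ 2) :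
    (-1) ^ e * (-1) ^ b * quadraticChar (ZMod p) q ^ a *
      quadraticChar (ZMod p) (P.red (1 + gI)) ^ c = 1 := by
  have hI := P.red_gI_ne_zero
  have hs := P.red_star_ne_zero
  have h1 := P.red_one_add_gI_ne_zero hp
  have hq : P.red (q : GaussianInt) ≠ 0 := by
    rw [map_natCast]; exact natCast_prime_ne_zero hne
  have hd : P.red (-gI * P.conj.v * q) ≠ 0 := by
    rw [map_mul, map_mul, map_neg]
    exact mul_ne_zero (mul_ne_zero (neg_ne_zero.mpr hI) hs) hq
  have cI : quadraticChar (ZMod p) (P.red gI) = -1 := P.char_I hp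
  have cs := P.char_conj
  have hv := P.mul_conj
  interval_cases a
  · have hm : P.red (gI ^ e * P.conj.v ^ b * (1 + gI) ^ c) ≠ 0 := by
      simp only [map_mul, map_pow]
      exact mul_ne_zero (mul_ne_zero (pow_ne_zero _ hI) (pow_ne_zero _ hs)) (pow_ne_zero _ h1)
    have := quadraticChar_of_isSquare (isSquare_red_of_norm P hd
      (m := gI ^ e * P.conj.v ^ b * (1 + gI) ^ c) (x := x) (y := y) (z := z)
      (by linear_combination h + gI * y ^ 2 * q * hv) hz) hm
    simp only [map_mul, map_pow, cI, cs] at this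
    rw [pow_zero, mul_one, this]
  · have hm' : P.red (gI ^ e * P.conj.v ^ b * (1 + gI) ^ c) ≠ 0 := by
      simp only [map_mul, map_pow]
      exact mul_ne_zero (mul_ne_zero (pow_ne_zero _ hI) (pow_ne_zero _ hs)) (pow_ne_zero _ h1)
    have := quadraticChar_of_isSquare (isSquare_red_of_norm_ramified P hd
      (m' := gI ^ e * P.conj.v ^ b * (1 + gI) ^ c)
      (x := x) (y := y) (z := z) (by linear_combination h + gI * y ^ 2 * q * hv) hz)
      (by rw [map_neg, map_mul]; exact neg_ne_zero.mpr (mul_ne_zero hd hm'))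
    have e1 : -(-gI * P.conj.v * q * (gI ^ e * P.conj.v ^ b * (1 + gI) ^ c)) =
      gI * P.conj.v * q * (gI ^ e * P.conj.v ^ b * (1 + gI) ^ c) := by ring
    rw [e1] at this
    simp only [map_mul, map_pow, cI, cs, map_natCast] at this
    linear_combination this

theorem char_condition_norm (P : GaussPrime q) {d' m x y z : GaussianInt}
    (hd : P.red d' ≠ 0) (hd' : P.conj.red d' ≠ 0) (hm : (m.norm : ZMod q) ≠ 0)
    (h : x ^ 2 - q * d' * y ^ 2 = m * z ^ 2) (hz : z ≠ 0) :
    quadraticChar (ZMod q) m.norm = 1 := by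
  rw [P.red_norm] at hm ⊢
  have h1 := isSquare_red_of_norm P (d' := P.conj.v * d') (m := m) (x := x) (y := y) (z := z)
    (by rw [map_mul]; exact mul_ne_zero P.red_star_ne_zero hd)
    (by rw [← h, ← P.mul_conj]; ring) hz
  have h2 := isSquare_red_of_norm P.conj (d' := P.v * d') (m := m) (x := x) (y := y) (z := z)
    (by
      rw [map_mul, ← P.conj_conj_v]
      exact mul_ne_zero P.conj.red_star_ne_zero hd')
    (by rw [← h, ← P.mul_conj]; ring) hz
  exact quadraticChar_of_isSquare (h1.mul h2) hm

theorem norm_gI : (gI).norm = 1 := by decide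

theorem norm_one_add_gI : (1 + gI).norm = 2 := by decide

theorem norm_pow_gaussian (z : GaussianInt) (n : ℕ) : (z ^ n).norm = z.norm ^ n :=
  map_pow Zsqrtd.normMonoidHom z n

/-- `i^e π₁^a π₂^b (1+i)^c` is, up to squares, a norm from `ℚ(i, √(-ipq))` only if it is
trivial. -/
theorem trivial_of_norm (hp : p % 8 = 5) (hq : q % 8 = 5) (hne : p ≠ q) (P : GaussPrime p)
    {e a b c : ℕ} (ha : a ≤ 1) (hb : b ≤ 1) (hc : c ≤ 1) {x y z : GaussianInt} (hz : z ≠ 0)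
    (h : x ^ 2 - (-gI * (p * q)) * y ^ 2 =
      gI ^ e * P.v ^ a * P.conj.v ^ b * (1 + gI) ^ c * z ^ 2) : a = 0 ∧ b = 0 ∧ c = 0 := by
  obtain ⟨Q⟩ := exists_gaussPrime hq
  have S1 := char_condition hp hne P ha hz h
  have S2 := char_condition hp hne P.conj (e := e) (a := b) (b := a) (c := c) (x := x) (y := y) hb hz
    (by rw [P.conj_conj_v]; linear_combination h)
  have ht := P.char_one_add_gI hp
  have hpq : (p : ZMod q) ≠ 0 := natCast_prime_ne_zero hne.symm
  have hdQ : ∀ Q : GaussPrime q, Q.red (-gI * p) ≠ 0 := by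
    intro Q
    rw [map_mul, map_neg, map_natCast]
    exact mul_ne_zero (neg_ne_zero.mpr Q.red_gI_ne_zero) hpq
  have hnorm : (gI ^ e * P.v ^ a * P.conj.v ^ b * (1 + gI) ^ c).norm = p ^ (a + b) * 2 ^ c := by
    simp only [Zsqrtd.norm_mul, norm_pow_gaussian, norm_gI, norm_one_add_gI, P.norm_v,
      P.conj.norm_v, one_pow]
    ring
  have R := char_condition_norm Q (hdQ Q) (hdQ Q.conj) (by
    rw [hnorm]
    push_cast
    exact mul_ne_zero (pow_ne_zero _ hpq) (pow_ne_zero _ (two_ne_zero_zmod hq)))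
    (x := x) (y := y) (by rw [← h]; ring) hz
  rw [hnorm] at R
  push_cast at R
  rw [map_mul, map_pow, map_pow, quadraticChar_two' hq, ← quadraticChar_swap hp hq] at R
  have hr := quadraticChar_dichotomy (F := ZMod p) (natCast_prime_ne_zero (l := p) (m := q) hne)
  generalize quadraticChar (ZMod p) (P.red (1 + gI)) = t1 at *
  generalize quadraticChar (ZMod p) (P.conj.red (1 + gI)) = t2 at *
  have he := neg_one_pow_eq_or ℤ e
  have hcon : c = 0 ∧ a = b := by
    generalize (-1 : ℤ) ^ e = E at *
    generalize quadraticChar (ZMod p) (q : ZMod p) = r at *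
    interval_cases a <;> interval_cases b <;> interval_cases c <;>
      rcases hr with rfl | rfl <;> rcases he with rfl | rfl <;> simp at S1 S2 R ht ⊢ <;>
      simp_all
    all_goals
      have e1 : t1 = -1 := by omega
      have e2 : t2 = -1 := by omega
      rw [e1, e2] at ht
      omega
  obtain ⟨rfl, rfl⟩ := hcon
  have hm : Q.red (gI ^ e * (p : GaussianInt) ^ a) ≠ 0 := by
    rw [map_mul, map_pow, map_pow, map_natCast]
    exact mul_ne_zero (pow_ne_zero _ Q.red_gI_ne_zero) (pow_ne_zero _ hpq)
  have T := quadraticChar_of_isSquare (isSquare_red_of_norm Q (d' := Q.conj.v * (-gI * p))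
    (m := gI ^ e * (p : GaussianInt) ^ a) (x := x) (y := y) (z := z)
    (by rw [map_mul]; exact mul_ne_zero Q.red_star_ne_zero (hdQ Q))
    (by
      have e1 : x ^ 2 - Q.v * (Q.conj.v * (-gI * p)) * y ^ 2 = x ^ 2 - (-gI * (p * q)) * y ^ 2 := by
        rw [← Q.mul_conj]; ring
      rw [e1, h, ← P.mul_conj]
      ring) hz) hm
  have cI : quadraticChar (ZMod q) (Q.red gI) = -1 := Q.char_I hq
  rw [map_mul, map_pow, map_pow, map_natCast, map_mul, map_pow, map_pow, cI,
    ← quadraticChar_swap hp hq] at T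
  generalize (-1 : ℤ) ^ e = E at *
  generalize quadraticChar (ZMod p) (q : ZMod p) = r at *
  interval_cases a
  · simp
  · rcases hr with rfl | rfl <;> rcases he with rfl | rfl <;> simp at S1 T

/-- Over `ℚ(i, √(-iq))`. -/
theorem not_norm_one_add_gI (hq : q % 8 = 5) {e : ℕ} {x y z : GaussianInt} (hz : z ≠ 0)
    (h : x ^ 2 - (-gI * q) * y ^ 2 = gI ^ e * (1 + gI) * z ^ 2) : False := by
  obtain ⟨Q⟩ := exists_gaussPrime hq
  have hn : (gI ^ e * (1 + gI)).norm = 2 := by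
    simp only [Zsqrtd.norm_mul, norm_pow_gaussian, norm_gI, norm_one_add_gI, one_pow]
    norm_num
  have hdQ : ∀ Q : GaussPrime q, Q.red (-gI) ≠ 0 := by
    intro Q
    rw [map_neg]
    exact neg_ne_zero.mpr Q.red_gI_ne_zero
  have := char_condition_norm Q (hdQ Q) (hdQ Q.conj)
    (by rw [hn]; exact_mod_cast two_ne_zero_zmod hq) (x := x) (y := y) (by rw [← h]; ring) hz
  rw [hn] at this
  push_cast at this
  rw [quadraticChar_two' hq] at this
  simp at this

end norms

theorem isCoprime_star_of_two {s x y : GaussianInt} (h : x * s + y * star s = 2)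
    (hn : s.norm % 2 = 1) : IsCoprime s (star s) := by
  have h1 : s * star s = 2 * ((s.norm / 2 : ℤ) : GaussianInt) + 1 := by
    rw [← Zsqrtd.norm_eq_mul_conj]
    have : s.norm = 2 * (s.norm / 2) + 1 := by omega
    exact_mod_cast congrArg (Int.cast : ℤ → GaussianInt) this
  refine ⟨star s - ((s.norm / 2 : ℤ) : GaussianInt) * x, - ((s.norm / 2 : ℤ) : GaussianInt) * y, ?_⟩
  linear_combination h1 - ((s.norm / 2 : ℤ) : GaussianInt) * h

theorem exists_prime_factor {l : ℕ} [Fact l.Prime] (P : GaussPrime l) {s : GaussianInt}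
    (hs : IsCoprime s (star s)) {n : ℤ} (hn : s.norm = l * n) :
    ∃ P' : GaussPrime l, (P' = P ∨ P' = P.conj) ∧
      ∃ s₁, s = P'.v * s₁ ∧ IsCoprime s₁ (star s₁) ∧ s₁.norm = n := by
  have h1 : P.red s = 0 ∨ P.conj.red s = 0 := by
    rw [← mul_eq_zero, ← P.red_norm, hn]
    simp
  have key : ∀ P' : GaussPrime l, P'.red s = 0 →
      ∃ s₁, s = P'.v * s₁ ∧ IsCoprime s₁ (star s₁) ∧ s₁.norm = n := by
    intro P' h
    obtain ⟨s₁, h2⟩ := (P'.red_eq_zero s).1 h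
    refine ⟨s₁, h2, ?_, ?_⟩
    · rw [h2, star_mul'] at hs
      exact hs.of_mul_left_right.of_mul_right_right
    · rw [h2, Zsqrtd.norm_mul, P'.norm_v] at hn
      exact mul_left_cancel₀ (by exact_mod_cast (Fact.out : l.Prime).ne_zero) hn
  rcases h1 with h1 | h1
  · exact ⟨P, Or.inl rfl, key _ h1⟩
  · exact ⟨P.conj, Or.inr rfl, key _ h1⟩

theorem exists_unit_mul_sq {s : GaussianInt} (hs : IsCoprime s (star s)) {b : ℤ}
    (hn : s.norm = b ^ 2) : ∃ k w, s = gI ^ k * w ^ 2 := by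
  have h1 : s * star s = (b : GaussianInt) ^ 2 := by
    rw [← Zsqrtd.norm_eq_mul_conj, hn]
    push_cast
    rfl
  obtain ⟨w, u, hu⟩ := exists_associated_pow_of_mul_eq_pow' hs h1
  obtain ⟨k, hk⟩ := gaussianInt_isUnit u.isUnit
  exact ⟨k, w, by rw [← hu, hk, mul_comm]⟩

theorem odd_of_sq_add_one {a b : ℤ} {D : ℤ} (h : a ^ 2 + 1 = D * b ^ 2) : b % 2 = 1 := by
  by_contra hb
  obtain ⟨c, rfl⟩ : ∃ c, b = 2 * c := ⟨b / 2, by omega⟩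
  rcases Int.even_or_odd' a with ⟨n, rfl | rfl⟩
  · have : 4 * (D * c ^ 2 - n ^ 2) = 1 := by linarith
    omega
  · have : 4 * (D * c ^ 2 - n ^ 2 - n) = 2 := by linarith
    omega

theorem odd_mul_sq {b n : ℤ} (hb : b % 2 = 1) (hn : n % 2 = 1) : (n * b ^ 2) % 2 = 1 := by
  rw [Int.mul_emod, sq, Int.mul_emod b b, hb, hn]
  rfl

theorem norm_mk_neg_one (a : ℤ) : (⟨a, -1⟩ : GaussianInt).norm = a ^ 2 + 1 := by
  rw [Zsqrtd.norm_def]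
  ring

theorem exists_one_add_gI_mul {a b n : ℤ} (hn : n % 2 = 1) (h : a ^ 2 + 1 = 2 * n * b ^ 2) :
    ∃ s : GaussianInt, ⟨a, -1⟩ = (1 + gI) * s ∧ IsCoprime s (star s) ∧ s.norm = n * b ^ 2 := by
  have hb := odd_of_sq_add_one h
  obtain ⟨c, hc⟩ : ∃ c, a = 2 * c + 1 := by
    refine ⟨a / 2, ?_⟩
    by_contra h1
    obtain ⟨c, rfl⟩ : ∃ c, a = 2 * c := ⟨a / 2, by omega⟩
    have : 2 * (n * b ^ 2 - 2 * c ^ 2) = 1 := by linarith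
    omega
  have hs : (⟨a, -1⟩ : GaussianInt) = (1 + gI) * ⟨c, -(c + 1)⟩ := by
    ext <;> simp [hc]
    ring
  have hnorm : (⟨c, -(c + 1)⟩ : GaussianInt).norm = n * b ^ 2 := by
    have := norm_mk_neg_one a
    rw [hs, Zsqrtd.norm_mul, norm_one_add_gI] at this
    linarith
  refine ⟨⟨c, -(c + 1)⟩, hs, ?_, hnorm⟩
  refine isCoprime_star_of_two (x := gI * (1 + gI)) (y := -gI * (1 - gI)) ?_ ?_
  · ext <;> simp
  · rw [hnorm]
    exact odd_mul_sq hb hn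

section factorization

variable {p q : ℕ} [Fact p.Prime] [Fact q.Prime]

theorem neg_pell_factor_prime (hp : p % 8 = 5) (P : GaussPrime p) :
    ∃ a b : ℤ, a ^ 2 + 1 = p * b ^ 2 ∧ ∃ P' : GaussPrime p, (P' = P ∨ P' = P.conj) ∧
      ∃ k w, (⟨a, -1⟩ : GaussianInt) = gI ^ k * P'.v * w ^ 2 := by
  obtain ⟨a, b, h⟩ := neg_pell_prime hp
  have hcop : IsCoprime (⟨a, -1⟩ : GaussianInt) (star ⟨a, -1⟩) := by
    refine isCoprime_star_of_two (x := gI) (y := -gI) ?_ ?_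
    · ext <;> simp
    · rw [norm_mk_neg_one, h]
      exact odd_mul_sq (odd_of_sq_add_one h) (by omega)
  obtain ⟨P', hP', s, hs, hc, hn⟩ := exists_prime_factor P hcop
    (by rw [norm_mk_neg_one, h])
  obtain ⟨k, w, rfl⟩ := exists_unit_mul_sq hc hn
  exact ⟨a, b, h, P', hP', k, w, by rw [hs]; ring⟩

theorem neg_pell_factor_two_mul (hq : q % 8 = 5) (Q : GaussPrime q) :
    ∃ a b : ℤ, a ^ 2 + 1 = 2 * q * b ^ 2 ∧ ∃ Q' : GaussPrime q, (Q' = Q ∨ Q' = Q.conj) ∧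
      ∃ k w, (⟨a, -1⟩ : GaussianInt) = gI ^ k * ((1 + gI) * Q'.v) * w ^ 2 := by
  obtain ⟨a, b, h⟩ := neg_pell_two_mul hq
  obtain ⟨s, hs, hc, hn⟩ := exists_one_add_gI_mul (n := q) (by omega) h
  obtain ⟨Q', hQ', t, ht, hc, hn⟩ := exists_prime_factor Q hc hn
  obtain ⟨k, w, rfl⟩ := exists_unit_mul_sq hc hn
  exact ⟨a, b, h, Q', hQ', k, w, by rw [hs, ht]; ring⟩

theorem neg_pell_factor_two_mul_mul (hp : p % 8 = 5) (hq : q % 8 = 5) (hne : p ≠ q)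
    (P : GaussPrime p) (Q : GaussPrime q) :
    ∃ a b : ℤ, a ^ 2 + 1 = 2 * p * q * b ^ 2 ∧
      ∃ P' : GaussPrime p, (P' = P ∨ P' = P.conj) ∧
      ∃ Q' : GaussPrime q, (Q' = Q ∨ Q' = Q.conj) ∧
      ∃ k w, (⟨a, -1⟩ : GaussianInt) = gI ^ k * ((1 + gI) * P'.v * Q'.v) * w ^ 2 := by
  obtain ⟨a, b, h⟩ := neg_pell_two_mul_mul hp hq hne
  obtain ⟨s, hs, hc, hn⟩ := exists_one_add_gI_mul (n := p * q) (a := a) (b := b)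
    (by rw [Int.mul_emod]; have : (p : ℤ) % 2 = 1 := by omega
        have h2 : (q : ℤ) % 2 = 1 := by omega
        rw [this, h2]; rfl) (by rw [h]; ring)
  obtain ⟨P', hP', r, hr, hc, hn⟩ := exists_prime_factor P hc (by rw [hn, mul_assoc])
  obtain ⟨Q', hQ', t, ht, hc, hn⟩ := exists_prime_factor Q hc hn
  obtain ⟨k, w, rfl⟩ := exists_unit_mul_sq hc hn
  exact ⟨a, b, h, P', hP', Q', hQ', k, w, by rw [hs, hr, ht]; ring⟩

end factorization

section Dedekind

variable {R : Type*} [CommRing R] [IsDedekindDomain R]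

theorem Ideal.eq_of_sq_eq {I J : Ideal R} (h : I ^ 2 = J ^ 2) : I = J := by
  refine dvd_antisymm ?_ ?_
  · exact (UniqueFactorizationMonoid.pow_dvd_pow_iff_dvd two_ne_zero).1 h.dvd
  · exact (UniqueFactorizationMonoid.pow_dvd_pow_iff_dvd two_ne_zero).1 h.symm.dvd

omit [IsDedekindDomain R] in
theorem Ideal.span_ne_bot {x : R} (hx : x ≠ 0) : Ideal.span {x} ≠ ⊥ := by
  simpa [Ideal.span_singleton_eq_bot] using hx

theorem exists_mul_principal_coprime {I N : Ideal R} (hI : I ≠ ⊥) (hN : N ≠ ⊥) :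
    ∃ (C : Ideal R) (a : R), a ≠ 0 ∧ I * C = Ideal.span {a} ∧ C ⊔ N = ⊤ := by
  by_cases hT : N = ⊤
  · obtain ⟨x, hx, hx0⟩ := Submodule.exists_mem_ne_zero_of_ne_bot hI
    obtain ⟨C, hC⟩ := Ideal.dvd_span_singleton.2 hx
    exact ⟨C, x, hx0, hC.symm, by simp [hT]⟩
  obtain ⟨a, ha⟩ := IsDedekindDomain.exists_sup_span_eq (I := I * N) (J := I) Ideal.mul_le_left
    (mul_ne_zero hI hN)
  have haI : a ∈ I := by
    rw [← ha]
    exact Ideal.mem_sup_right (Ideal.mem_span_singleton_self a)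
  obtain ⟨C, hC⟩ := Ideal.dvd_span_singleton.2 haI
  have hCN : N ⊔ C = ⊤ := by
    apply mul_left_cancel₀ hI
    rw [Ideal.mul_sup, ← hC, ha, Ideal.mul_top]
  refine ⟨C, a, ?_, hC.symm, by rw [sup_comm, hCN]⟩
  rintro rfl
  have hC0 : C = ⊥ := by
    have : I * C = 0 := by rw [← hC]; simp
    exact (mul_eq_zero.1 this).resolve_left hI
  apply hT
  simpa [hC0] using hCN

theorem Ideal.exists_span_pair {I : Ideal R} (hI : I ≠ ⊥) : ∃ x y, x ≠ 0 ∧ I = Ideal.span {x, y} := by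
  obtain ⟨x, hx, hx0⟩ := Submodule.exists_mem_ne_zero_of_ne_bot hI
  obtain ⟨y, hy⟩ := IsDedekindDomain.exists_eq_span_pair hx hx0
  exact ⟨x, y, hx0, hy⟩

end Dedekind

/-- A degree two extension of rings: `j` embeds `S` as the fixed ring of the involution `s`. -/
structure Layer (S R : Type*) [CommRing S] [CommRing R] where
  j : S →+* R
  s : R ≃+* R
  inj : Function.Injective j
  invol : ∀ x, s (s x) = x
  fix : ∀ x, s (j x) = j x
  desc : ∀ x, s x = x → ∃ y, j y = x

namespace Layer

section basic

variable {S R : Type*} [CommRing S] [CommRing R] (Λ : Layer S R)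

theorem j_ne_zero {x : S} (hx : x ≠ 0) : Λ.j x ≠ 0 := (map_ne_zero_iff _ Λ.inj).2 hx

theorem exists_norm (x : R) : ∃ n, Λ.j n = x * Λ.s x :=
  Λ.desc _ (by rw [map_mul, Λ.invol, mul_comm])

theorem exists_trace (x : R) : ∃ n, Λ.j n = x + Λ.s x :=
  Λ.desc _ (by rw [map_add, Λ.invol, add_comm])

theorem map_map_s (I : Ideal R) : (I.map Λ.s).map Λ.s = I := by
  ext x
  simp only [Ideal.mem_map_of_equiv]
  constructor
  · rintro ⟨_, ⟨y, hy, rfl⟩, rfl⟩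
    rwa [Λ.invol]
  · intro hx
    exact ⟨_, ⟨x, hx, rfl⟩, Λ.invol x⟩

theorem map_s_span (x : R) : (Ideal.span {x}).map Λ.s = Ideal.span {Λ.s x} := by
  rw [Ideal.map_span, Set.image_singleton]

theorem s_mem {P : Ideal R} {x : R} (hx : x ∈ P) : Λ.s x ∈ P.map Λ.s :=
  Ideal.mem_map_of_mem _ hx

theorem isIntegral : Λ.j.IsIntegral := by
  intro x
  obtain ⟨n, hn⟩ := Λ.exists_norm x
  obtain ⟨t, ht⟩ := Λ.exists_trace x
  refine ⟨Polynomial.X ^ 2 - Polynomial.C t * Polynomial.X + Polynomial.C n, ?_, ?_⟩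
  · nontriviality S
    monicity!
  · simp only [Polynomial.eval₂_add, Polynomial.eval₂_sub, Polynomial.eval₂_pow,
      Polynomial.eval₂_X, Polynomial.eval₂_mul, Polynomial.eval₂_C, ht, hn]
    ring

theorem map_s_ne_bot {I : Ideal R} (hI : I ≠ ⊥) : I.map Λ.s ≠ ⊥ := by
  intro h
  apply hI
  rw [← Λ.map_map_s I, h, Ideal.map_bot]

theorem s_ne_zero {x : R} (hx : x ≠ 0) : Λ.s x ≠ 0 := (map_ne_zero_iff _ Λ.s.injective).2 hx

theorem map_j_ne_bot {B : Ideal S} (hB : B ≠ ⊥) : B.map Λ.j ≠ ⊥ := by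
  intro h
  apply hB
  rwa [Ideal.map_eq_bot_iff_of_injective Λ.inj] at h

end basic

variable {S R : Type*} [CommRing S] [CommRing R] [IsDedekindDomain R] (Λ : Layer S R)

theorem exists_map_eq (I : Ideal R) : ∃ B : Ideal S, B.map Λ.j = I * I.map Λ.s := by
  by_cases hI : I = ⊥
  · exact ⟨⊥, by simp [hI]⟩
  obtain ⟨x, y, hx, rfl⟩ := Ideal.exists_span_pair hI
  obtain ⟨a, ha⟩ := Λ.exists_norm x
  obtain ⟨b, hb⟩ := Λ.exists_norm y
  obtain ⟨t, ht⟩ := Λ.exists_trace (x * Λ.s y)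
  rw [map_mul, Λ.invol] at ht
  refine ⟨Ideal.span {a, b, t}, ?_⟩
  set A := x * Λ.s y with hA
  have hm : Ideal.span {x, y} * (Ideal.span {x, y}).map Λ.s
      = Ideal.span {x * Λ.s x, x * Λ.s y, y * Λ.s x, y * Λ.s y} := by
    rw [Ideal.map_span, Set.image_pair, Ideal.span_pair_mul_span_pair]
  have hB : (Ideal.span {a, b, t}).map Λ.j = Ideal.span {Λ.j a, Λ.j b, Λ.j t} := by
    rw [Ideal.map_span, Set.image_insert_eq, Set.image_pair]
  have hAB : A ∈ Ideal.span {Λ.j a, Λ.j b, Λ.j t} := by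
    set B := Ideal.span {Λ.j a, Λ.j b, Λ.j t} with hBdef
    have hB0 : B ≠ ⊥ := by
      intro h
      have : Λ.j a ∈ B := Ideal.subset_span (by simp)
      rw [h, Ideal.mem_bot, ha] at this
      exact mul_ne_zero hx (Λ.s_ne_zero hx) this
    have hle : (Ideal.span {A} ⊔ B) * (Ideal.span {A} ⊔ B) ≤ B * (Ideal.span {A} ⊔ B) := by
      rw [Ideal.sup_mul, Ideal.mul_sup]
      have hA2 : Ideal.span {A} * Ideal.span {A} ≤ B * (Ideal.span {A} ⊔ B) := by
        rw [Ideal.span_singleton_mul_span_singleton, Ideal.span_singleton_le_iff_mem]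
        have : A * A = Λ.j t * A - Λ.j a * Λ.j b := by
          rw [ht, ha, hb, hA]; ring
        rw [this]
        refine Ideal.sub_mem _ (Ideal.mul_mem_mul (Ideal.subset_span (by simp))
          (Ideal.mem_sup_left (Ideal.mem_span_singleton_self A))) (Ideal.mul_mem_mul
          (Ideal.subset_span (by simp)) (Ideal.mem_sup_right (Ideal.subset_span (by simp))))
      refine sup_le (sup_le hA2 ?_) (Ideal.mul_mono_right le_rfl)
      rw [mul_comm]
      exact Ideal.mul_mono_right le_sup_left
    have hC0 : Ideal.span {A} ⊔ B ≠ ⊥ := fun h => hB0 (le_bot_iff.1 (h ▸ le_sup_right))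
    have := Ideal.dvd_iff_le.2 hle
    rw [mul_dvd_mul_iff_right hC0, Ideal.dvd_iff_le] at this
    exact this (Ideal.mem_sup_left (Ideal.mem_span_singleton_self A))
  rw [hm, hB]
  apply le_antisymm
  · rw [Ideal.span_le]
    rintro z (rfl | rfl | rfl)
    · rw [ha]; exact Ideal.subset_span (by simp)
    · rw [hb]; exact Ideal.subset_span (by simp)
    · rw [ht]
      refine Ideal.add_mem _ (Ideal.subset_span (by simp [hA])) (Ideal.subset_span ?_)
      simp [mul_comm]
  · rw [Ideal.span_le]
    rintro z (rfl | rfl | rfl | rfl)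
    · rw [← ha]; exact Ideal.subset_span (by simp)
    · exact hAB
    · have : y * Λ.s x = Λ.j t - A := by rw [ht, hA]; ring
      rw [this]
      exact Ideal.sub_mem _ (Ideal.subset_span (by simp)) hAB
    · rw [← hb]; exact Ideal.subset_span (by simp)

theorem exists_norm_span [IsPrincipalIdealRing S] (I : Ideal R) :
    ∃ g : S, I * I.map Λ.s = Ideal.span {Λ.j g} := by
  obtain ⟨B, hB⟩ := Λ.exists_map_eq I
  refine ⟨Submodule.IsPrincipal.generator B, ?_⟩
  rw [← hB, ← Set.image_singleton, ← Ideal.map_span, Ideal.span_singleton_generator]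

theorem isPrincipal_of_map [IsDedekindDomain S] {B : Ideal S} {x : S} (hx : x ≠ 0)
    (h : B.map Λ.j = Ideal.span {Λ.j x}) : B = Ideal.span {x} := by
  have hle : B ≤ Ideal.span {x} := by
    intro b hb
    have : Λ.j b ∈ Ideal.span {Λ.j x} := h ▸ Ideal.mem_map_of_mem _ hb
    obtain ⟨r, hr⟩ := Ideal.mem_span_singleton'.1 this
    have hs : Λ.s r = r := by
      apply mul_right_cancel₀ (Λ.j_ne_zero hx)
      conv_lhs => rw [← Λ.fix x, ← map_mul, hr, Λ.fix]
      exact hr.symm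
    obtain ⟨y, rfl⟩ := Λ.desc r hs
    rw [← map_mul] at hr
    rw [← Λ.inj hr]
    exact Ideal.mem_span_singleton'.2 ⟨y, rfl⟩
  obtain ⟨D, rfl⟩ := Ideal.dvd_iff_le.2 hle
  have hD : D.map Λ.j = ⊤ := by
    apply mul_left_cancel₀ (Ideal.span_ne_bot (Λ.j_ne_zero hx))
    rw [Ideal.map_mul, Ideal.map_span, Set.image_singleton] at h
    rw [Ideal.mul_top, h]
  rw [(Ideal.map_eq_top_iff Λ.j Λ.inj Λ.isIntegral).1 hD, Ideal.mul_top]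

end Layer

section Classes

variable {R : Type*} [CommRing R] [IsDedekindDomain R]

open Classical in
/-- The class of an ideal (trivial for the zero ideal). -/
noncomputable def idealClass (I : Ideal R) : ClassGroup R :=
  if h : I ∈ nonZeroDivisors (Ideal R) then ClassGroup.mk0 ⟨I, h⟩ else 1

theorem idealClass_of_ne {I : Ideal R} (h : I ≠ ⊥) :
    idealClass I = ClassGroup.mk0 ⟨I, mem_nonZeroDivisors_of_ne_zero h⟩ :=
  dif_pos _

theorem idealClass_mul {I J : Ideal R} (hI : I ≠ ⊥) (hJ : J ≠ ⊥) :
    idealClass (I * J) = idealClass I * idealClass J := by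
  rw [idealClass_of_ne hI, idealClass_of_ne hJ, idealClass_of_ne (mul_ne_zero hI hJ), ← map_mul]
  rfl

theorem idealClass_eq_one_iff {I : Ideal R} (hI : I ≠ ⊥) :
    idealClass I = 1 ↔ ∃ x, x ≠ 0 ∧ I = Ideal.span {x} := by
  rw [idealClass_of_ne hI, ClassGroup.mk0_eq_one_iff]
  constructor
  · rintro ⟨x, hx⟩
    refine ⟨x, ?_, hx⟩
    rintro rfl
    exact hI (by rw [hx]; simp)
  · rintro ⟨x, -, hx⟩
    exact ⟨x, hx⟩

theorem idealClass_span {x : R} (hx : x ≠ 0) : idealClass (Ideal.span {x}) = 1 :=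
  (idealClass_eq_one_iff (Ideal.span_ne_bot hx)).2 ⟨x, hx, rfl⟩

theorem idealClass_top : idealClass (⊤ : Ideal R) = 1 := by
  rw [← Ideal.span_singleton_one, idealClass_span one_ne_zero]

theorem idealClass_pow {I : Ideal R} (hI : I ≠ ⊥) (n : ℕ) :
    idealClass (I ^ n) = idealClass I ^ n := by
  induction n with
  | zero => simp [Ideal.one_eq_top, idealClass_top]
  | succ n ih => rw [pow_succ, idealClass_mul (pow_ne_zero n hI) hI, ih, pow_succ]

theorem idealClass_eq_iff {I J : Ideal R} (hI : I ≠ ⊥) (hJ : J ≠ ⊥) :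
    idealClass I = idealClass J ↔
      ∃ x y : R, x ≠ 0 ∧ y ≠ 0 ∧ Ideal.span {x} * I = Ideal.span {y} * J := by
  rw [idealClass_of_ne hI, idealClass_of_ne hJ, ClassGroup.mk0_eq_mk0_iff]
  simp only [exists_prop, exists_and_left]

theorem exists_idealClass_eq (x : ClassGroup R) : ∃ I : Ideal R, I ≠ ⊥ ∧ idealClass I = x := by
  obtain ⟨⟨I, hI⟩, rfl⟩ := ClassGroup.mk0_surjective x
  have h : I ≠ ⊥ := nonZeroDivisors.ne_zero hI
  exact ⟨I, h, idealClass_of_ne h⟩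

/-- The square of the ideal `I` and the principal ideal `m` differ by the square of a principal
fractional ideal. -/
def SqRep (I : Ideal R) (m : R) : Prop :=
  ∃ x y : R, x ≠ 0 ∧ y ≠ 0 ∧ Ideal.span {x} ^ 2 * I ^ 2 = Ideal.span {y} ^ 2 * Ideal.span {m}

omit [IsDedekindDomain R] in
theorem SqRep.of_sq [Nontrivial R] {I : Ideal R} {m : R} (h : I ^ 2 = Ideal.span {m}) : SqRep I m :=
  ⟨1, 1, one_ne_zero, one_ne_zero, by rw [h]⟩

theorem SqRep.mul {I J : Ideal R} {m n : R} (h : SqRep I m) (h' : SqRep J n) : SqRep (I * J) (m * n) := by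
  obtain ⟨x, y, hx, hy, h⟩ := h
  obtain ⟨x', y', hx', hy', h'⟩ := h'
  refine ⟨x * x', y * y', mul_ne_zero hx hx', mul_ne_zero hy hy', ?_⟩
  simp only [← Ideal.span_singleton_mul_span_singleton, mul_pow]
  calc _ = (Ideal.span {x} ^ 2 * I ^ 2) * (Ideal.span {x'} ^ 2 * J ^ 2) := by ring
    _ = _ := by rw [h, h']; ring

theorem SqRep.of_mul_sq {I : Ideal R} {m n : R} (hn : n ≠ 0) (h : SqRep I (m * n ^ 2)) : SqRep I m := by
  obtain ⟨x, y, hx, hy, h⟩ := h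
  refine ⟨x, y * n, hx, mul_ne_zero hy hn, ?_⟩
  rw [h, ← Ideal.span_singleton_mul_span_singleton, ← Ideal.span_singleton_mul_span_singleton,
    ← Ideal.span_singleton_pow, mul_pow]
  ring

omit [IsDedekindDomain R] in
theorem SqRep.congr {I : Ideal R} {m n : R} (h : SqRep I m) (hmn : m = n) : SqRep I n := hmn ▸ h

omit [IsDedekindDomain R] in
theorem SqRep.top_one [Nontrivial R] : SqRep (⊤ : Ideal R) 1 :=
  SqRep.of_sq (by simp [← Ideal.one_eq_top])

theorem SqRep.cancel {I : Ideal R} {a m : R} (ha : a ≠ 0) (h : SqRep I (a * m))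
    (h' : SqRep (⊤ : Ideal R) a) : SqRep I m := by
  have := h.mul h'
  rw [Ideal.mul_top] at this
  exact SqRep.of_mul_sq ha (this.congr (by ring))

theorem SqRep.mul_top {I : Ideal R} {a m : R} (h : SqRep I m) (h' : SqRep (⊤ : Ideal R) a) :
    SqRep I (a * m) := by
  have := h.mul h'
  rw [Ideal.mul_top] at this
  exact this.congr (mul_comm _ _)

theorem SqRep.pow {I : Ideal R} {m : R} (h : SqRep I m) (n : ℕ) : SqRep (I ^ n) (m ^ n) := by
  induction n with
  | zero => simpa [Ideal.one_eq_top] using SqRep.top_one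
  | succ n ih => simpa [pow_succ] using ih.mul h

theorem SqRep.class_eq {I J : Ideal R} {m : R} (hI : I ≠ ⊥) (hJ : J ≠ ⊥) (h : SqRep I m)
    (h' : SqRep J m) : idealClass I = idealClass J := by
  rw [idealClass_eq_iff hI hJ]
  obtain ⟨x, y, hx, hy, h⟩ := h
  obtain ⟨x', y', hx', hy', h'⟩ := h'
  refine ⟨x * y', x' * y, mul_ne_zero hx hy', mul_ne_zero hx' hy, Ideal.eq_of_sq_eq ?_⟩
  simp only [← Ideal.span_singleton_mul_span_singleton, mul_pow]
  calc _ = Ideal.span {y'} ^ 2 * (Ideal.span {x} ^ 2 * I ^ 2) := by ring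
    _ = Ideal.span {y} ^ 2 * (Ideal.span {y'} ^ 2 * Ideal.span {m}) := by rw [h]; ring
    _ = _ := by rw [← h']; ring

theorem SqRep.class_eq_one {I : Ideal R} (hI : I ≠ ⊥) (h : SqRep I 1) : idealClass I = 1 := by
  rw [← idealClass_top, h.class_eq hI _ SqRep.top_one]
  exact top_ne_bot

omit [IsDedekindDomain R] in
theorem SqRep.map {R' : Type*} [CommRing R'] {f : R →+* R'} (hf : Function.Injective f) {I : Ideal R}
    {m : R} (h : SqRep I m) : SqRep (I.map f) (f m) := by
  obtain ⟨x, y, hx, hy, h⟩ := h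
  refine ⟨f x, f y, (map_ne_zero_iff f hf).2 hx, (map_ne_zero_iff f hf).2 hy, ?_⟩
  have := congrArg (Ideal.map f) h
  simpa only [Ideal.map_mul, Ideal.map_pow, Ideal.map_span, Set.image_singleton] using this

theorem SqRep.span_mul {I : Ideal R} {m x : R} (hx : x ≠ 0) (h : SqRep I m) :
    SqRep (Ideal.span {x} * I) m := by
  obtain ⟨a, b, ha, hb, h⟩ := h
  refine ⟨a, b * x, ha, mul_ne_zero hb hx, ?_⟩
  rw [← Ideal.span_singleton_mul_span_singleton, mul_pow, mul_pow,
    mul_right_comm, ← h]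
  ring

theorem SqRep.of_span_mul {I : Ideal R} {m x : R} (hx : x ≠ 0) (h : SqRep (Ideal.span {x} * I) m) :
    SqRep I m := by
  obtain ⟨a, b, ha, hb, h⟩ := h
  refine ⟨a * x, b, mul_ne_zero ha hx, hb, ?_⟩
  rw [← Ideal.span_singleton_mul_span_singleton, mul_pow, ← h]
  ring

/-- Every residue class modulo `P` contains an integer. -/
def IntRes (P : Ideal R) : Prop := ∀ x : R, ∃ n : ℤ, x - n ∈ P

end Classes

namespace Layer

variable {S R : Type*} [CommRing S] [CommRing R] [IsDedekindDomain R] (Λ : Layer S R)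

theorem invariant_induction {p : Ideal R → Prop} (h1 : p ⊤)
    (hmul : ∀ I J, I ≠ ⊥ → J ≠ ⊥ → p I → p J → p (I * J))
    (hnorm : ∀ P : Ideal R, P.IsPrime → P ≠ ⊥ → p (P * P.map Λ.s))
    (hprime : ∀ P : Ideal R, P.IsPrime → P ≠ ⊥ → P.map Λ.s = P → p P)
    (J : Ideal R) (hJ : J ≠ ⊥) (hs : J.map Λ.s = J) : p J := by
  induction J using WellFoundedGT.induction with
  | ind J ih =>
  by_cases hT : J = ⊤
  · rwa [hT]
  have key : ∀ Q : Ideal R, Q ≠ ⊤ → Q ≠ ⊥ → Q.map Λ.s = Q → p Q → Q ∣ J → p J := by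
    rintro Q hQT hQ hQs hpQ ⟨J', rfl⟩
    have hJ' : J' ≠ ⊥ := by
      rintro rfl
      exact hJ (by simp)
    refine hmul _ _ hQ hJ' hpQ (ih J' (lt_of_le_of_ne Ideal.mul_le_right fun h => hQT ?_) hJ' ?_)
    · have : Q * J' = 1 * J' := by rw [h, one_mul]
      rw [mul_right_cancel₀ hJ' this, Ideal.one_eq_top]
    · rw [Ideal.map_mul, hQs] at hs
      exact mul_left_cancel₀ hQ hs
  obtain ⟨P, hP, hJP⟩ := Ideal.exists_le_maximal J hT
  have hP0 : P ≠ ⊥ := fun h => hJ (le_bot_iff.1 (h ▸ hJP))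
  by_cases hPs : P.map Λ.s = P
  · exact key P hP.ne_top hP0 hPs (hprime P hP.isPrime hP0 hPs) (Ideal.dvd_iff_le.2 hJP)
  · have hPm : (P.map Λ.s).IsMaximal :=
      Ideal.map_isMaximal_of_equiv Λ.s
    refine key (P * P.map Λ.s) (fun h => hP.ne_top ?_) (mul_ne_zero hP0 (Λ.map_s_ne_bot hP0)) ?_
      (hnorm P hP.isPrime hP0) ?_
    · exact top_le_iff.1 (h ▸ Ideal.mul_le_left)
    · rw [Ideal.map_mul, Λ.map_map_s, mul_comm]
    · refine IsCoprime.mul_dvd ?_ (Ideal.dvd_iff_le.2 hJP) (Ideal.dvd_iff_le.2 ?_)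
      · rw [Ideal.isCoprime_iff_sup_eq]
        exact hP.coprime_of_ne hPm (Ne.symm hPs)
      · rw [← hs]
        exact Ideal.map_mono hJP

theorem exists_invariant {I : Ideal R} (hI : I ≠ ⊥) {l γ : R} (hl : Λ.s l = l)
    (hIl : I * I.map Λ.s = Ideal.span {l}) (hγ : I ^ 2 = Ideal.span {γ})
    (hn : γ * Λ.s γ = l ^ 2) :
    ∃ (z : R) (J : Ideal R), z ≠ 0 ∧ J = Ideal.span {z} * I ∧ J.map Λ.s = J := by
  by_cases h0 : l + Λ.s γ = 0
  · refine ⟨1, I, one_ne_zero, by simp [Ideal.span_singleton_one], ?_⟩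
    have h1 : γ = -l := by
      have := congrArg Λ.s (eq_neg_of_add_eq_zero_right h0)
      rwa [Λ.invol, map_neg, hl] at this
    apply mul_left_cancel₀ hI
    rw [hIl, ← pow_two, hγ, h1, Ideal.span_singleton_neg]
  · refine ⟨l + Λ.s γ, _, h0, rfl, ?_⟩
    apply mul_left_cancel₀ hI
    rw [Ideal.map_mul, Λ.map_s_span, map_add, Λ.invol, hl]
    calc _ = Ideal.span {l + γ} * (I * I.map Λ.s) := by ring
      _ = Ideal.span {l + Λ.s γ} * I ^ 2 := by
        rw [hIl, hγ, Ideal.span_singleton_mul_span_singleton,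
          Ideal.span_singleton_mul_span_singleton]
        congr 2
        linear_combination -hn
      _ = _ := by ring

theorem exists_sq_sub_mem {I : Ideal R} (hI : I ≠ ⊥) {l γ u : R} (hl0 : l ≠ 0) (hl : Λ.s l = l)
    (hIγ : I * Ideal.span {l} = Ideal.span {γ} * I.map Λ.s)
    (hn : γ * Λ.s γ = u * l ^ 2) {P : Ideal R} (hP : P.IsPrime) (hP0 : P ≠ ⊥)
    (hPs : P.map Λ.s = P) (hres : IntRes P) : ∃ n : ℤ, (n : R) ^ 2 - u ∈ P := by
  have hfin : FiniteMultiplicity P I :=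
    FiniteMultiplicity.of_not_isUnit (by rw [Ideal.isUnit_iff]; exact hP.ne_top) hI
  obtain ⟨I', hI', hPI⟩ := hfin.exists_eq_pow_mul_and_not_dvd
  have hIγ' : I' * Ideal.span {l} = Ideal.span {γ} * I'.map Λ.s := by
    apply mul_left_cancel₀ (pow_ne_zero (multiplicity P I) hP0)
    rw [← mul_assoc, ← hI', hIγ]
    nth_rewrite 1 [hI']
    rw [Ideal.map_mul, Ideal.map_pow, hPs]
    ring
  obtain ⟨t, ht, htP⟩ := Set.not_subset.1 (fun h => hPI (Ideal.dvd_iff_le.2 h))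
  have hmem : γ * Λ.s t ∈ I' * Ideal.span {l} := by
    rw [hIγ']
    exact Ideal.mul_mem_mul (Ideal.mem_span_singleton_self γ) (Λ.s_mem ht)
  obtain ⟨a, -, ha⟩ := Ideal.mem_mul_span_singleton.1 hmem
  have hs : ∀ x, Λ.s x - x ∈ P := by
    intro x
    obtain ⟨n, hn⟩ := hres x
    have h1 := Λ.s_mem hn
    rw [hPs, map_sub, map_intCast] at h1
    simpa using Ideal.sub_mem _ h1 hn
  have hnorm : a * Λ.s a = u * t * Λ.s t := by
    apply mul_left_cancel₀ (pow_ne_zero 2 hl0)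
    have h2 := congrArg Λ.s ha
    rw [map_mul, map_mul, Λ.invol, hl] at h2
    calc l ^ 2 * (a * Λ.s a) = (a * l) * (Λ.s a * l) := by ring
      _ = (γ * Λ.s γ) * (t * Λ.s t) := by rw [ha, h2]; ring
      _ = _ := by rw [hn]; ring
  have hmod : a ^ 2 - u * t ^ 2 ∈ P := by
    have : a ^ 2 - u * t ^ 2 = u * t * (Λ.s t - t) - a * (Λ.s a - a) := by
      linear_combination hnorm
    rw [this]
    exact Ideal.sub_mem _ (Ideal.mul_mem_left _ _ (hs t)) (Ideal.mul_mem_left _ _ (hs a))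
  have hmax : P.IsMaximal := hP.isMaximal hP0
  obtain ⟨y, hy⟩ := hmax.exists_inv htP
  obtain ⟨z, hz, hz1⟩ := hy
  obtain ⟨n, hn'⟩ := hres (y * a)
  refine ⟨n, ?_⟩
  have h1 : y * t - 1 ∈ P := by
    have : y * t - 1 = -z := by linear_combination hz1
    rw [this]; exact P.neg_mem hz
  have : (n : R) ^ 2 - u = -(y * a + n) * (y * a - n) + y ^ 2 * (a ^ 2 - u * t ^ 2)
      + u * (y * t + 1) * (y * t - 1) := by ring
  rw [this]
  exact Ideal.add_mem _ (Ideal.add_mem _ (Ideal.mul_mem_left _ _ hn')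
    (Ideal.mul_mem_left _ _ hmod)) (Ideal.mul_mem_left _ _ h1)

omit [IsDedekindDomain R] in
theorem mul_span_eq {I : Ideal R} {l γ : R}
    (hIl : I * I.map Λ.s = Ideal.span {l}) (hγ : I ^ 2 = Ideal.span {γ}) :
    I * Ideal.span {l} = Ideal.span {γ} * I.map Λ.s := by
  rw [← hIl, ← hγ]; ring

theorem associated_of_span_eq [IsDomain S] {a b : S} (h : Ideal.span {Λ.j a} = Ideal.span {Λ.j b}) :
    Associated a b := by
  have key : ∀ {a b : S}, a ≠ 0 → Ideal.span {Λ.j b} ≤ Ideal.span {Λ.j a} → a ∣ b := by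
    intro a b ha h
    rw [Ideal.span_singleton_le_span_singleton] at h
    obtain ⟨r, hr⟩ := h
    have hs : Λ.s r = r := by
      apply mul_left_cancel₀ (Λ.j_ne_zero ha)
      conv_lhs => rw [← Λ.fix a, ← map_mul, ← hr, Λ.fix]
      exact hr
    obtain ⟨y, rfl⟩ := Λ.desc r hs
    exact ⟨y, Λ.inj (by rw [hr, map_mul])⟩
  by_cases ha : a = 0
  · subst ha
    rw [map_zero, Ideal.span_singleton_eq_span_singleton] at h
    have : b = 0 := Λ.inj (by rw [map_zero]; exact (associated_zero_iff_eq_zero _).1 h.symm)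
    rw [this]
  have hb : b ≠ 0 := by
    rintro rfl
    rw [map_zero, Ideal.span_singleton_eq_span_singleton, associated_zero_iff_eq_zero] at h
    exact Λ.j_ne_zero ha h
  exact associated_of_dvd_dvd (key ha h.ge) (key hb h.le)

end Layer

section Ramification

variable {R : Type*} [CommRing R]

theorem Ideal.span_pair_sq {v A w a b c : R} (hA : A ^ 2 = v * w) (h : a * v + b * A + c * w = 1) :
    Ideal.span {v, A} ^ 2 = Ideal.span {v} := by
  rw [pow_two, Ideal.span_pair_mul_span_pair]
  apply le_antisymm
  · rw [Ideal.span_le]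
    rintro z (rfl | rfl | rfl | rfl) <;> simp only [SetLike.mem_coe, Ideal.mem_span_singleton]
    · exact dvd_mul_right _ _
    · exact dvd_mul_right _ _
    · exact dvd_mul_left _ _
    · exact ⟨w, by rw [← pow_two, hA]⟩
  · rw [Ideal.span_singleton_le_iff_mem]
    have : v = a * (v * v) + b * (v * A) + c * (A * A) := by
      linear_combination (-v) * h + (-c) * hA
    refine (congrArg (· ∈ Ideal.span {v * v, v * A, A * v, A * A}) this).mpr ?_
    exact Ideal.add_mem _ (Ideal.add_mem _ (Ideal.mul_mem_left _ _ (Ideal.subset_span (by simp)))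
      (Ideal.mul_mem_left _ _ (Ideal.subset_span (by simp))))
      (Ideal.mul_mem_left _ _ (Ideal.subset_span (by simp)))

theorem Ideal.span_pair_mul_conj {v B t z a b : R} (hB : B ^ 2 - t ^ 2 = v * z)
    (h : a * v + b * (2 * t) = 1) :
    Ideal.span {v, B - t} * Ideal.span {v, B + t} = Ideal.span {v} := by
  rw [Ideal.span_pair_mul_span_pair]
  apply le_antisymm
  · rw [Ideal.span_le]
    rintro y (rfl | rfl | rfl | rfl) <;> simp only [SetLike.mem_coe, Ideal.mem_span_singleton]
    · exact dvd_mul_right _ _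
    · exact dvd_mul_right _ _
    · exact dvd_mul_left _ _
    · exact ⟨z, by linear_combination hB⟩
  · rw [Ideal.span_singleton_le_iff_mem]
    have : v = a * (v * v) + b * (v * (B + t)) - b * ((B - t) * v) := by
      linear_combination (-v) * h
    refine (congrArg (· ∈ Ideal.span {v * v, v * (B + t), (B - t) * v, (B - t) * (B + t)})
      this).mpr ?_
    exact Ideal.sub_mem _ (Ideal.add_mem _ (Ideal.mul_mem_left _ _ (Ideal.subset_span (by simp)))
      (Ideal.mul_mem_left _ _ (Ideal.subset_span (by simp))))
      (Ideal.mul_mem_left _ _ (Ideal.subset_span (by simp)))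

theorem Ideal.span_pair_sup_conj {v B t a b : R} (h : a * v + b * (2 * t) = 1) :
    Ideal.span {v, B - t} ⊔ Ideal.span {v, B + t} = ⊤ := by
  rw [Ideal.eq_top_iff_one]
  have : (1 : R) = (a * v - b * (B - t)) + b * (B + t) := by linear_combination -h
  rw [this]
  refine Ideal.add_mem _ (Ideal.mem_sup_left (Ideal.sub_mem _ ?_ ?_)) (Ideal.mem_sup_right ?_)
  all_goals exact Ideal.mul_mem_left _ _ (Ideal.subset_span (by simp))

theorem Ideal.sup_sq_of_mul {P Q Q' : Ideal R} (hP : P ^ 2 = Q * Q') (h : Q ⊔ Q' = ⊤) :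
    (Q ⊔ P) ^ 2 = Q := by
  have h1 : (Q ⊔ P) ^ 2 = Q * (Q ⊔ Q') ⊔ Q * P := by
    simp only [← Submodule.add_eq_sup]
    calc (Q + P) ^ 2 = Q ^ 2 + (Q * P + Q * P) + P ^ 2 := by ring
      _ = Q ^ 2 + Q * P + Q * Q' := by rw [show Q * P + Q * P = Q * P from sup_idem _, hP]
      _ = _ := by ring
  rw [h1, h, Ideal.mul_top, sup_eq_left]
  exact Ideal.mul_le_left

variable [IsDedekindDomain R]

theorem Ideal.sup_mul_sup_of_mul {P Q Q' : Ideal R} (hP : P ^ 2 = Q * Q') (h : Q ⊔ Q' = ⊤) :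
    (Q ⊔ P) * (Q' ⊔ P) = P := by
  apply Ideal.eq_of_sq_eq
  rw [mul_pow, Ideal.sup_sq_of_mul hP h, Ideal.sup_sq_of_mul (hP.trans (mul_comm _ _))
    (by rwa [sup_comm]), hP]

theorem Layer.eq_map_comap {S : Type*} [CommRing S] (Λ : Layer S R) {θ : R} {d : S}
    (hs : Λ.s θ = -θ) (hd : θ ^ 2 = Λ.j d) {P : Ideal R} (hP : P.IsPrime) (hP0 : P ≠ ⊥)
    (hPs : P.map Λ.s = P) (hdP : Λ.j (2 * d) ∉ P) : P = (P.comap Λ.j).map Λ.j := by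
  have hmax : P.IsMaximal := hP.isMaximal hP0
  have hm := Ideal.isMaximal_comap_of_isIntegral_of_isMaximal' Λ.j Λ.isIntegral P
  have hle : (P.comap Λ.j).map Λ.j ≤ P := Ideal.map_comap_le
  obtain ⟨D, hD⟩ := Ideal.dvd_iff_le.2 hle
  have htr : ∀ x ∈ P, x + Λ.s x ∈ (P.comap Λ.j).map Λ.j := by
    intro x hx
    obtain ⟨t, ht⟩ := Λ.exists_trace x
    rw [← ht]
    refine Ideal.mem_map_of_mem _ ?_
    rw [Ideal.mem_comap, ht]
    exact P.add_mem hx (hPs ▸ Λ.s_mem hx)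
  have hmem : ∀ x ∈ P, Λ.j (2 * d) * x ∈ (P.comap Λ.j).map Λ.j := by
    intro x hx
    have : Λ.j (2 * d) * x = θ ^ 2 * (x + Λ.s x) + θ * (θ * x + Λ.s (θ * x)) := by
      rw [map_mul, map_mul, map_ofNat, hs, hd]
      linear_combination (Λ.s x - x) * hd
    rw [this]
    exact Ideal.add_mem _ (Ideal.mul_mem_left _ _ (htr x hx))
      (Ideal.mul_mem_left _ _ (htr _ (P.mul_mem_left _ hx)))
  have hdvd : P * D ∣ P * Ideal.span {Λ.j (2 * d)} := by
    rw [← hD, Ideal.dvd_iff_le, Ideal.mul_le]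
    intro x hx y hy
    obtain ⟨z, rfl⟩ := Ideal.mem_span_singleton'.1 hy
    have := Ideal.mul_mem_left _ z (hmem x hx)
    convert this using 1
    ring
  have hDd := Ideal.dvd_iff_le.1 ((mul_dvd_mul_iff_left hP0).1 hdvd)
  rw [Ideal.span_singleton_le_iff_mem] at hDd
  have hDT : D = ⊤ := by
    by_contra hne
    obtain ⟨P', hP', hDP'⟩ := Ideal.exists_le_maximal D hne
    have h1 : P.comap Λ.j ≤ P'.comap Λ.j := by
      rw [← Ideal.map_le_iff_le_comap, hD]
      exact Ideal.mul_le_right.trans hDP'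
    have hc : P'.comap Λ.j ≠ ⊤ := by
      rw [Ne, Ideal.comap_eq_top_iff]
      exact hP'.ne_top
    have h2 := hm.eq_of_le hc h1
    apply hdP
    have : 2 * d ∈ P'.comap Λ.j := hDP' hDd
    rw [← h2] at this
    exact this
  rw [hD, hDT, Ideal.mul_top]

end Ramification

section AbsNorm

variable {R : Type*} [CommRing R] [IsDedekindDomain R] [Module.Free ℤ R]

theorem absNorm_map_equiv (e : R ≃+* R) (I : Ideal R) :
    Ideal.absNorm (I.map e) = Ideal.absNorm I := by
  rw [Ideal.absNorm_apply, Ideal.absNorm_apply, Submodule.cardQuot_apply, Submodule.cardQuot_apply]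
  exact (Nat.card_congr (Ideal.quotientEquiv I (I.map e) e rfl).toEquiv).symm

theorem intRes_of_absNorm_prime {P : Ideal R} (h : (Ideal.absNorm P).Prime) : IntRes P := by
  intro x
  rw [Ideal.absNorm_apply, Submodule.cardQuot_apply] at h
  have := Fact.mk h
  have : Finite (R ⧸ P) := Nat.finite_of_card_ne_zero h.ne_zero
  have hnt : Nontrivial (R ⧸ P) := Finite.one_lt_card_iff_nontrivial.1 h.one_lt
  rcases (AddSubgroup.zmultiples (1 : R ⧸ P)).eq_bot_or_eq_top_of_prime_card with h0 | h1
  · rw [AddSubgroup.zmultiples_eq_bot] at h0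
    exact absurd h0 one_ne_zero
  · have : Ideal.Quotient.mk P x ∈ AddSubgroup.zmultiples (1 : R ⧸ P) := h1 ▸ AddSubgroup.mem_top _
    obtain ⟨n, hn⟩ := AddSubgroup.mem_zmultiples_iff.1 this
    refine ⟨n, ?_⟩
    rw [← Ideal.Quotient.eq, ← hn]
    simp

theorem prime_of_absNorm_prime {P : Ideal R} (h : (Ideal.absNorm P).Prime) :
    P.IsPrime ∧ P ≠ ⊥ :=
  ⟨Ideal.isPrime_of_irreducible_absNorm h, by
    rintro rfl
    rw [Ideal.absNorm_bot] at h
    exact Nat.not_prime_zero h⟩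

theorem int_mem_iff_of_absNorm_prime {P : Ideal R} (h : (Ideal.absNorm P).Prime) (n : ℤ) :
    (n : R) ∈ P ↔ ((Ideal.absNorm P : ℕ) : ℤ) ∣ n := by
  have hmem := Ideal.absNorm_mem P
  constructor
  · intro hn
    by_contra hnd
    have hcop : IsCoprime ((Ideal.absNorm P : ℕ) : ℤ) n :=
      (Nat.prime_iff_prime_int.1 h).coprime_iff_not_dvd.2 hnd
    obtain ⟨a, b, hab⟩ := hcop
    apply (prime_of_absNorm_prime h).1.ne_top
    rw [Ideal.eq_top_iff_one]
    have : (1 : R) = a * (Ideal.absNorm P : R) + b * n := by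
      have := congrArg (Int.cast : ℤ → R) hab
      push_cast at this
      exact this.symm
    rw [this]
    exact P.add_mem (P.mul_mem_left _ hmem) (P.mul_mem_left _ hn)
  · rintro ⟨k, rfl⟩
    push_cast
    exact P.mul_mem_right _ hmem

/-- A prime divisor of an ideal of norm `l²` is the whole ideal unless it has norm `l`. -/
theorem eq_of_absNorm_sq {l : ℕ} (hl : l.Prime) {I P : Ideal R} (hI : Ideal.absNorm I = l ^ 2)
    (hP : P.IsPrime) (h : I ≤ P) (hne : Ideal.absNorm P ≠ l) : P = I := by
  obtain ⟨D, rfl⟩ := Ideal.dvd_iff_le.2 h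
  rw [map_mul] at hI
  obtain ⟨k, hk, hk'⟩ := (Nat.dvd_prime_pow hl).1 (Dvd.intro _ hI)
  have hP1 : Ideal.absNorm P ≠ 1 := fun h1 => hP.ne_top (Ideal.absNorm_eq_one_iff.1 h1)
  have hk2 : k = 2 := by
    interval_cases k
    · exact absurd hk' (by simpa using hP1)
    · exact absurd hk' (by simpa using hne)
    · rfl
  subst hk2
  rw [hk'] at hI
  have : Ideal.absNorm D = 1 := by
    have h0 : l ^ 2 ≠ 0 := pow_ne_zero 2 hl.ne_zero
    exact Nat.eq_of_mul_eq_mul_left (Nat.pos_of_ne_zero h0) (by rw [hI, mul_one])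
  rw [Ideal.absNorm_eq_one_iff.1 this, Ideal.mul_top]

variable [Module.Finite ℤ R]

theorem absNorm_span_sq {x y : R} {n k : ℕ} (hk : Module.finrank ℤ R = 2 * k) (e : R ≃+* R)
    (he : Ideal.span {e x} = Ideal.span {y}) (hxy : x * y = n) :
    Ideal.absNorm (Ideal.span {x}) = n ^ k := by
  have h1 : Ideal.absNorm (Ideal.span {y}) = Ideal.absNorm (Ideal.span {x}) := by
    rw [← absNorm_map_equiv e (Ideal.span {x}), Ideal.map_span, Set.image_singleton, he]
  have h2 : Ideal.absNorm (Ideal.span {x}) ^ 2 = (n ^ k) ^ 2 := by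
    nth_rewrite 1 [pow_two]
    nth_rewrite 2 [← h1]
    rw [← map_mul, Ideal.span_singleton_mul_span_singleton, hxy, Ideal.absNorm_span_natCast, hk,
      ← pow_mul, mul_comm]
  exact Nat.pow_left_injective two_ne_zero h2

end AbsNorm

/-- A quadratic extension `R` of the Gaussian integers generated, up to finite index, by a square
root `θ` of `d`, with an extension `κ` of complex conjugation fixing the square root `c * θ` of
the natural number `D`. -/
structure Quartic (R : Type*) [CommRing R] extends Layer GaussianInt R where
  θ : R
  d : GaussianInt
  c : GaussianInt
  D : ℕ
  κ : R ≃+* R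
  d_ne_zero : d ≠ 0
  s_θ : s θ = -θ
  sq_θ : θ ^ 2 = j d
  κ_j : ∀ z, κ (j z) = j (star z)
  κ_s : ∀ x, κ (s x) = s (κ x)
  κ_δ : κ (j c * θ) = j c * θ
  sq_c : c ^ 2 * d = D

theorem gI_not_isSquare (z : GaussianInt) : z ^ 2 ≠ gI := by
  intro h
  have := congrArg Zsqrtd.im h
  simp only [pow_two, Zsqrtd.im_mul] at this
  have h2 : 2 * (z.re * z.im) = 1 := by linear_combination this
  omega

namespace Quartic

variable {R : Type*} [CommRing R] (E : Quartic R)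

theorem sq_I : E.j gI * E.j gI = -1 := by
  rw [← map_mul, gI_mul_gI, map_neg, map_one]

theorem exists_norm_form {z : R} {n : GaussianInt} (hn : E.j n = z * E.s z) :
    ∃ x y, x ^ 2 - E.d * y ^ 2 = n * (2 * E.d) ^ 2 := by
  obtain ⟨t, ht⟩ := E.exists_trace z
  obtain ⟨t', ht'⟩ := E.exists_trace (E.θ * z)
  refine ⟨E.d * t, t', E.inj ?_⟩
  rw [map_mul, E.s_θ] at ht'
  simp only [map_sub, map_mul, map_pow, ht, ht', hn, map_ofNat]
  linear_combination (-E.j E.d * (z - E.s z) ^ 2) * E.sq_θ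

variable [IsDedekindDomain R]

theorem norm_form_of_sqRep {I : Ideal R} {m n : GaussianInt} (h : SqRep I (E.j m))
    (hI : I * I.map E.s = Ideal.span {E.j n}) :
    ∃ (e : ℕ) (x y z : GaussianInt), z ≠ 0 ∧ x ^ 2 - E.d * y ^ 2 = gI ^ e * (m * n) * z ^ 2 := by
  obtain ⟨x, y, hx, hy, h⟩ := h
  obtain ⟨a, ha⟩ := E.exists_norm x
  obtain ⟨b, hb⟩ := E.exists_norm y
  obtain ⟨g, hg⟩ := E.exists_norm (x * y)
  have hb0 : b ≠ 0 := by
    rintro rfl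
    rw [map_zero] at hb
    exact mul_ne_zero hy (E.s_ne_zero hy) hb.symm
  have hgab : g = a * b := E.inj (by rw [hg, map_mul, map_mul, ha, hb]; ring)
  have hsq : Ideal.span {E.j (a * n)} ^ 2 = Ideal.span {E.j (b * m)} ^ 2 := by
    have h' := congrArg (Ideal.map E.s) h
    simp only [Ideal.map_mul, Ideal.map_pow, E.map_s_span, E.fix] at h'
    simp only [map_mul, ha, hb, ← Ideal.span_singleton_mul_span_singleton, mul_pow, ← hI]
    calc _ = (Ideal.span {x} ^ 2 * I ^ 2) * (Ideal.span {E.s x} ^ 2 * I.map E.s ^ 2) := by ring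
      _ = _ := by rw [h, h']; ring
  obtain ⟨u, hu⟩ := E.associated_of_span_eq (Ideal.eq_of_sq_eq hsq).symm
  obtain ⟨e, he⟩ := gaussianInt_isUnit u.isUnit
  rw [he] at hu
  obtain ⟨X, Y, hXY⟩ := E.exists_norm_form hg
  refine ⟨e, n * X, n * Y, b * (2 * E.d), mul_ne_zero hb0 (mul_ne_zero two_ne_zero E.d_ne_zero), ?_⟩
  calc (n * X) ^ 2 - E.d * (n * Y) ^ 2 = n ^ 2 * (X ^ 2 - E.d * Y ^ 2) := by ring
    _ = n * b * (a * n) * (2 * E.d) ^ 2 := by rw [hXY, hgab]; ring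
    _ = _ := by rw [← hu]; ring

theorem norm_form_of_sqRep_sq {I : Ideal R} (hI : I ≠ ⊥) {m : GaussianInt}
    (h : SqRep (I ^ 2) (E.j m)) : ∃ (e : ℕ) (x y z : GaussianInt), z ≠ 0 ∧
      x ^ 2 - E.d * y ^ 2 = gI ^ e * m * z ^ 2 := by
  obtain ⟨g, hg⟩ := E.exists_norm_span I
  have hg0 : g ≠ 0 := by
    rintro rfl
    rw [map_zero, Ideal.span_singleton_eq_bot.2 rfl] at hg
    exact mul_ne_zero hI (E.map_s_ne_bot hI) hg
  obtain ⟨e, x, y, z, hz, hxyz⟩ := E.norm_form_of_sqRep (n := g ^ 2) h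
    (by rw [Ideal.map_pow, ← mul_pow, hg, Ideal.span_singleton_pow, map_pow])
  exact ⟨e, x, y, g * z, mul_ne_zero hg0 hz, by rw [hxyz]; ring⟩

section ramified

variable {l : ℕ} [Fact l.Prime] (P : GaussPrime l)

omit [IsDedekindDomain R] in
theorem sq_ramified {v w : GaussianInt} (hd : E.d = v * w) (hw : IsCoprime v w) :
    Ideal.span {E.j v, E.θ} ^ 2 = Ideal.span {E.j v} := by
  obtain ⟨a, b, hab⟩ := hw
  refine Ideal.span_pair_sq (w := E.j w) (a := E.j a) (b := 0) (c := E.j b) ?_ ?_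
  · rw [E.sq_θ, hd, map_mul]
  · rw [zero_mul, add_zero, ← map_mul, ← map_mul, ← map_add, hab, map_one]

omit [IsDedekindDomain R] in
theorem map_s_ramified (v : GaussianInt) :
    (Ideal.span {E.j v, E.θ}).map E.s = Ideal.span {E.j v, E.θ} := by
  rw [Ideal.map_span, Set.image_pair, E.fix, E.s_θ]
  refine le_antisymm ?_ ?_ <;> rw [Ideal.span_le] <;> rintro z (rfl | rfl)
  · exact Ideal.subset_span (by simp)
  · exact Ideal.neg_mem_iff _ |>.2 (Ideal.subset_span (by simp))
  · exact Ideal.subset_span (by simp)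
  · rw [SetLike.mem_coe, ← Ideal.neg_mem_iff]
    exact Ideal.subset_span (by simp)

variable [Module.Free ℤ R] [Module.Finite ℤ R]

theorem absNorm_span_gaussPrime (h4 : Module.finrank ℤ R = 4) :
    Ideal.absNorm (Ideal.span {E.j P.v}) = l ^ 2 := by
  refine absNorm_span_sq (y := E.j P.conj.v) (by rw [h4]) E.κ ?_ ?_
  · rw [E.κ_j, P.conj_v]
  · rw [← map_mul, P.mul_conj, map_natCast]

theorem absNorm_span_one_add_gI (h4 : Module.finrank ℤ R = 4) :
    Ideal.absNorm (Ideal.span {E.j (1 + gI)}) = 2 ^ 2 := by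
  refine absNorm_span_sq (y := E.j (star (1 + gI))) (by rw [h4]) E.κ ?_ ?_
  · rw [E.κ_j]
  · rw [← map_mul, show (1 + gI) * star (1 + gI) = ((2 : ℕ) : GaussianInt) by decide, map_natCast]

theorem absNorm_ramified (h4 : Module.finrank ℤ R = 4) {w : GaussianInt} (hd : E.d = P.v * w)
    (hw : IsCoprime P.v w) : Ideal.absNorm (Ideal.span {E.j P.v, E.θ}) = l := by
  have h := E.absNorm_span_gaussPrime P h4
  rw [← E.sq_ramified hd hw, map_pow] at h
  exact Nat.pow_left_injective two_ne_zero h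

theorem exists_invariant_of_sq (h4 : Module.finrank ℤ R = 4) (hl : l % 8 = 5) {w : GaussianInt}
    (hd : E.d = P.v * w) (hw : IsCoprime P.v w) {I : Ideal R} (hI : I ≠ ⊥) {γ : R}
    (hγ : I ^ 2 = Ideal.span {γ}) :
    ∃ (z : R) (J : Ideal R), z ≠ 0 ∧ J = Ideal.span {z} * I ∧ J.map E.s = J := by
  obtain ⟨g, hg⟩ := E.exists_norm_span I
  obtain ⟨n, hn⟩ := E.exists_norm γ
  have hg0 : g ≠ 0 := by
    rintro rfl
    rw [map_zero, Ideal.span_singleton_eq_bot.2 rfl] at hg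
    exact mul_ne_zero hI (E.map_s_ne_bot hI) hg
  have hass : Associated (g ^ 2) n := by
    apply E.associated_of_span_eq
    rw [hn, map_pow, ← Ideal.span_singleton_pow, ← hg, mul_pow, hγ, ← Ideal.map_pow, hγ,
      E.map_s_span, Ideal.span_singleton_mul_span_singleton]
  obtain ⟨u, hu⟩ := hass
  obtain ⟨e, he⟩ := gaussianInt_isUnit u.isUnit
  rw [he] at hu
  have hspan : ∀ f : ℕ, Ideal.span {E.j (gI ^ f * g)} = Ideal.span {E.j g} := by
    intro f
    rw [map_mul, Ideal.span_singleton_mul_left_unit]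
    exact (gI_isUnit.pow f).map E.j
  rcases Nat.even_or_odd' e with ⟨f, rfl | rfl⟩
  · refine E.exists_invariant hI (l := E.j (gI ^ f * g)) (E.fix _) (by rw [hspan, hg]) hγ ?_
    rw [← hn, ← hu, ← map_pow]
    congr 1
    ring
  · exfalso
    have hpr : (Ideal.absNorm (Ideal.span {E.j P.v, E.θ})).Prime := by
      rw [E.absNorm_ramified P h4 hd hw]
      exact Fact.out
    obtain ⟨k, hk⟩ := E.exists_sq_sub_mem hI (l := E.j (gI ^ f * g)) (γ := γ) (u := E.j gI)
      (E.j_ne_zero (mul_ne_zero (gI_isUnit.pow f).ne_zero hg0)) (E.fix _)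
      (E.mul_span_eq (by rw [hspan, hg]) hγ)
      (by rw [← hn, ← hu, ← map_pow, ← map_mul]; congr 1; ring)
      (prime_of_absNorm_prime hpr).1 (prime_of_absNorm_prime hpr).2 (E.map_s_ramified _)
      (intRes_of_absNorm_prime hpr)
    have hk' : ((k ^ 4 + 1 : ℤ) : R) ∈ Ideal.span {E.j P.v, E.θ} := by
      have : ((k ^ 4 + 1 : ℤ) : R) = ((k : R) ^ 2 + E.j gI) * ((k : R) ^ 2 - E.j gI) := by
        push_cast
        linear_combination E.sq_I
      rw [this]
      exact Ideal.mul_mem_left _ _ hk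
    rw [int_mem_iff_of_absNorm_prime hpr, E.absNorm_ramified P h4 hd hw,
      ← ZMod.intCast_zmod_eq_zero_iff_dvd] at hk'
    push_cast at hk'
    exact zmod_pow_four_ne_neg_one hl (k : ZMod l) (eq_neg_of_add_eq_zero_left hk')

/-- Ideals with principal square are classified by the ramified primes. -/
theorem exists_sqRep (h4 : Module.finrank ℤ R = 4) (hl : l % 8 = 5) {w : GaussianInt}
    (hd : E.d = P.v * w) (hw : IsCoprime P.v w) (T : Submonoid GaussianInt)
    (hT : ∀ Q : Ideal R, Q.IsPrime → Q ≠ ⊥ → Q.map E.s = Q → E.j (2 * E.d) ∈ Q →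
      ∃ m ∈ T, SqRep Q (E.j m)) {I : Ideal R} (hI : I ≠ ⊥) (h2 : idealClass I ^ 2 = 1) :
    ∃ m ∈ T, SqRep I (E.j m) := by
  rw [← idealClass_pow hI, idealClass_eq_one_iff (pow_ne_zero 2 hI)] at h2
  obtain ⟨γ, -, hγ⟩ := h2
  obtain ⟨z, J, hz, hJ, hJs⟩ := E.exists_invariant_of_sq P h4 hl hd hw hI hγ
  have hspan : ∀ g : GaussianInt, g ≠ 0 → SqRep (Ideal.span {E.j g}) (E.j 1) := by
    intro g hg
    have := SqRep.span_mul (E.j_ne_zero hg) (SqRep.top_one (R := R))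
    rwa [Ideal.mul_top, ← map_one E.j] at this
  have key : ∃ m ∈ T, SqRep J (E.j m) := by
    refine E.invariant_induction (p := fun J => ∃ m ∈ T, SqRep J (E.j m)) ?_ ?_ ?_ ?_ J ?_ hJs
    · exact ⟨1, T.one_mem, by rw [map_one]; exact SqRep.top_one⟩
    · rintro I J - - ⟨m, hm, h⟩ ⟨n, hn, h'⟩
      exact ⟨m * n, T.mul_mem hm hn, by rw [map_mul]; exact h.mul h'⟩
    · intro Q _ hQ
      obtain ⟨g, hg⟩ := E.exists_norm_span Q
      refine ⟨1, T.one_mem, hg ▸ hspan g ?_⟩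
      rintro rfl
      rw [map_zero, Ideal.span_singleton_eq_bot.2 rfl] at hg
      exact mul_ne_zero hQ (E.map_s_ne_bot hQ) hg
    · intro Q hQ hQ0 hQs
      by_cases hmem : E.j (2 * E.d) ∈ Q
      · exact hT Q hQ hQ0 hQs hmem
      · have h := E.eq_map_comap E.s_θ E.sq_θ hQ hQ0 hQs hmem
        rw [← Ideal.span_singleton_generator (Q.comap E.j), Ideal.map_span,
          Set.image_singleton] at h
        refine ⟨1, T.one_mem, h ▸ hspan _ ?_⟩
        intro h0
        rw [h0, map_zero, Ideal.span_singleton_eq_bot.2 rfl] at h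
        exact hQ0 h
    · rw [hJ]
      exact mul_ne_zero (Ideal.span_ne_bot hz) hI
  obtain ⟨m, hm, h⟩ := key
  exact ⟨m, hm, SqRep.of_span_mul hz (hJ ▸ h)⟩

end ramified

end Quartic

theorem pow_two_eq_one_of_pow_two_pow {G : Type*} [Monoid G] (h : ∀ x : G, x ^ 4 = 1 → x ^ 2 = 1)
    {x : G} {n : ℕ} (hx : x ^ 2 ^ n = 1) : x ^ 2 = 1 := by
  induction n with
  | zero => rw [pow_zero, pow_one] at hx; rw [hx, one_pow]
  | succ n ih =>
    cases n with
    | zero => simpa using hx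
    | succ n =>
      apply ih
      have := h (x ^ 2 ^ n) (by rw [← pow_mul, ← hx]; congr 1; ring)
      rw [← this, ← pow_mul, ← pow_succ]

namespace Quartic

variable {R : Type*} [CommRing R] (E : Quartic R)

/-- `ε` is a unit of the real quadratic subring, of norm `-1`, whose product with `m` is a square
up to squares of Gaussian numbers. -/
def IsFund (ε : R) (m : GaussianInt) : Prop :=
  ε * E.s ε = -1 ∧ E.κ ε = ε ∧
    ∃ (β : R) (w : GaussianInt) (k : ℕ), w ≠ 0 ∧ β ^ 2 = E.j (gI ^ k * m * w ^ 2) * ε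

theorem isUnit_of_norm {ε : R} (h : ε * E.s ε = -1) : IsUnit ε :=
  IsUnit.of_mul_eq_one (-E.s ε) (by linear_combination -h)

variable [IsDedekindDomain R]

theorem exists_isFund {a b : ℤ} (h : a ^ 2 + 1 = E.D * b ^ 2) {k : ℕ} {m w : GaussianInt}
    (hw : (⟨a, -1⟩ : GaussianInt) = gI ^ k * m * w ^ 2) : ∃ ε, E.IsFund ε m := by
  set δ := E.j E.c * E.θ with hδ
  have hδ2 : δ ^ 2 = (E.D : R) := by
    rw [hδ, mul_pow, E.sq_θ, ← map_pow, ← map_mul, E.sq_c, map_natCast]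
  have hsδ : E.s δ = -δ := by rw [hδ, map_mul, E.fix, E.s_θ]; ring
  have h' : (a : R) ^ 2 + 1 = E.D * (b : R) ^ 2 := by exact_mod_cast congrArg (Int.cast : ℤ → R) h
  set ε := (a : R) + b * δ with hε
  have hsq : ε ^ 2 = 2 * a * ε + 1 := by
    rw [hε]; linear_combination (b : R) ^ 2 * hδ2 - h'
  have hai : E.j (⟨a, -1⟩ : GaussianInt) = a - E.j gI := by
    rw [show (⟨a, -1⟩ : GaussianInt) = (a : GaussianInt) - gI by ext <;> simp, map_sub, map_intCast]
  have hβ : (1 + E.j gI * ε) ^ 2 = E.j (1 + gI) ^ 2 * (E.j (gI * ⟨a, -1⟩) * ε) := by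
    rw [map_mul, hai, map_add, map_one]
    clear_value ε
    linear_combination
      (ε ^ 2 - ε * (2 * a - 2 * E.j gI + E.j gI * a - E.j gI ^ 2)) * E.sq_I - hsq
  obtain ⟨β, hβ'⟩ := (IsIntegrallyClosed.pow_dvd_pow_iff two_ne_zero).1 (Dvd.intro _ hβ.symm)
  rw [hβ', mul_pow] at hβ
  have h1 : E.j (1 + gI) ^ 2 ≠ 0 := pow_ne_zero 2 (E.j_ne_zero (by decide))
  refine ⟨ε, ?_, ?_, β, w, k + 1, ?_, ?_⟩
  · rw [hε, map_add, map_mul, map_intCast, map_intCast, hsδ]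
    linear_combination h' - (b : R) ^ 2 * hδ2
  · rw [hε, map_add, map_mul, map_intCast, map_intCast, E.κ_δ]
  · rintro rfl
    have := congrArg Zsqrtd.im hw
    simp at this
  · rw [mul_left_cancel₀ h1 hβ, hw]
    congr 2
    ring

theorem IsFund.sqRep {ε : R} {m : GaussianInt} (hm : m ≠ 0) (h : E.IsFund ε m) :
    SqRep (⊤ : Ideal R) (E.j m) := by
  obtain ⟨h1, -, β, w, k, hw, hβ⟩ := h
  have hu := (((gI_isUnit.pow k).map E.j)).mul (E.isUnit_of_norm h1)
  have hβ' : β ^ 2 = E.j w ^ 2 * E.j m * (E.j (gI ^ k) * ε) := by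
    rw [hβ, map_mul, map_mul, map_pow E.j w]; ring
  refine ⟨β, E.j w, ?_, E.j_ne_zero hw, ?_⟩
  · rintro rfl
    refine mul_ne_zero (mul_ne_zero (pow_ne_zero 2 (E.j_ne_zero hw)) (E.j_ne_zero hm)) hu.ne_zero
      (by rw [← hβ']; ring)
  · rw [← Ideal.one_eq_top, one_pow, mul_one, Ideal.span_singleton_pow, hβ',
      Ideal.span_singleton_mul_right_unit hu, Ideal.span_singleton_pow,
      Ideal.span_singleton_mul_span_singleton]

theorem sqRep_d {g m : GaussianInt} (hg : IsUnit g) (h : E.d = g * m) :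
    SqRep (⊤ : Ideal R) (E.j m) := by
  have h0 : E.θ ≠ 0 := by
    intro h0
    have := E.sq_θ
    rw [h0, zero_pow two_ne_zero] at this
    exact E.j_ne_zero E.d_ne_zero this.symm
  refine ⟨E.θ, 1, h0, one_ne_zero, ?_⟩
  rw [← Ideal.one_eq_top, one_pow, mul_one, Ideal.span_singleton_pow, E.sq_θ, h, map_mul,
    Ideal.span_singleton_mul_left_unit (hg.map E.j), Ideal.span_singleton_one, ← Ideal.one_eq_top,
    one_pow, one_mul]

theorem sqRep_parity {I : Ideal R} {a m : GaussianInt} (ha : a ≠ 0) (n : ℕ)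
    (h : SqRep I (E.j (a ^ n * m))) : SqRep I (E.j (a ^ (n % 2) * m)) := by
  refine SqRep.of_mul_sq (n := E.j (a ^ (n / 2))) (E.j_ne_zero (pow_ne_zero _ ha)) (h.congr ?_)
  rw [← map_pow, ← map_mul]
  congr 1
  conv_lhs => rw [← Nat.mod_add_div n 2, pow_add, pow_mul]
  ring

section ramified

variable [Module.Free ℤ R] [Module.Finite ℤ R]

theorem eq_ramified {l : ℕ} [Fact l.Prime] (P : GaussPrime l) (h4 : Module.finrank ℤ R = 4)
    {w : GaussianInt} (hd : E.d = P.v * w) (hw : IsCoprime P.v w) {Q : Ideal R} (hQ : Q.IsPrime)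
    (hv : E.j P.v ∈ Q) : Q = Ideal.span {E.j P.v, E.θ} := by
  have hpr : (Ideal.absNorm (Ideal.span {E.j P.v, E.θ})).Prime := by
    rw [E.absNorm_ramified P h4 hd hw]
    exact Fact.out
  obtain ⟨h1, h2⟩ := prime_of_absNorm_prime hpr
  refine ((h1.isMaximal h2).eq_of_le hQ.ne_top ?_).symm
  rw [Ideal.span_le]
  rintro z (rfl | rfl)
  · exact hv
  · refine hQ.mem_of_pow_mem 2 ?_
    rw [E.sq_θ, hd, map_mul]
    exact Q.mul_mem_right _ hv

theorem sqRep_of_mem {l : ℕ} [Fact l.Prime] (P : GaussPrime l) (h4 : Module.finrank ℤ R = 4)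
    {w : GaussianInt} (hd : E.d = P.v * w) (hw : IsCoprime P.v w) {Q : Ideal R} (hQ : Q.IsPrime)
    (hv : E.j P.v ∈ Q) : SqRep Q (E.j P.v) :=
  E.eq_ramified P h4 hd hw hQ hv ▸ SqRep.of_sq (E.sq_ramified hd hw)

omit [IsDedekindDomain R] [Module.Free ℤ R] [Module.Finite ℤ R] in
theorem sq_ramified_two {n : ℤ} (hd : E.d = -gI * n) (hn : n % 4 = 1) :
    Ideal.span {E.j (1 + gI), 1 + E.θ} ^ 2 = Ideal.span {E.j (1 + gI)} := by
  obtain ⟨m, rfl⟩ : ∃ m, n = 1 + 4 * m := ⟨n / 4, by omega⟩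
  have hθ := E.sq_θ
  rw [hd] at hθ
  simp only [map_mul, map_neg, map_intCast] at hθ
  push_cast at hθ
  have hI := E.sq_I
  set i := E.j gI
  refine Ideal.span_pair_sq (w := -i - 2 * m * i * (1 - i) + (1 - i) * E.θ)
    (a := 2 * m * i - E.θ) (b := 0) (c := i) ?_ ?_
  · rw [map_add, map_one]
    linear_combination hθ + (1 - 2 * m * i + E.θ) * hI
  · rw [map_add, map_one]
    linear_combination (-1 - E.θ + 2 * m * i) * hI

end ramified

end Quartic

theorem GaussPrime.isCoprime_of_red_ne_zero {l : ℕ} [Fact l.Prime] (P : GaussPrime l)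
    {w : GaussianInt} (h : P.red w ≠ 0) : IsCoprime P.v w :=
  (P.prime.irreducible.coprime_iff_not_dvd).2 fun h' => h ((P.red_eq_zero w).2 h')

theorem GaussPrime.v_ne_zero {l : ℕ} [Fact l.Prime] (P : GaussPrime l) : P.v ≠ 0 := P.prime.ne_zero

theorem one_add_gI_sq_mul : (1 + gI) ^ 2 * (-gI) = 2 := by decide

theorem one_add_gI_ne_zero : 1 + gI ≠ 0 := by decide

theorem exists_half {R : Type*} [CommRing R] [IsDomain R] [IsIntegrallyClosed R] {θ : R} {m : ℤ}
    (h2 : (2 : R) ≠ 0) (h : θ ^ 2 = 1 + 4 * m) : ∃ ω : R, 2 * ω = 1 + θ ∧ ω ^ 2 = ω + m := by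
  let f := algebraMap R (FractionRing R)
  have hf : Function.Injective f := IsFractionRing.injective R _
  have h2' : f 2 ≠ 0 := (map_ne_zero_iff f hf).2 h2
  have h' := congrArg f h
  simp only [map_pow, map_add, map_one, map_mul, map_intCast, map_ofNat] at h' h2'
  have key : ((1 + f θ) / 2) ^ 2 = (1 + f θ) / 2 + m := by
    field_simp
    linear_combination h'
  have h_int : IsIntegral R ((1 + f θ) / 2) := by
    refine ⟨Polynomial.X ^ 2 - (Polynomial.X + Polynomial.C (m : R)), ?_, ?_⟩
    · monicity!
    · simp only [Polynomial.eval₂_sub, Polynomial.eval₂_add, Polynomial.eval₂_pow,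
        Polynomial.eval₂_X, Polynomial.eval₂_C]
      rw [key, map_intCast, sub_self]
  obtain ⟨ω, hω⟩ := IsIntegrallyClosed.isIntegral_iff.1 h_int
  refine ⟨ω, hf ?_, hf ?_⟩
  · simp only [map_mul, map_add, map_one, map_ofNat]
    change 2 * f ω = _
    rw [show f ω = _ from hω]
    field_simp
  · simp only [map_add, map_pow, map_intCast]
    rw [show f ω = _ from hω, key]

theorem absNorm_ne_of_half {R : Type*} [CommRing R] [IsDedekindDomain R] [Module.Free ℤ R]
    [Module.Finite ℤ R] {ω : R} {m : ℤ} (hm : m % 2 = 1) (hω : ω ^ 2 = ω + m) (Q : Ideal R) :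
    Ideal.absNorm Q ≠ 2 := by
  intro h
  have hpr : (Ideal.absNorm Q).Prime := h ▸ Nat.prime_two
  obtain ⟨n, hn⟩ := intRes_of_absNorm_prime hpr ω
  have : ((n ^ 2 - n - m : ℤ) : R) ∈ Q := by
    have h1 : ((n ^ 2 - n - m : ℤ) : R) = -((ω + n - 1) * (ω - n)) := by
      push_cast
      linear_combination hω
    rw [h1, Ideal.neg_mem_iff]
    exact Q.mul_mem_left _ hn
  rw [int_mem_iff_of_absNorm_prime hpr, h] at this
  obtain ⟨k, hk⟩ := this
  have : (n * (n - 1)) % 2 = 0 := by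
    rcases Int.emod_two_eq_zero_or_one n with h | h
    · rw [Int.mul_emod, h]; simp
    · rw [Int.mul_emod, Int.sub_emod, h]; simp
  have h3 : n * (n - 1) = m + 2 * k := by push_cast at hk; linear_combination hk
  omega

namespace Quartic

variable {R : Type*} [CommRing R] [IsDedekindDomain R] (E : Quartic R)

omit [IsDedekindDomain R] in
theorem D_eq {n : ℕ} (h : E.c ^ 2 * E.d = (n : GaussianInt)) : (E.D : ℤ) = n := by
  have := E.sq_c.symm.trans h
  have h2 := congrArg Zsqrtd.re this
  rwa [Zsqrtd.re_natCast, Zsqrtd.re_natCast] at h2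

variable {p q : ℕ} [Fact p.Prime] [Fact q.Prime]

theorem exists_isFund_prime (hp : p % 8 = 5) (hd : E.d = (p : GaussianInt)) (hc : E.c = 1)
    (P : GaussPrime p) : ∃ P' : GaussPrime p, (P' = P ∨ P' = P.conj) ∧ ∃ ε, E.IsFund ε P'.v := by
  obtain ⟨a, b, h, P', hP', k, w, hw⟩ := neg_pell_factor_prime hp P
  exact ⟨P', hP', E.exists_isFund (by rw [E.D_eq (n := p) (by rw [hc, hd]; ring), h]) hw⟩

theorem exists_isFund_two_mul (hq : q % 8 = 5) (hd : E.d = -gI * (q : GaussianInt))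
    (hc : E.c = 1 + gI) (Q : GaussPrime q) :
    ∃ Q' : GaussPrime q, (Q' = Q ∨ Q' = Q.conj) ∧ ∃ ε, E.IsFund ε ((1 + gI) * Q'.v) := by
  obtain ⟨a, b, h, Q', hQ', k, w, hw⟩ := neg_pell_factor_two_mul hq Q
  refine ⟨Q', hQ', E.exists_isFund (b := b) ?_ hw⟩
  rw [E.D_eq (n := 2 * q), h]
  · push_cast; ring
  · rw [hc, hd]
    push_cast
    linear_combination (q : GaussianInt) * one_add_gI_sq_mul

theorem exists_isFund_two_mul_mul (hp : p % 8 = 5) (hq : q % 8 = 5) (hne : p ≠ q)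
    (hd : E.d = -gI * (p * q : GaussianInt)) (hc : E.c = 1 + gI) (P : GaussPrime p)
    (Q : GaussPrime q) :
    ∃ P' : GaussPrime p, (P' = P ∨ P' = P.conj) ∧ ∃ Q' : GaussPrime q, (Q' = Q ∨ Q' = Q.conj) ∧
      ∃ ε, E.IsFund ε ((1 + gI) * P'.v * Q'.v) := by
  obtain ⟨a, b, h, P', hP', Q', hQ', k, w, hw⟩ := neg_pell_factor_two_mul_mul hp hq hne P Q
  refine ⟨P', hP', Q', hQ', E.exists_isFund (b := b) ?_ hw⟩
  rw [E.D_eq (n := 2 * p * q), h]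
  · push_cast; ring
  · rw [hc, hd]
    push_cast
    linear_combination (p * q : GaussianInt) * one_add_gI_sq_mul

omit [IsDedekindDomain R] in
theorem mem_two {Q : Ideal R} (hQ : Q.IsPrime) {m : GaussianInt} (h : E.j (2 * m) ∈ Q) :
    E.j (1 + gI) ∈ Q ∨ E.j m ∈ Q := by
  rw [show (2 : GaussianInt) = -gI * (1 + gI) ^ 2 by decide, map_mul] at h
  rcases hQ.mem_or_mem h with h | h
  · left
    rw [map_mul, map_pow] at h
    refine hQ.mem_of_pow_mem 2 ((hQ.mem_or_mem h).resolve_left fun h' => hQ.ne_top ?_)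
    exact Ideal.eq_top_of_isUnit_mem _ h' ((gI_isUnit.neg).map E.j)
  · exact Or.inr h

omit [IsDedekindDomain R] in
theorem mem_prime {Q : Ideal R} (hQ : Q.IsPrime) (P : GaussPrime p) (h : E.j (p : GaussianInt) ∈ Q) :
    ∃ P' : GaussPrime p, (P' = P ∨ P' = P.conj) ∧ E.j P'.v ∈ Q := by
  rw [← P.mul_conj, map_mul] at h
  rcases hQ.mem_or_mem h with h | h
  · exact ⟨P, Or.inl rfl, h⟩
  · exact ⟨P.conj, Or.inr rfl, h⟩

theorem sqRep_prime_of_choice {P P' P'' : GaussPrime p} (h' : P' = P ∨ P' = P.conj)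
    (h'' : P'' = P ∨ P'' = P.conj) {m : GaussianInt} (hs : SqRep (⊤ : Ideal R) (E.j (m * P'.v)))
    {x : GaussianInt} (hsx : SqRep (⊤ : Ideal R) (E.j (x * p))) :
    SqRep (⊤ : Ideal R) (E.j (m * P''.v)) ∨ SqRep (⊤ : Ideal R) (E.j (x * m * P''.v)) := by
  by_cases heq : P'.v = P''.v
  · left; rwa [← heq]
  · right
    have hp : P'.v * P''.v = p := by
      rcases h' with rfl | rfl <;> rcases h'' with rfl | rfl
      · exact absurd rfl heq
      · exact P'.mul_conj
      · rw [mul_comm]; exact P''.mul_conj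
      · exact absurd rfl heq
    refine SqRep.of_mul_sq (n := E.j P'.v) (E.j_ne_zero P'.v_ne_zero) ?_
    refine (hs.mul_top hsx).congr ?_
    rw [← hp]
    simp only [map_mul]
    ring

theorem sqRep_top (hp : p % 8 = 5) (hd : E.d = (p : GaussianInt)) (hc : E.c = 1)
    (P : GaussPrime p) : SqRep (⊤ : Ideal R) (E.j P.v) := by
  obtain ⟨P', h', ε, hε⟩ := E.exists_isFund_prime hp hd hc P
  have := E.sqRep_prime_of_choice h' (Or.inl rfl) (m := 1) (x := 1)
    (by rw [one_mul]; exact hε.sqRep _ P'.v_ne_zero) (E.sqRep_d isUnit_one (by rw [hd]; ring))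
  simpa using this

theorem sqRep_top_two (hq : q % 8 = 5) (hd : E.d = -gI * (q : GaussianInt)) (hc : E.c = 1 + gI)
    (Q : GaussPrime q) : SqRep (⊤ : Ideal R) (E.j ((1 + gI) * Q.v)) := by
  obtain ⟨Q', h', ε, hε⟩ := E.exists_isFund_two_mul hq hd hc Q
  have htop := E.sqRep_prime_of_choice h' (Or.inl rfl) (x := 1)
    (hε.sqRep _ (mul_ne_zero one_add_gI_ne_zero Q'.v_ne_zero))
    (E.sqRep_d gI_isUnit.neg (by rw [hd]; ring))
  rwa [one_mul, or_self] at htop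

variable [Module.Free ℤ R] [Module.Finite ℤ R]

/-- The field of square roots of `-1` and `p` has odd class number. -/
theorem idealClass_eq_one (h4 : Module.finrank ℤ R = 4) (hp : p % 8 = 5)
    (hd : E.d = (p : GaussianInt)) (hc : E.c = 1) {I : Ideal R} {n : ℕ}
    (h : idealClass I ^ 2 ^ n = 1) : idealClass I = 1 := by
  obtain ⟨P⟩ := exists_gaussPrime hp
  have hcop : ∀ P : GaussPrime p, IsCoprime P.v P.conj.v :=
    fun P => P.isCoprime_of_red_ne_zero P.red_star_ne_zero
  have hdP : ∀ P : GaussPrime p, E.d = P.v * P.conj.v := fun P => by rw [hd, P.mul_conj]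
  obtain ⟨m, hm⟩ : ∃ m : ℤ, (p : ℤ) = 1 + 4 * m := ⟨p / 4, by omega⟩
  have h2R : (2 : R) ≠ 0 := by
    have := E.j_ne_zero (x := 2) (by decide)
    rwa [map_ofNat] at this
  obtain ⟨ω, -, hω⟩ := exists_half (θ := E.θ) (m := m) h2R (by
    rw [E.sq_θ, hd, map_natCast]; exact_mod_cast congrArg (Int.cast : ℤ → R) hm)
  have key : ∀ J : Ideal R, J ≠ ⊥ → idealClass J ^ 2 = 1 → idealClass J = 1 := by
    intro J hJ hJ2
    obtain ⟨x, hx, hs⟩ := E.exists_sqRep P h4 hp (hdP P) (hcop P) ⊥ (fun Q hQ hQ0 _ hmem => by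
      refine ⟨1, Submonoid.mem_bot.2 rfl, ?_⟩
      rw [map_one]
      rcases E.mem_two hQ hmem with h | h
      · have := eq_of_absNorm_sq Nat.prime_two (E.absNorm_span_one_add_gI h4) hQ
          ((Ideal.span_singleton_le_iff_mem _).2 h) (absNorm_ne_of_half (by omega) hω Q)
        rw [this]
        simpa using SqRep.span_mul (E.j_ne_zero one_add_gI_ne_zero) (SqRep.top_one (R := R))
      · rw [hd] at h
        obtain ⟨P', -, hmem'⟩ := E.mem_prime hQ P h
        refine SqRep.cancel (E.j_ne_zero P'.v_ne_zero) ?_ (E.sqRep_top hp hd hc P')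
        rw [mul_one]
        exact E.sqRep_of_mem P' h4 (hdP P') (hcop P') hQ hmem') hJ hJ2
    rw [Submonoid.mem_bot.1 hx, map_one] at hs
    exact hs.class_eq_one hJ
  obtain ⟨x, hx⟩ : ∃ x, idealClass I = x := ⟨_, rfl⟩
  rw [hx] at h ⊢
  induction n with
  | zero => simpa using h
  | succ n ih =>
    apply ih
    obtain ⟨J, hJ, hJx⟩ := exists_idealClass_eq (x ^ 2 ^ n)
    rw [← hJx]
    refine key J hJ ?_
    rw [hJx, ← pow_mul, ← pow_succ, h]

end Quartic

/-- The Gaussian integers with all prime factors among `1 + i` and those of `p`. -/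
def ramifiedSubmonoid {p : ℕ} [Fact p.Prime] (P : GaussPrime p) : Submonoid GaussianInt where
  carrier := {m | ∃ a b c : ℕ, m = P.v ^ a * P.conj.v ^ b * (1 + gI) ^ c}
  one_mem' := ⟨0, 0, 0, by simp⟩
  mul_mem' := by
    rintro _ _ ⟨a, b, c, rfl⟩ ⟨a', b', c', rfl⟩
    exact ⟨a + a', b + b', c + c', by ring⟩

theorem v_mem_ramifiedSubmonoid {p : ℕ} [Fact p.Prime] {P P' : GaussPrime p}
    (h : P' = P ∨ P' = P.conj) : P'.v ∈ ramifiedSubmonoid P := by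
  rcases h with rfl | rfl
  · exact ⟨1, 0, 0, by ring⟩
  · exact ⟨0, 1, 0, by ring⟩

theorem one_add_gI_mem_ramifiedSubmonoid {p : ℕ} [Fact p.Prime] (P : GaussPrime p) :
    1 + gI ∈ ramifiedSubmonoid P := ⟨0, 0, 1, by ring⟩

namespace Quartic

variable {R : Type*} [CommRing R] [IsDedekindDomain R] [Module.Free ℤ R] [Module.Finite ℤ R]
  (E : Quartic R) {p q : ℕ} [Fact p.Prime] [Fact q.Prime]

theorem absNorm_ramified_two (h4 : Module.finrank ℤ R = 4) {n : ℤ} (hd : E.d = -gI * n)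
    (hn : n % 4 = 1) : Ideal.absNorm (Ideal.span {E.j (1 + gI), 1 + E.θ}) = 2 := by
  have h := E.absNorm_span_one_add_gI h4
  rw [← E.sq_ramified_two hd hn, map_pow] at h
  exact Nat.pow_left_injective two_ne_zero h

theorem sqRep_of_mem_two (h4 : Module.finrank ℤ R = 4) {n : ℤ} (hd : E.d = -gI * n)
    (hn : n % 4 = 1) {Q : Ideal R} (hQ : Q.IsPrime) (h : E.j (1 + gI) ∈ Q) :
    SqRep Q (E.j (1 + gI)) := by
  obtain ⟨h1, h2⟩ := prime_of_absNorm_prime (E.absNorm_ramified_two h4 hd hn ▸ Nat.prime_two)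
  have hsq := E.sq_ramified_two hd hn
  rw [(h1.isMaximal h2).eq_of_le hQ.ne_top] at hsq
  · exact SqRep.of_sq hsq
  · rw [Ideal.span_le]
    rintro z (rfl | rfl)
    · exact h
    · refine hQ.mem_of_pow_mem 2 ((Ideal.span_singleton_le_iff_mem _).2 h ?_)
      rw [← hsq]
      exact Ideal.pow_mem_pow (Ideal.subset_span (by simp)) 2

section

variable (h4 : Module.finrank ℤ R = 4) (hq : q % 8 = 5)

include h4 hq

theorem exists_sqRep_pow (hd : E.d = -gI * (q : GaussianInt)) (hc : E.c = 1 + gI)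
    {I : Ideal R} (hI : I ≠ ⊥) (h : idealClass I ^ 2 = 1) :
    ∃ c : ℕ, SqRep I (E.j ((1 + gI) ^ c)) := by
  obtain ⟨Q⟩ := exists_gaussPrime hq
  have hg : ∀ Q : GaussPrime q, E.d = Q.v * (-gI * Q.conj.v) := fun Q => by
    rw [hd, ← Q.mul_conj]; ring
  have hcop : ∀ Q : GaussPrime q, IsCoprime Q.v (-gI * Q.conj.v) := fun Q =>
    Q.isCoprime_of_red_ne_zero (by
      rw [map_mul, map_neg]
      exact mul_ne_zero (neg_ne_zero.2 Q.red_gI_ne_zero) Q.red_star_ne_zero)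
  obtain ⟨m, ⟨c, rfl⟩, hm⟩ := E.exists_sqRep Q h4 hq (hg Q) (hcop Q) (Submonoid.powers (1 + gI)) (by
    intro P hP hP0 _ hmem
    refine ⟨1 + gI, Submonoid.mem_powers _, ?_⟩
    rcases E.mem_two hP hmem with h | h
    · exact E.sqRep_of_mem_two h4 (n := q) (by rw [hd]; norm_cast) (by omega) hP h
    · rw [hd, map_mul] at h
      obtain ⟨Q'', -, hmem'⟩ := E.mem_prime hP Q ((hP.mem_or_mem h).resolve_left fun h' =>
        hP.ne_top (Ideal.eq_top_of_isUnit_mem _ h' (gI_isUnit.neg.map E.j)))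
      refine SqRep.of_mul_sq (n := E.j Q''.v) (E.j_ne_zero Q''.v_ne_zero)
        (((E.sqRep_of_mem Q'' h4 (hg Q'') (hcop Q'') hP hmem').mul_top
          (E.sqRep_top_two hq hd hc Q'')).congr ?_)
      simp only [map_mul]
      ring) hI h
  exact ⟨c, hm⟩

theorem sq_idealClass_eq_one (hd : E.d = -gI * (q : GaussianInt)) (hc : E.c = 1 + gI) {I : Ideal R}
    {n : ℕ} (h : idealClass I ^ 2 ^ n = 1) : idealClass I ^ 2 = 1 := by
  refine pow_two_eq_one_of_pow_two_pow (fun x hx => ?_) h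
  obtain ⟨J, hJ, rfl⟩ := exists_idealClass_eq x
  obtain ⟨c, hs⟩ := E.exists_sqRep_pow h4 hq hd hc (pow_ne_zero 2 hJ)
    (by rw [idealClass_pow hJ, ← pow_mul, hx])
  have hs' := E.sqRep_parity (m := 1) one_add_gI_ne_zero c (by rwa [mul_one])
  rw [← idealClass_pow hJ]
  refine SqRep.class_eq_one (pow_ne_zero 2 hJ) ?_
  rcases Nat.mod_two_eq_zero_or_one c with h0 | h0 <;> rw [h0] at hs'
  · simpa using hs'
  · exfalso
    obtain ⟨e, x, y, z, hz, hxyz⟩ := E.norm_form_of_sqRep_sq hJ hs'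
    rw [hd] at hxyz
    exact not_norm_one_add_gI hq hz (by rw [hxyz]; ring)

omit h4 [Module.Free ℤ R] [Module.Finite ℤ R] in
theorem quadraticChar_of_sqRep (hd : E.d = -gI * (q : GaussianInt))
    {I : Ideal R} {c : ℕ} (hs : SqRep I (E.j ((1 + gI) ^ c))) {g : GaussianInt}
    (hg : I * I.map E.s = Ideal.span {E.j g}) (hgq : (g.norm : ZMod q) ≠ 0) :
    quadraticChar (ZMod q) g.norm = (-1) ^ c := by
  obtain ⟨Q⟩ := exists_gaussPrime hq
  obtain ⟨e, x, y, z, hz, h⟩ := E.norm_form_of_sqRep hs hg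
  have h0 : ∀ Q : GaussPrime q, Q.red (-gI) ≠ 0 := fun Q => by
    rw [map_neg]
    exact neg_ne_zero.2 Q.red_gI_ne_zero
  have hn : (gI ^ e * ((1 + gI) ^ c * g)).norm = 2 ^ c * g.norm := by
    simp only [Zsqrtd.norm_mul, norm_pow_gaussian, norm_gI, norm_one_add_gI, one_pow, one_mul]
  have key := char_condition_norm Q (h0 Q) (h0 Q.conj)
    (m := gI ^ e * ((1 + gI) ^ c * g)) (by
      rw [hn]
      push_cast
      exact mul_ne_zero (pow_ne_zero _ (two_ne_zero_zmod hq)) hgq)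
    (x := x) (y := y) (by rw [← h, hd]; ring) hz
  rw [hn] at key
  push_cast at key
  rw [map_mul, map_pow, quadraticChar_two' hq] at key
  rcases Nat.even_or_odd c with hc | hc
  · rw [hc.neg_one_pow] at key ⊢; linarith
  · rw [hc.neg_one_pow] at key ⊢; linarith

end

section

variable (h4 : Module.finrank ℤ R = 4) (hp : p % 8 = 5) (hq : q % 8 = 5) (hne : p ≠ q)
  (P : GaussPrime p)

include h4 hp hq hne

theorem exists_sqRep_pow_mul (hd : E.d = -gI * (p * q : GaussianInt)) (hc : E.c = 1 + gI)
    {I : Ideal R} (hI : I ≠ ⊥) (h : idealClass I ^ 2 = 1) :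
    ∃ a b c : ℕ, SqRep I (E.j (P.v ^ a * P.conj.v ^ b * (1 + gI) ^ c)) := by
  obtain ⟨Q⟩ := exists_gaussPrime hq
  have hgP : ∀ P : GaussPrime p, E.d = P.v * (-gI * P.conj.v * q) := fun P => by
    rw [hd, ← P.mul_conj]; ring
  have hgQ : ∀ Q : GaussPrime q, E.d = Q.v * (-gI * Q.conj.v * p) := fun Q => by
    rw [hd, ← Q.mul_conj]; ring
  have hcopP : ∀ P : GaussPrime p, IsCoprime P.v (-gI * P.conj.v * q) := fun P =>
    P.isCoprime_of_red_ne_zero (by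
      rw [map_mul, map_mul, map_neg, map_natCast]
      exact mul_ne_zero (mul_ne_zero (neg_ne_zero.2 P.red_gI_ne_zero) P.red_star_ne_zero)
        (natCast_prime_ne_zero hne))
  have hcopQ : ∀ Q : GaussPrime q, IsCoprime Q.v (-gI * Q.conj.v * p) := fun Q =>
    Q.isCoprime_of_red_ne_zero (by
      rw [map_mul, map_mul, map_neg, map_natCast]
      exact mul_ne_zero (mul_ne_zero (neg_ne_zero.2 Q.red_gI_ne_zero) Q.red_star_ne_zero)
        (natCast_prime_ne_zero hne.symm))
  have hpS : (p : GaussianInt) ∈ ramifiedSubmonoid P := by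
    rw [← P.mul_conj]
    exact mul_mem (v_mem_ramifiedSubmonoid (Or.inl rfl)) (v_mem_ramifiedSubmonoid (Or.inr rfl))
  obtain ⟨m, ⟨a, b, c, rfl⟩, hm⟩ := E.exists_sqRep Q h4 hq (hgQ Q) (hcopQ Q) (ramifiedSubmonoid P) (by
    intro J hJ hJ0 _ hmem
    rcases E.mem_two hJ hmem with h | h
    · refine ⟨1 + gI, one_add_gI_mem_ramifiedSubmonoid P, ?_⟩
      refine E.sqRep_of_mem_two h4 (n := p * q) (by rw [hd]; norm_cast) ?_ hJ h
      rw [Int.mul_emod, show (p : ℤ) % 4 = 1 by omega, show (q : ℤ) % 4 = 1 by omega]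
      norm_num
    · rw [hd, map_mul] at h
      have h := (hJ.mem_or_mem h).resolve_left fun h' =>
        hJ.ne_top (Ideal.eq_top_of_isUnit_mem _ h' (gI_isUnit.neg.map E.j))
      rw [map_mul] at h
      rcases hJ.mem_or_mem h with h | h
      · obtain ⟨P'', h'', hmem'⟩ := E.mem_prime hJ P h
        exact ⟨P''.v, v_mem_ramifiedSubmonoid h'',
          E.sqRep_of_mem P'' h4 (hgP P'') (hcopP P'') hJ hmem'⟩
      · obtain ⟨Q'', h'', hmem'⟩ := E.mem_prime hJ Q h
        obtain ⟨P', hP', Q', h', ε, hε⟩ := E.exists_isFund_two_mul_mul hp hq hne hd hc P Q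
        have key : ∀ m, SqRep (⊤ : Ideal R) (E.j (m * Q''.v)) → SqRep J (E.j m) := fun m hm => by
          refine SqRep.of_mul_sq (n := E.j Q''.v) (E.j_ne_zero Q''.v_ne_zero)
            (((E.sqRep_of_mem Q'' h4 (hgQ Q'') (hcopQ Q'') hJ hmem').mul_top hm).congr ?_)
          simp only [map_mul]
          ring
        have hmS := mul_mem (one_add_gI_mem_ramifiedSubmonoid P) (v_mem_ramifiedSubmonoid hP')
        rcases E.sqRep_prime_of_choice h' h'' (x := (p : GaussianInt))
          (hε.sqRep _ (mul_ne_zero (mul_ne_zero one_add_gI_ne_zero P'.v_ne_zero) Q'.v_ne_zero))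
          (E.sqRep_d gI_isUnit.neg (by rw [hd])) with htop | htop
        · exact ⟨_, hmS, key _ htop⟩
        · exact ⟨_, mul_mem hpS hmS, key _ htop⟩) hI h
  exact ⟨a, b, c, hm⟩

theorem sq_idealClass_eq_one' (hd : E.d = -gI * (p * q : GaussianInt)) (hc : E.c = 1 + gI)
    {I : Ideal R} {n : ℕ} (h : idealClass I ^ 2 ^ n = 1) : idealClass I ^ 2 = 1 := by
  obtain ⟨P⟩ := exists_gaussPrime hp
  refine pow_two_eq_one_of_pow_two_pow (fun x hx => ?_) h
  obtain ⟨J, hJ, rfl⟩ := exists_idealClass_eq x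
  obtain ⟨a, b, c, hs⟩ := E.exists_sqRep_pow_mul h4 hp hq hne P hd hc (pow_ne_zero 2 hJ)
    (by rw [idealClass_pow hJ, ← pow_mul, hx])
  have h1 := E.sqRep_parity P.v_ne_zero a (m := P.conj.v ^ b * (1 + gI) ^ c) (by rwa [← mul_assoc])
  have h2 := E.sqRep_parity P.conj.v_ne_zero b (m := P.v ^ (a % 2) * (1 + gI) ^ c)
    (h1.congr (by congr 1; ring))
  have h3 := E.sqRep_parity one_add_gI_ne_zero c (m := P.v ^ (a % 2) * P.conj.v ^ (b % 2))
    (h2.congr (by congr 1; ring))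
  obtain ⟨e, x, y, z, hz, hxyz⟩ := E.norm_form_of_sqRep_sq hJ h3
  rw [hd] at hxyz
  obtain ⟨ha, hb, hc⟩ := trivial_of_norm hp hq hne P (e := e) (a := a % 2) (b := b % 2) (c := c % 2)
    (x := x) (y := y) (z := z) (by omega) (by omega) (by omega) hz (by rw [hxyz]; ring)
  rw [← idealClass_pow hJ]
  refine SqRep.class_eq_one (pow_ne_zero 2 hJ) ?_
  simpa [ha, hb, hc] using h3

omit h4 hp [Module.Free ℤ R] [Module.Finite ℤ R] in
theorem quadraticChar_of_sqRep' (hd : E.d = -gI * (p * q : GaussianInt))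
    {I : Ideal R} {a b c : ℕ} (hs : SqRep I (E.j (P.v ^ a * P.conj.v ^ b * (1 + gI) ^ c)))
    {g : GaussianInt} (hg : I * I.map E.s = Ideal.span {E.j g}) (hgq : (g.norm : ZMod q) ≠ 0) :
    quadraticChar (ZMod q) g.norm = quadraticChar (ZMod q) p ^ (a + b) * (-1) ^ c := by
  obtain ⟨Q⟩ := exists_gaussPrime hq
  obtain ⟨e, x, y, z, hz, h⟩ := E.norm_form_of_sqRep hs hg
  have hp0 : (p : ZMod q) ≠ 0 := natCast_prime_ne_zero hne.symm
  have h0 : ∀ Q : GaussPrime q, Q.red (-gI * p) ≠ 0 := fun Q => by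
    rw [map_mul, map_neg, map_natCast]
    exact mul_ne_zero (neg_ne_zero.2 Q.red_gI_ne_zero) hp0
  have hn : (gI ^ e * (P.v ^ a * P.conj.v ^ b * (1 + gI) ^ c * g)).norm
      = p ^ (a + b) * 2 ^ c * g.norm := by
    simp only [Zsqrtd.norm_mul, norm_pow_gaussian, norm_gI, norm_one_add_gI, one_pow, one_mul,
      GaussPrime.norm_v]
    ring
  have key := char_condition_norm Q (h0 Q) (h0 Q.conj)
    (m := gI ^ e * (P.v ^ a * P.conj.v ^ b * (1 + gI) ^ c * g)) (by
      rw [hn]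
      push_cast
      exact mul_ne_zero (mul_ne_zero (pow_ne_zero _ hp0) (pow_ne_zero _ (two_ne_zero_zmod hq))) hgq)
    (x := x) (y := y) (by rw [← h, hd]; ring) hz
  rw [hn] at key
  push_cast at key
  rw [map_mul, map_mul, map_pow, map_pow, quadraticChar_two' hq] at key
  have h1 : quadraticChar (ZMod q) p ^ (a + b) * quadraticChar (ZMod q) p ^ (a + b) = 1 := by
    rw [← mul_pow, ← pow_two, quadraticChar_sq_one hp0, one_pow]
  have h2 : (-1 : ℤ) ^ c * (-1) ^ c = 1 := by rw [← mul_pow]; norm_num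
  linear_combination (quadraticChar (ZMod q) p ^ (a + b) * (-1) ^ c) * key
    - quadraticChar (ZMod q) g.norm * (-1) ^ c * (-1) ^ c * h1 - quadraticChar (ZMod q) g.norm * h2

end

end Quartic

/-- Two elements of a group with two generators that are independent modulo squares generate it
modulo squares. -/
theorem exists_mul_sq_of_generators {G : Type*} [CommGroup G] {t h x y : G}
    (hG : ∀ u : G, ∃ a b : ℤ, u = t ^ a * h ^ b) (hx : ∀ z, z ^ 2 ≠ x) (hy : ∀ z, z ^ 2 ≠ y)
    (hxy : ∀ z, z ^ 2 ≠ x * y) (u : G) : ∃ (a b : ℕ) (v : G), u = x ^ a * y ^ b * v ^ 2 := by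
  obtain ⟨a₁, b₁, h₁⟩ := hG x
  obtain ⟨a₂, b₂, h₂⟩ := hG y
  obtain ⟨a, b, hu⟩ := hG u
  have hsq : ∀ {a b : ℤ}, a % 2 = 0 → b % 2 = 0 → ∃ z, z ^ 2 = t ^ a * h ^ b := by
    intro a b ha hb
    refine ⟨t ^ (a / 2) * h ^ (b / 2), ?_⟩
    rw [mul_pow, ← zpow_natCast, ← zpow_natCast, ← zpow_mul, ← zpow_mul]
    congr 2 <;> push_cast <;> omega
  have n₁ : ¬(a₁ % 2 = 0 ∧ b₁ % 2 = 0) := fun ⟨e, e'⟩ => by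
    obtain ⟨z, hz⟩ := hsq e e'
    exact hx z (hz.trans h₁.symm)
  have n₂ : ¬(a₂ % 2 = 0 ∧ b₂ % 2 = 0) := fun ⟨e, e'⟩ => by
    obtain ⟨z, hz⟩ := hsq e e'
    exact hy z (hz.trans h₂.symm)
  have n₃ : ¬((a₁ + a₂) % 2 = 0 ∧ (b₁ + b₂) % 2 = 0) := fun ⟨e, e'⟩ => by
    obtain ⟨z, hz⟩ := hsq e e'
    refine hxy z (hz.trans ?_)
    rw [h₁, h₂, zpow_add, zpow_add]
    exact mul_mul_mul_comm _ _ _ _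
  have key : ∃ r s : ℕ, (a - r * a₁ - s * a₂) % 2 = 0 ∧ (b - r * b₁ - s * b₂) % 2 = 0 := by
    by_cases e1 : a % 2 = 0 ∧ b % 2 = 0
    · exact ⟨0, 0, by push_cast; omega⟩
    by_cases e2 : (a - a₁) % 2 = 0 ∧ (b - b₁) % 2 = 0
    · exact ⟨1, 0, by push_cast; omega⟩
    by_cases e3 : (a - a₂) % 2 = 0 ∧ (b - b₂) % 2 = 0
    · exact ⟨0, 1, by push_cast; omega⟩
    · exact ⟨1, 1, by push_cast; omega⟩
  obtain ⟨r, s, e, e'⟩ := key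
  obtain ⟨z, hz⟩ := hsq e e'
  refine ⟨r, s, z, ?_⟩
  rw [hz, hu, h₁, h₂, mul_pow, mul_pow]
  simp only [← zpow_natCast, ← zpow_mul]
  have split : ∀ g : G, ∀ c c₁ c₂ : ℤ,
      g ^ c = g ^ (c₁ * r) * g ^ (c₂ * s) * g ^ (c - r * c₁ - s * c₂) := fun g c c₁ c₂ => by
    rw [← zpow_add, ← zpow_add]
    congr 1
    ring
  rw [split t a a₁ a₂, split h b b₁ b₂]
  rw [mul_mul_mul_comm, mul_mul_mul_comm (t ^ (a₁ * r))]

namespace Quartic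

variable {R : Type*} [CommRing R] [IsDomain R] (E : Quartic R)

theorem j_gI_not_isSquare {l : ℕ} [Fact l.Prime] (P : GaussPrime l) {w : GaussianInt}
    (hd : E.d = P.v * w) (hw : P.red w ≠ 0) (y : R) : y ^ 2 ≠ E.j gI := by
  intro hy
  have hs : (E.s y) ^ 2 = y ^ 2 := by rw [← map_pow, hy, E.fix]
  rcases sq_eq_sq_iff_eq_or_eq_neg.1 hs with h | h
  · obtain ⟨z, rfl⟩ := E.desc y h
    exact gI_not_isSquare z (E.inj (by rw [map_pow, hy]))
  · obtain ⟨z, hz⟩ := E.desc (E.θ * y) (by rw [map_mul, E.s_θ, h]; ring)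
    have hz2 : z ^ 2 = P.v * (w * gI) := E.inj (by
      rw [map_pow, hz, mul_pow, hy, E.sq_θ, hd, ← mul_assoc, map_mul _ (P.v * w)])
    obtain ⟨t, rfl⟩ := P.prime.dvd_of_dvd_pow (Dvd.intro _ hz2.symm)
    have : P.v * t ^ 2 = w * gI :=
      mul_left_cancel₀ P.prime.ne_zero (by linear_combination hz2)
    have := congrArg P.red this
    rw [map_mul, map_mul, P.red_v, zero_mul] at this
    exact mul_ne_zero hw P.red_gI_ne_zero this.symm

theorem fund_not_isSquare {ε : R} (h1 : ε * E.s ε = -1) (h2 : E.κ ε = ε) (y : R) : y ^ 2 ≠ ε := by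
  rintro rfl
  obtain ⟨g, hg⟩ := E.exists_norm y
  have hκ : E.κ y * E.s (E.κ y) = y * E.s y := by
    rw [map_pow] at h2
    rcases sq_eq_sq_iff_eq_or_eq_neg.1 h2 with h | h
    · rw [h]
    · rw [h, map_neg, neg_mul_neg]
  have hstar : star g = g := E.inj (by rw [← E.κ_j, hg, map_mul, E.κ_s, hκ])
  have hg2 : g ^ 2 = -1 := E.inj (by
    rw [map_pow, hg, map_neg, map_one, ← h1, map_pow]; ring)
  have him : g.im = 0 := by
    have := congrArg Zsqrtd.im hstar
    rw [Zsqrtd.im_star] at this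
    omega
  have hre := congrArg Zsqrtd.re hg2
  rw [pow_two, Zsqrtd.re_mul, him] at hre
  simp only [mul_zero, add_zero, Zsqrtd.re_neg, Zsqrtd.re_one] at hre
  nlinarith [sq_nonneg g.re]

theorem gI_mul_fund_not_isSquare {ε : R} (h1 : ε * E.s ε = -1) (h2 : E.κ ε = ε) (y : R) :
    y ^ 2 ≠ E.j gI * ε := by
  intro hy
  have hκ : (E.κ y) ^ 2 = -E.j gI * ε := by
    rw [← map_pow, hy, map_mul, E.κ_j, h2, ← map_neg]
    rfl
  have hsq : (y * E.κ y) ^ 2 = ε ^ 2 := by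
    rw [mul_pow, hy, hκ]
    linear_combination -ε ^ 2 * E.sq_I
  obtain ⟨g, hg⟩ := E.exists_norm y
  have hn : y * E.κ y * E.s (y * E.κ y) = -1 := by
    rcases sq_eq_sq_iff_eq_or_eq_neg.1 hsq with h | h
    · rw [h, h1]
    · rw [h, map_neg, neg_mul_neg, h1]
  have hgg : g * star g = -1 := E.inj (by
    rw [map_mul, ← E.κ_j, hg, map_neg, map_one, ← hn, map_mul, map_mul, E.κ_s]; ring)
  have h3 := congrArg Zsqrtd.re hgg
  rw [← Zsqrtd.norm_eq_mul_conj, Zsqrtd.re_intCast, Zsqrtd.re_neg, Zsqrtd.re_one] at h3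
  have := GaussianInt.norm_nonneg g
  omega

/-- Units modulo squares. -/
theorem exists_unit_eq {l : ℕ} [Fact l.Prime] (P : GaussPrime l) {w : GaussianInt}
    (hd : E.d = P.v * w) (hw : P.red w ≠ 0) {t h : Rˣ}
    (hG : ∀ u : Rˣ, ∃ a b : ℤ, u = t ^ a * h ^ b) {ε : R} (h1 : ε * E.s ε = -1) (h2 : E.κ ε = ε)
    {u : R} (hu : IsUnit u) :
    ∃ (a b : ℕ) (v : R), IsUnit v ∧ u = E.j gI ^ a * ε ^ b * v ^ 2 := by
  obtain ⟨x, hx⟩ := gI_isUnit.map E.j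
  obtain ⟨y, hy⟩ := E.isUnit_of_norm h1
  obtain ⟨u, rfl⟩ := hu
  obtain ⟨a, b, v, rfl⟩ := exists_mul_sq_of_generators hG (x := x) (y := y)
    (fun z hz => E.j_gI_not_isSquare P hd hw z (by rw [← hx, ← hz, Units.val_pow_eq_pow_val]))
    (fun z hz => E.fund_not_isSquare h1 h2 z (by rw [← hy, ← hz, Units.val_pow_eq_pow_val]))
    (fun z hz => E.gI_mul_fund_not_isSquare h1 h2 z
      (by rw [← hx, ← hy, ← Units.val_mul, ← hz, Units.val_pow_eq_pow_val])) u
  exact ⟨a, b, v, v.isUnit, by simp [hx, hy]⟩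

end Quartic

namespace Layer

variable {S R : Type*} [CommRing S] [CommRing R] [IsDedekindDomain S] [IsDedekindDomain R]
  (Λ : Layer S R)

/-- The norm of an ideal class of `2`-power order. -/
theorem exists_norm_ideal {I : Ideal R} (hI : I ≠ ⊥) {n : ℕ} (h : idealClass I ^ n = 1) :
    ∃ B : Ideal S, B ≠ ⊥ ∧ B.map Λ.j = I * I.map Λ.s ∧ idealClass B ^ n = 1 := by
  obtain ⟨B, hB⟩ := Λ.exists_map_eq I
  have hB0 : B ≠ ⊥ := by
    rintro rfl
    rw [Ideal.map_bot] at hB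
    exact mul_ne_zero hI (Λ.map_s_ne_bot hI) hB.symm
  refine ⟨B, hB0, hB, ?_⟩
  rw [← idealClass_pow hI, idealClass_eq_one_iff (pow_ne_zero n hI)] at h
  obtain ⟨x, hx, hIx⟩ := h
  obtain ⟨g, hg⟩ := Λ.exists_norm x
  have hg0 : g ≠ 0 := by
    rintro rfl
    rw [map_zero] at hg
    exact mul_ne_zero hx (Λ.s_ne_zero hx) hg.symm
  rw [← idealClass_pow hB0, Λ.isPrincipal_of_map (B := B ^ n) hg0, idealClass_span hg0]
  rw [Ideal.map_pow, hB, mul_pow, ← Ideal.map_pow, hIx, Λ.map_s_span,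
    Ideal.span_singleton_mul_span_singleton, hg]

end Layer

/-- A biquadratic extension `O` of the Gaussian integers with its three quadratic
subextensions, those of the square roots of `p`, `2 * q` and `2 * p * q`. -/
structure Octic (p q : ℕ) (RL RM Rk O : Type*) [CommRing RL] [CommRing RM] [CommRing Rk]
    [CommRing O] where
  hp : p % 8 = 5
  hq : q % 8 = 5
  hne : p ≠ q
  EL : Quartic RL
  EM : Quartic RM
  Ek : Quartic Rk
  ΛL : Layer RL O
  ΛM : Layer RM O
  Λk : Layer Rk O
  j_M : ∀ z, ΛM.j (EM.j z) = ΛL.j (EL.j z)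
  j_k : ∀ z, Λk.j (Ek.j z) = ΛL.j (EL.j z)
  s_comm : ∀ x, ΛL.s (ΛM.s x) = ΛM.s (ΛL.s x)
  s_k : ∀ x, Λk.s x = ΛL.s (ΛM.s x)
  s_L_j : ∀ x, ΛM.s (ΛL.j x) = ΛL.j (EL.s x)
  s_M_j : ∀ x, ΛL.s (ΛM.j x) = ΛM.j (EM.s x)
  s_k_j : ∀ x, ΛL.s (Λk.j x) = Λk.j (Ek.s x)
  κ : O ≃+* O
  κ_L : ∀ x, κ (ΛL.j x) = ΛL.j (EL.κ x)
  κ_M : ∀ x, κ (ΛM.j x) = ΛM.j (EM.κ x)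
  κ_k : ∀ x, κ (Λk.j x) = Λk.j (Ek.κ x)
  d_L : EL.d = p
  c_L : EL.c = 1
  d_M : EM.d = -gI * q
  c_M : EM.c = 1 + gI
  d_k : Ek.d = -gI * (p * q)
  c_k : Ek.c = 1 + gI
  units_L : ∃ t h : RLˣ, ∀ u, ∃ a b : ℤ, u = t ^ a * h ^ b
  units_M : ∃ t h : RMˣ, ∀ u, ∃ a b : ℤ, u = t ^ a * h ^ b
  units_k : ∃ t h : Rkˣ, ∀ u, ∃ a b : ℤ, u = t ^ a * h ^ b
  rank_L : Module.finrank ℤ RL = 4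
  rank_M : Module.finrank ℤ RM = 4
  rank_k : Module.finrank ℤ Rk = 4
  rank_O : Module.finrank ℤ O = 8

namespace Octic

variable {p q : ℕ} {RL RM Rk O : Type*} [CommRing RL] [CommRing RM] [CommRing Rk] [CommRing O]
  (X : Octic p q RL RM Rk O)

/-- The embedding of the Gaussian integers. -/
def φ : GaussianInt →+* O := X.ΛL.j.comp X.EL.j

/-- The square root of `p`. -/
def α : O := X.ΛL.j X.EL.θ

/-- A square root of `-q` times the imaginary unit. -/
def β : O := X.ΛM.j X.EM.θ

theorem φ_L (z : GaussianInt) : X.ΛL.j (X.EL.j z) = X.φ z := rfl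

theorem φ_M (z : GaussianInt) : X.ΛM.j (X.EM.j z) = X.φ z := X.j_M z

theorem φ_k (z : GaussianInt) : X.Λk.j (X.Ek.j z) = X.φ z := X.j_k z

theorem φ_injective : Function.Injective X.φ := X.ΛL.inj.comp X.EL.inj

theorem φ_ne_zero {z : GaussianInt} (hz : z ≠ 0) : X.φ z ≠ 0 :=
  (map_ne_zero_iff _ X.φ_injective).2 hz

theorem σ_φ (z : GaussianInt) : X.ΛL.s (X.φ z) = X.φ z := X.ΛL.fix _

theorem τ_φ (z : GaussianInt) : X.ΛM.s (X.φ z) = X.φ z := by rw [← φ_M, X.ΛM.fix]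

theorem κ_φ (z : GaussianInt) : X.κ (X.φ z) = X.φ (star z) := by
  rw [← φ_L, X.κ_L, X.EL.κ_j]; rfl

theorem σ_α : X.ΛL.s X.α = X.α := X.ΛL.fix _

theorem τ_α : X.ΛM.s X.α = -X.α := by rw [α, X.s_L_j, X.EL.s_θ, map_neg]

theorem σ_β : X.ΛL.s X.β = -X.β := by rw [β, X.s_M_j, X.EM.s_θ, map_neg]

theorem τ_β : X.ΛM.s X.β = X.β := X.ΛM.fix _

theorem sq_α : X.α ^ 2 = X.φ p := by rw [α, ← map_pow, X.EL.sq_θ, X.d_L]; rfl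

theorem sq_β : X.β ^ 2 = X.φ (-gI * q) := by rw [β, ← map_pow, X.EM.sq_θ, X.d_M, φ_M]

theorem exists_φ {x : O} (h : X.ΛL.s x = x) (h' : X.ΛM.s x = x) : ∃ z, X.φ z = x := by
  obtain ⟨y, rfl⟩ := X.ΛL.desc x h
  rw [X.s_L_j] at h'
  obtain ⟨z, rfl⟩ := X.EL.desc y (X.ΛL.inj h')
  exact ⟨z, rfl⟩

variable [IsDedekindDomain O]

theorem two_ne_sq [Fact p.Prime] [Fact q.Prime] (z : O) : z ^ 2 ≠ X.φ 2 := by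
  intro hz
  obtain ⟨P⟩ := exists_gaussPrime X.hp
  obtain ⟨Q⟩ := exists_gaussPrime X.hq
  have hnot : ∀ {l : ℕ} [Fact l.Prime] (P : GaussPrime l) {g w : GaussianInt}, g ^ 2 = P.v * w →
      P.red w ≠ 0 → False := by
    intro l _ P g w h hw
    obtain ⟨t, rfl⟩ := P.prime.dvd_of_dvd_pow (Dvd.intro _ h.symm)
    have : P.v * t ^ 2 = w := mul_left_cancel₀ P.prime.ne_zero (by linear_combination h)
    apply hw
    rw [← this, map_mul, P.red_v, zero_mul]
  have hσ : X.ΛL.s z ^ 2 = z ^ 2 := by rw [← map_pow, hz, σ_φ]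
  have hτ : X.ΛM.s z ^ 2 = z ^ 2 := by rw [← map_pow, hz, τ_φ]
  have h2p : (P.red 2 : ZMod p) ≠ 0 := by rw [map_ofNat]; exact two_ne_zero_zmod X.hp
  have h2q : (Q.red 2 : ZMod q) ≠ 0 := by rw [map_ofNat]; exact two_ne_zero_zmod X.hq
  have hIq : Q.red (-gI) ≠ 0 := by rw [map_neg]; exact neg_ne_zero.2 Q.red_gI_ne_zero
  rcases sq_eq_sq_iff_eq_or_eq_neg.1 hσ with h | h <;>
    rcases sq_eq_sq_iff_eq_or_eq_neg.1 hτ with h' | h'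
  · obtain ⟨g, rfl⟩ := X.exists_φ h h'
    have hg : g ^ 2 = 2 := X.φ_injective (by rw [map_pow, hz])
    have h1 := congrArg Zsqrtd.re hg
    have h2 := congrArg Zsqrtd.im hg
    simp only [pow_two, Zsqrtd.re_mul, Zsqrtd.im_mul, Zsqrtd.re_ofNat, Zsqrtd.im_ofNat] at h1 h2
    have h3 : g.re * g.im = 0 := by linarith
    rcases mul_eq_zero.1 h3 with h3 | h3
    · rw [h3] at h1
      have h4 : -(g.im * g.im) = 2 := by simpa using h1
      nlinarith [mul_self_nonneg g.im]
    · rw [h3] at h1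
      have h4 : g.re * g.re = 2 := by simpa using h1
      have h5 : |g.re| < 2 := by rw [← sq_lt_sq₀ (abs_nonneg _) (by norm_num), sq_abs]; nlinarith
      rw [abs_lt] at h5
      obtain ⟨h6, h7⟩ := h5
      have : g.re = -1 ∨ g.re = 0 ∨ g.re = 1 := by omega
      rcases this with h | h | h <;> rw [h] at h4 <;> norm_num at h4
  · obtain ⟨g, hg⟩ := X.exists_φ (x := z * X.α) (by rw [map_mul, h, σ_α])
      (by rw [map_mul, h', τ_α, neg_mul_neg])
    refine hnot P (g := g) (w := P.conj.v * 2) (X.φ_injective ?_)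
      (by rw [map_mul]; exact mul_ne_zero P.red_star_ne_zero h2p)
    rw [map_pow, hg, mul_pow, hz, sq_α, ← mul_assoc, P.mul_conj, map_mul, mul_comm]
  · obtain ⟨g, hg⟩ := X.exists_φ (x := z * X.β) (by rw [map_mul, h, σ_β, neg_mul_neg])
      (by rw [map_mul, h', τ_β])
    refine hnot Q (g := g) (w := Q.conj.v * (2 * -gI)) (X.φ_injective ?_) ?_
    · rw [map_pow, hg, mul_pow, hz, sq_β, ← mul_assoc, Q.mul_conj, ← map_mul]
      congr 1; ring
    · rw [map_mul, map_mul]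
      exact mul_ne_zero Q.red_star_ne_zero (mul_ne_zero h2q hIq)
  · obtain ⟨g, hg⟩ := X.exists_φ (x := z * X.α * X.β)
      (by rw [map_mul, map_mul, h, σ_α, σ_β]; ring) (by rw [map_mul, map_mul, h', τ_α, τ_β]; ring)
    refine hnot Q (g := g) (w := Q.conj.v * (2 * -gI * p)) (X.φ_injective ?_) ?_
    · rw [map_pow, hg, mul_pow, mul_pow, hz, sq_α, sq_β, ← mul_assoc, Q.mul_conj, ← map_mul,
        ← map_mul]
      congr 1; ring
    · rw [map_mul, map_mul, map_mul, map_natCast]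
      exact mul_ne_zero Q.red_star_ne_zero (mul_ne_zero (mul_ne_zero h2q hIq)
        (natCast_prime_ne_zero X.hne.symm))

end Octic

theorem Layer.exists_isUnit_of_sq {S R : Type*} [CommRing S] [CommRing R] [IsDedekindDomain S]
    [IsDedekindDomain R] (Λ : Layer S R) {γ : R} {a : S}
    (h : Ideal.span {γ} ^ 2 = Ideal.span {Λ.j a}) : ∃ u, IsUnit u ∧ γ * Λ.s γ = Λ.j (a * u) := by
  obtain ⟨n, hn⟩ := Λ.exists_norm γ
  have h1 : Ideal.span {Λ.j (n ^ 2)} = Ideal.span {Λ.j (a ^ 2)} := by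
    have h2 : (Ideal.span {γ} ^ 2).map Λ.s = Ideal.span {Λ.j a} := by
      rw [h, Λ.map_s_span, Λ.fix]
    rw [Ideal.map_pow, Λ.map_s_span] at h2
    rw [map_pow, map_pow, hn, ← Ideal.span_singleton_pow, ← Ideal.span_singleton_pow,
      ← Ideal.span_singleton_mul_span_singleton, mul_pow, h, h2, sq]
  have h3 : Ideal.span {n} ^ 2 = Ideal.span {a} ^ 2 := by
    rw [Ideal.span_singleton_pow, Ideal.span_singleton_pow,
      Ideal.span_singleton_eq_span_singleton]
    exact Λ.associated_of_span_eq h1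
  obtain ⟨u, hu⟩ := (Ideal.span_singleton_eq_span_singleton.1 (Ideal.eq_of_sq_eq h3)).symm
  exact ⟨u, u.isUnit, by rw [hu, hn]⟩

namespace Octic

variable {p q : ℕ} {RL RM Rk O : Type*} [CommRing RL] [CommRing RM] [CommRing Rk] [CommRing O]
  (X : Octic p q RL RM Rk O) [IsDedekindDomain RL] [IsDedekindDomain RM] [IsDedekindDomain Rk]
  [IsDedekindDomain O] [Fact p.Prime] [Fact q.Prime]

theorem exists_units_L : ∃ E, IsUnit E ∧ X.κ E = E ∧ ∀ u, IsUnit u →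
    ∃ (a b : ℕ) (v : O), IsUnit v ∧ X.ΛL.j u = X.φ gI ^ a * E ^ b * v ^ 2 := by
  obtain ⟨P⟩ := exists_gaussPrime X.hp
  obtain ⟨-, -, ε, h1, h2, -⟩ := X.EL.exists_isFund_prime X.hp X.d_L X.c_L P
  obtain ⟨t, h, hG⟩ := X.units_L
  refine ⟨X.ΛL.j ε, (X.EL.isUnit_of_norm h1).map X.ΛL.j, by rw [X.κ_L, h2], fun u hu => ?_⟩
  obtain ⟨a, b, v, hv, rfl⟩ := X.EL.exists_unit_eq P (w := P.conj.v) (by rw [X.d_L, P.mul_conj])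
    P.red_star_ne_zero hG h1 h2 hu
  exact ⟨a, b, _, hv.map X.ΛL.j, by simp only [map_mul, map_pow, φ_L]⟩

theorem exists_units_M : ∃ E, IsUnit E ∧ X.κ E = E ∧ ∀ u, IsUnit u →
    ∃ (a b : ℕ) (v : O), IsUnit v ∧ X.ΛM.j u = X.φ gI ^ a * E ^ b * v ^ 2 := by
  obtain ⟨Q⟩ := exists_gaussPrime X.hq
  obtain ⟨-, -, ε, h1, h2, -⟩ := X.EM.exists_isFund_two_mul X.hq X.d_M X.c_M Q
  obtain ⟨t, h, hG⟩ := X.units_M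
  refine ⟨X.ΛM.j ε, (X.EM.isUnit_of_norm h1).map X.ΛM.j, by rw [X.κ_M, h2], fun u hu => ?_⟩
  obtain ⟨a, b, v, hv, rfl⟩ := X.EM.exists_unit_eq Q (w := Q.conj.v * -gI)
    (by rw [X.d_M, ← mul_assoc, Q.mul_conj, mul_comm])
    (by rw [map_mul, map_neg]
        exact mul_ne_zero Q.red_star_ne_zero (neg_ne_zero.2 Q.red_gI_ne_zero)) hG h1 h2 hu
  exact ⟨a, b, _, hv.map X.ΛM.j, by simp only [map_mul, map_pow, φ_M]⟩

theorem exists_units_k : ∃ E, IsUnit E ∧ X.κ E = E ∧ ∀ u, IsUnit u →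
    ∃ (a b : ℕ) (v : O), IsUnit v ∧ X.Λk.j u = X.φ gI ^ a * E ^ b * v ^ 2 := by
  obtain ⟨P⟩ := exists_gaussPrime X.hp
  obtain ⟨Q⟩ := exists_gaussPrime X.hq
  obtain ⟨-, -, -, -, ε, h1, h2, -⟩ :=
    X.Ek.exists_isFund_two_mul_mul X.hp X.hq X.hne X.d_k X.c_k P Q
  obtain ⟨t, h, hG⟩ := X.units_k
  refine ⟨X.Λk.j ε, (X.Ek.isUnit_of_norm h1).map X.Λk.j, by rw [X.κ_k, h2], fun u hu => ?_⟩
  obtain ⟨a, b, v, hv, rfl⟩ := X.Ek.exists_unit_eq Q (w := Q.conj.v * (-gI * p))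
    (by rw [X.d_k, ← mul_assoc Q.v, Q.mul_conj]; ring)
    (by rw [map_mul, map_mul, map_neg, map_natCast]
        exact mul_ne_zero Q.red_star_ne_zero (mul_ne_zero (neg_ne_zero.2 Q.red_gI_ne_zero)
          (natCast_prime_ne_zero X.hne.symm))) hG h1 h2 hu
  exact ⟨a, b, _, hv.map X.Λk.j, by simp only [map_mul, map_pow, φ_k]⟩

/-- The prime above `2` has a square that is principal, but it is not itself principal. -/
theorem span_sq_ne (γ : O) : Ideal.span {γ} ^ 2 ≠ Ideal.span {X.φ (1 + gI)} := by
  intro hγ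
  obtain ⟨uL, hL, hγL⟩ := X.ΛL.exists_isUnit_of_sq (a := X.EL.j (1 + gI)) hγ
  obtain ⟨uM, hM, hγM⟩ := X.ΛM.exists_isUnit_of_sq (a := X.EM.j (1 + gI)) (by rw [φ_M, hγ])
  obtain ⟨uk, hk, hγk⟩ := X.Λk.exists_isUnit_of_sq (a := X.Ek.j (1 + gI)) (by rw [φ_k, hγ])
  rw [map_mul, φ_L] at hγL
  rw [map_mul, φ_M] at hγM
  rw [map_mul, φ_k, X.s_k] at hγk
  have hL' : IsUnit (X.EL.s uL) := hL.map X.EL.s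
  have h2 : γ ^ 2 * X.ΛL.j (X.EL.s uL) = X.φ (1 + gI) * (X.ΛM.j uM * X.Λk.j uk) := by
    apply mul_left_cancel₀ (X.φ_ne_zero one_add_gI_ne_zero)
    have := congrArg X.ΛM.s hγL
    rw [map_mul, map_mul, τ_φ, X.s_L_j, ← X.s_comm] at this
    linear_combination -γ ^ 2 * this + γ * X.ΛL.s (X.ΛM.s γ) * hγM + X.φ (1 + gI) * X.ΛM.j uM * hγk
  obtain ⟨E₁, e₁, f₁, g₁⟩ := X.exists_units_L
  obtain ⟨E₂, e₂, f₂, g₂⟩ := X.exists_units_M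
  obtain ⟨E₃, e₃, f₃, g₃⟩ := X.exists_units_k
  obtain ⟨a₁, b₁, v₁, w₁, h₁⟩ := g₁ _ hL'
  obtain ⟨a₂, b₂, v₂, w₂, h₂⟩ := g₂ _ hM
  obtain ⟨a₃, b₃, v₃, w₃, h₃⟩ := g₃ _ hk
  have hW : IsUnit (E₁ ^ b₁ * E₂ ^ b₂ * E₃ ^ b₃) := ((e₁.pow _).mul (e₂.pow _)).mul (e₃.pow _)
  have hκW : X.κ (E₁ ^ b₁ * E₂ ^ b₂ * E₃ ^ b₃) = E₁ ^ b₁ * E₂ ^ b₂ * E₃ ^ b₃ := by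
    simp only [map_mul, map_pow, f₁, f₂, f₃]
  obtain ⟨y, hy⟩ : ∃ y, y * (v₁ * v₂ * v₃) = γ * X.ΛL.j (X.EL.s uL) := by
    obtain ⟨v, hv⟩ := (w₁.mul w₂).mul w₃
    exact ⟨γ * X.ΛL.j (X.EL.s uL) * ↑v⁻¹, by rw [← hv]; simp [mul_assoc]⟩
  have hy2 : y ^ 2 = X.φ ((1 + gI) * gI ^ (a₁ + a₂ + a₃)) * (E₁ ^ b₁ * E₂ ^ b₂ * E₃ ^ b₃) := by
    apply mul_right_cancel₀ (pow_ne_zero 2 ((w₁.mul w₂).mul w₃).ne_zero)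
    rw [← mul_pow, hy, mul_pow, sq (X.ΛL.j _), ← mul_assoc, h2, h₁, h₂, h₃, map_mul, map_pow]
    ring
  have hκy := congrArg X.κ hy2
  rw [map_pow, map_mul, hκW, κ_φ] at hκy
  obtain ⟨w, hw⟩ := hW
  refine X.two_ne_sq (y * X.κ y * ↑w⁻¹) ?_
  have hg : (1 + gI) * gI ^ (a₁ + a₂ + a₃) * star ((1 + gI) * gI ^ (a₁ + a₂ + a₃)) = 2 := by
    rw [star_mul', star_pow, mul_mul_mul_comm, ← mul_pow]
    have e1 : gI * star gI = 1 := by decide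
    have e2 : (1 + gI) * star (1 + gI) = 2 := by decide
    rw [e1, e2, one_pow, mul_one]
  rw [mul_pow, mul_pow, hy2, hκy, ← hw, mul_mul_mul_comm, ← map_mul, hg, mul_assoc, ← sq, ← mul_pow,
    Units.mul_inv, one_pow, mul_one]

end Octic

namespace Octic

variable {p q : ℕ} {RL RM Rk O : Type*} [CommRing RL] [CommRing RM] [CommRing Rk] [CommRing O]
  (X : Octic p q RL RM Rk O) [IsDedekindDomain RL] [IsDedekindDomain RM] [IsDedekindDomain Rk]
  [IsDedekindDomain O] [Fact p.Prime] [Fact q.Prime]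

theorem sq_φ_gI : X.φ gI ^ 2 = -1 := by
  rw [← map_pow, sq, gI_mul_gI, map_neg, map_one]

/-- A unit which is the square root of a product of three fundamental units. -/
theorem exists_isUnit_norm_fund : ∃ (η : O) (ε : RL) (n : ℕ), IsUnit η ∧ ε * X.EL.s ε = -1 ∧
    X.EL.κ ε = ε ∧ η * X.ΛL.s η = X.φ gI ^ n * X.ΛL.j ε := by
  obtain ⟨P⟩ := exists_gaussPrime X.hp
  obtain ⟨Q⟩ := exists_gaussPrime X.hq
  obtain ⟨P₁, hP₁, ε₁, h₁, hκ, β₁, w₁, k₁, hw₁, e₁⟩ :=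
    X.EL.exists_isFund_prime X.hp X.d_L X.c_L P
  obtain ⟨Q₁, hQ₁, ε₂, h₂, -, β₂, w₂, k₂, hw₂, e₂⟩ :=
    X.EM.exists_isFund_two_mul X.hq X.d_M X.c_M Q
  obtain ⟨P₂, hP₂, Q₂, hQ₂, ε₃, h₃, -, β₃, w₃, k₃, hw₃, e₃⟩ :=
    X.Ek.exists_isFund_two_mul_mul X.hp X.hq X.hne X.d_k X.c_k P Q
  obtain ⟨x, hx⟩ : ∃ x, x ^ 2 = X.φ (P₁.v * P₂.v) := by
    rcases hP₁ with rfl | rfl <;> rcases hP₂ with rfl | rfl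
    · exact ⟨X.φ P₂.v, by rw [map_mul, sq]⟩
    · exact ⟨X.α, by rw [P₁.mul_conj, sq_α]⟩
    · exact ⟨X.α, by rw [mul_comm, P₂.mul_conj, sq_α]⟩
    · exact ⟨X.φ P.conj.v, by rw [map_mul, sq]⟩
  have hI : X.φ gI * X.β ^ 2 = X.φ q := by
    rw [sq_β, ← map_mul, ← mul_assoc, mul_neg, gI_mul_gI, neg_neg, one_mul]
  obtain ⟨y, m, hy⟩ : ∃ y, ∃ m : ℕ, X.φ gI ^ m * y ^ 2 = X.φ (Q₁.v * Q₂.v) := by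
    rcases hQ₁ with rfl | rfl <;> rcases hQ₂ with rfl | rfl
    · exact ⟨X.φ Q₂.v, 0, by rw [map_mul, pow_zero, one_mul, sq]⟩
    · exact ⟨X.β, 1, by rw [Q₁.mul_conj, pow_one, hI]⟩
    · exact ⟨X.β, 1, by rw [mul_comm Q₂.conj.v, Q₂.mul_conj, pow_one, hI]⟩
    · exact ⟨X.φ Q.conj.v, 0, by rw [map_mul, pow_zero, one_mul, sq]⟩
  set Z := X.φ ((1 + gI) * w₁ * w₂ * w₃) * x * y with hZ
  set B := X.ΛL.j β₁ * X.ΛM.j β₂ * X.Λk.j β₃ with hB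
  have e₁' := congrArg X.ΛL.j e₁
  have e₂' := congrArg X.ΛM.j e₂
  have e₃' := congrArg X.Λk.j e₃
  simp only [map_mul, map_pow] at e₁' e₂' e₃'
  simp only [← map_pow, ← map_mul, φ_L, φ_M, φ_k] at e₁' e₂' e₃'
  simp only [map_mul, map_pow] at e₁' e₂' e₃' hx hy
  have hBZ : B ^ 2 = Z ^ 2 *
      (X.φ gI ^ (k₁ + k₂ + k₃ + m) * X.ΛL.j ε₁ * X.ΛM.j ε₂ * X.Λk.j ε₃) := by
    simp only [hB, hZ, mul_pow, e₁', e₂', e₃', hx, map_mul, pow_add]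
    linear_combination (-X.φ gI ^ k₁ * X.φ gI ^ k₂ * X.φ gI ^ k₃ * X.φ (1 + gI) ^ 2 * X.φ w₁ ^ 2 *
      X.φ w₂ ^ 2 * X.φ w₃ ^ 2 * X.φ P₁.v * X.φ P₂.v * X.ΛL.j ε₁ * X.ΛM.j ε₂ * X.Λk.j ε₃) * hy
  have hZ0 : Z ≠ 0 := by
    refine mul_ne_zero (mul_ne_zero (X.φ_ne_zero ?_) ?_) ?_
    · exact mul_ne_zero (mul_ne_zero (mul_ne_zero one_add_gI_ne_zero hw₁) hw₂) hw₃
    · rintro rfl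
      rw [zero_pow two_ne_zero] at hx
      exact mul_ne_zero (X.φ_ne_zero P₁.v_ne_zero) (X.φ_ne_zero P₂.v_ne_zero) hx.symm
    · rintro rfl
      rw [zero_pow two_ne_zero, mul_zero] at hy
      exact mul_ne_zero (X.φ_ne_zero Q₁.v_ne_zero) (X.φ_ne_zero Q₂.v_ne_zero) hy.symm
  obtain ⟨η, hη⟩ := (IsIntegrallyClosed.pow_dvd_pow_iff two_ne_zero).1 (Dvd.intro _ hBZ.symm)
  rw [hη, mul_pow] at hBZ
  have hη2 := mul_left_cancel₀ (pow_ne_zero 2 hZ0) hBZ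
  have hu : IsUnit η := by
    rw [← isUnit_pow_iff two_ne_zero, hη2]
    exact ((((gI_isUnit.map X.φ).pow _).mul ((X.EL.isUnit_of_norm h₁).map X.ΛL.j)).mul
      ((X.EM.isUnit_of_norm h₂).map X.ΛM.j)).mul ((X.Ek.isUnit_of_norm h₃).map X.Λk.j)
  have hσ := congrArg X.ΛL.s hη2
  simp only [map_mul, map_pow, σ_φ, X.ΛL.fix, X.s_M_j, X.s_k_j] at hσ
  have h₂' := congrArg X.ΛM.j h₂
  have h₃' := congrArg X.Λk.j h₃
  simp only [map_mul, map_neg, map_one] at h₂' h₃'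
  have hsq : (η * X.ΛL.s η) ^ 2 = (X.φ gI ^ (k₁ + k₂ + k₃ + m) * X.ΛL.j ε₁) ^ 2 := by
    rw [mul_pow, hη2, hσ]
    linear_combination (X.φ gI ^ (k₁ + k₂ + k₃ + m) * X.ΛL.j ε₁) ^ 2 *
      (X.ΛM.j ε₂ * X.ΛM.j (X.EM.s ε₂) * h₃' - h₂')
  rcases sq_eq_sq_iff_eq_or_eq_neg.1 hsq with h | h
  · exact ⟨η, ε₁, _, hu, h₁, hκ, h⟩
  · exact ⟨η, ε₁, k₁ + k₂ + k₃ + m + 2, hu, h₁, hκ, by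
      rw [h, pow_add _ (k₁ + k₂ + k₃ + m) 2, X.sq_φ_gI]; ring⟩

theorem exists_type [Module.Free ℤ RL] [Module.Finite ℤ RL] {I : Ideal O} (hI : I ≠ ⊥)
    (h : idealClass I ^ 2 = 1) : ∃ (l γ : O) (t : ℕ), t < 2 ∧ l ≠ 0 ∧ X.ΛL.s l = l ∧
      I * I.map X.ΛL.s = Ideal.span {l} ∧ I ^ 2 = Ideal.span {γ} ∧
      γ * X.ΛL.s γ = X.φ gI ^ t * l ^ 2 := by
  obtain ⟨P⟩ := exists_gaussPrime X.hp
  obtain ⟨t, f, hG⟩ := X.units_L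
  obtain ⟨η, ε, n, hη, h1, h2, hηε⟩ := X.exists_isUnit_norm_fund
  obtain ⟨B, hB0, hB, hB2⟩ := X.ΛL.exists_norm_ideal hI h
  have hB1 := X.EL.idealClass_eq_one (n := 1) X.rank_L X.hp X.d_L X.c_L (by rwa [pow_one])
  obtain ⟨x, hx0, rfl⟩ := (idealClass_eq_one_iff hB0).1 hB1
  rw [← idealClass_pow hI, idealClass_eq_one_iff (pow_ne_zero 2 hI)] at h
  obtain ⟨γ, hγ0, hγ⟩ := h
  rw [Ideal.map_span, Set.image_singleton] at hB
  obtain ⟨N, hN⟩ := X.ΛL.exists_norm γ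
  obtain ⟨u, hu⟩ : Associated (x ^ 2) N := X.ΛL.associated_of_span_eq (by
    rw [hN, ← Ideal.span_singleton_mul_span_singleton, ← X.ΛL.map_s_span, ← hγ, Ideal.map_pow,
      ← mul_pow, ← hB, map_pow, Ideal.span_singleton_pow])
  obtain ⟨a, b, v, hv, huv⟩ := X.EL.exists_unit_eq P (w := P.conj.v) (by rw [X.d_L, P.mul_conj])
    P.red_star_ne_zero hG h1 h2 u.isUnit
  have hε := X.EL.isUnit_of_norm h1
  rw [← hu, huv] at hN
  simp only [map_mul, map_pow, φ_L] at hN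
  have key : ∀ (γ : O) (m : ℕ) (w : RL), IsUnit w → I ^ 2 = Ideal.span {γ} →
      γ * X.ΛL.s γ = X.φ gI ^ m * X.ΛL.j w ^ 2 * X.ΛL.j x ^ 2 →
      ∃ (l γ : O) (t : ℕ), t < 2 ∧ l ≠ 0 ∧ X.ΛL.s l = l ∧
        I * I.map X.ΛL.s = Ideal.span {l} ∧ I ^ 2 = Ideal.span {γ} ∧
        γ * X.ΛL.s γ = X.φ gI ^ t * l ^ 2 := by
    intro γ m w hw hγ h
    have hU : IsUnit (X.ΛL.j w * X.φ gI ^ (m / 2)) :=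
      (hw.map X.ΛL.j).mul ((gI_isUnit.map X.φ).pow _)
    refine ⟨X.ΛL.j w * X.φ gI ^ (m / 2) * X.ΛL.j x, γ, m % 2, Nat.mod_lt _ two_pos,
      mul_ne_zero hU.ne_zero (X.ΛL.j_ne_zero hx0), ?_, ?_, hγ, ?_⟩
    · simp only [map_mul, map_pow, X.ΛL.fix, σ_φ]
    · rw [← hB, Ideal.span_singleton_mul_left_unit hU]
    · rw [h]
      conv_lhs => rw [← Nat.div_add_mod m 2, pow_add, pow_mul']
      ring
  rcases Nat.even_or_odd' b with ⟨b, rfl | rfl⟩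
  · exact key γ a (ε ^ b * v) ((hε.pow _).mul hv) hγ (by rw [← hN, map_mul, map_pow]; ring)
  · refine key (γ * η) (a + n) (ε ^ (b + 1) * v) ((hε.pow _).mul hv) ?_ ?_
    · rw [hγ, Ideal.span_singleton_mul_right_unit hη]
    · rw [map_mul, mul_mul_mul_comm, ← hN, hηε, map_mul, map_pow]; ring

end Octic

namespace Layer

variable {S R : Type*} [CommRing S] [CommRing R] [IsDomain R] (Λ : Layer S R)

theorem isUnit_of_j {a : S} (h : IsUnit (Λ.j a)) : IsUnit a := by
  obtain ⟨y, hy⟩ := isUnit_iff_exists_inv.1 h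
  have h1 := congrArg Λ.s hy
  rw [map_mul, Λ.fix, map_one, ← hy] at h1
  obtain ⟨z, rfl⟩ := Λ.desc y (mul_left_cancel₀ h.ne_zero h1)
  exact IsUnit.of_mul_eq_one z (Λ.inj (by rw [map_mul, hy, map_one]))

end Layer

namespace Octic

variable {p q : ℕ} {RL RM Rk O : Type*} [CommRing RL] [CommRing RM] [CommRing Rk] [CommRing O]
  (X : Octic p q RL RM Rk O)

theorem map_s_k (I : Ideal O) : (I.map X.ΛL.s).map X.ΛM.s = I.map X.Λk.s := by
  ext x
  simp only [Ideal.mem_map_of_equiv, X.s_k]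
  constructor
  · rintro ⟨_, ⟨y, hy, rfl⟩, rfl⟩
    exact ⟨y, hy, X.s_comm y⟩
  · rintro ⟨y, hy, rfl⟩
    exact ⟨_, ⟨y, hy, rfl⟩, (X.s_comm y).symm⟩

theorem map_s_k' (I : Ideal O) : (I.map X.ΛM.s).map X.ΛL.s = I.map X.Λk.s := by
  ext x
  simp only [Ideal.mem_map_of_equiv, X.s_k]
  constructor
  · rintro ⟨_, ⟨y, hy, rfl⟩, rfl⟩
    exact ⟨y, hy, rfl⟩
  · rintro ⟨y, hy, rfl⟩
    exact ⟨_, ⟨y, hy, rfl⟩, rfl⟩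

/-- The product of the conjugates of an ideal. -/
def galoisNorm (I : Ideal O) : Ideal O := I * I.map X.ΛL.s * (I.map X.ΛM.s * I.map X.Λk.s)

theorem galoisNorm_mul (I J : Ideal O) :
    X.galoisNorm (I * J) = X.galoisNorm I * X.galoisNorm J := by
  simp only [galoisNorm, Ideal.map_mul]
  ring

theorem galoisNorm_pow (I : Ideal O) (n : ℕ) : X.galoisNorm (I ^ n) = X.galoisNorm I ^ n := by
  simp only [galoisNorm, Ideal.map_pow]
  ring

theorem map_s_M_map_j (B : Ideal RM) : (B.map X.ΛM.j).map X.ΛL.s = (B.map X.EM.s).map X.ΛM.j := by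
  have : (B.map X.ΛM.j).map (X.ΛL.s : O →+* O) = (B.map (X.EM.s : RM →+* RM)).map X.ΛM.j := by
    rw [Ideal.map_map, Ideal.map_map]
    congr 1
    ext x
    exact X.s_M_j x
  exact this

theorem map_s_k_map_j (B : Ideal Rk) : (B.map X.Λk.j).map X.ΛL.s = (B.map X.Ek.s).map X.Λk.j := by
  have : (B.map X.Λk.j).map (X.ΛL.s : O →+* O) = (B.map (X.Ek.s : Rk →+* Rk)).map X.Λk.j := by
    rw [Ideal.map_map, Ideal.map_map]
    congr 1
    ext x
    exact X.s_k_j x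
  exact this

variable [IsDedekindDomain RL] [IsDedekindDomain RM] [IsDedekindDomain Rk] [IsDedekindDomain O]

theorem exists_galoisNorm (I : Ideal O) : ∃ g, X.galoisNorm I = Ideal.span {X.φ g} := by
  obtain ⟨B, hB⟩ := X.ΛM.exists_map_eq I
  obtain ⟨g, hg⟩ := X.EM.exists_norm_span B
  refine ⟨g, ?_⟩
  rw [← φ_M, ← Set.image_singleton, ← Ideal.map_span, ← hg, Ideal.map_mul, ← map_s_M_map_j, hB,
    Ideal.map_mul, map_s_k', galoisNorm]
  ring

theorem mul_map_s_M {I : Ideal O} {g : GaussianInt} (hg0 : g ≠ 0)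
    (hg : X.galoisNorm I = Ideal.span {X.φ g}) {B : Ideal RM}
    (hB : B.map X.ΛM.j = I * I.map X.ΛM.s) : B * B.map X.EM.s = Ideal.span {X.EM.j g} := by
  refine X.ΛM.isPrincipal_of_map (X.EM.j_ne_zero hg0) ?_
  rw [φ_M, ← hg, Ideal.map_mul, ← map_s_M_map_j, hB, Ideal.map_mul, map_s_k', galoisNorm]
  ring

theorem mul_map_s_k {I : Ideal O} {g : GaussianInt} (hg0 : g ≠ 0)
    (hg : X.galoisNorm I = Ideal.span {X.φ g}) {B : Ideal Rk}
    (hB : B.map X.Λk.j = I * I.map X.Λk.s) : B * B.map X.Ek.s = Ideal.span {X.Ek.j g} := by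
  refine X.Λk.isPrincipal_of_map (X.Ek.j_ne_zero hg0) ?_
  have h : (I.map X.Λk.s).map X.ΛL.s = I.map X.ΛM.s := by
    rw [← map_s_k', X.ΛL.map_map_s]
  rw [φ_k, ← hg, Ideal.map_mul, ← map_s_k_map_j, hB, Ideal.map_mul, h, galoisNorm]
  ring

variable [Fact p.Prime] [Fact q.Prime]

theorem norm_galoisNorm_ne_zero {I : Ideal O} (h : I ⊔ Ideal.span {X.φ q} = ⊤) {g : GaussianInt}
    (hg : X.galoisNorm I = Ideal.span {X.φ g}) : ((g.norm : ℤ) : ZMod q) ≠ 0 := by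
  obtain ⟨Q⟩ := exists_gaussPrime X.hq
  have main : ∀ Q : GaussPrime q, Q.red g ≠ 0 := by
    intro Q hQ
    have hle : Ideal.span {X.φ q} ≤ Ideal.span {X.φ Q.v} := by
      rw [Ideal.span_singleton_le_span_singleton, ← Q.mul_conj, map_mul]
      exact Dvd.intro _ rfl
    have h1 : IsCoprime I (Ideal.span {X.φ Q.v}) := by
      rw [Ideal.isCoprime_iff_sup_eq, eq_top_iff, ← h]
      exact sup_le_sup_left hle _
    have hs : ∀ s : O ≃+* O, s (X.φ Q.v) = X.φ Q.v →
        IsCoprime (I.map s) (Ideal.span {X.φ Q.v}) := by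
      intro s hs
      rw [Ideal.isCoprime_iff_sup_eq] at h1 ⊢
      have := congrArg (Ideal.map s) h1
      rwa [Ideal.map_sup, Ideal.map_top, Ideal.map_span, Set.image_singleton, hs] at this
    have hk : X.Λk.s (X.φ Q.v) = X.φ Q.v := by rw [X.s_k, τ_φ, σ_φ]
    have h2 : IsCoprime (X.galoisNorm I) (Ideal.span {X.φ Q.v}) :=
      (h1.mul_left (hs _ (X.σ_φ _))).mul_left ((hs _ (X.τ_φ _)).mul_left (hs _ hk))
    obtain ⟨t, rfl⟩ := (Q.red_eq_zero _).1 hQ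
    rw [Ideal.isCoprime_iff_sup_eq, hg, map_mul, sup_eq_right.2, Ideal.span_singleton_eq_top] at h2
    · exact Q.prime.not_isUnit (X.EL.isUnit_of_j (X.ΛL.isUnit_of_j h2))
    · rw [Ideal.span_singleton_le_span_singleton]
      exact Dvd.intro _ rfl
  rw [Q.red_norm]
  exact mul_ne_zero (main Q) (main Q.conj)

/-- The prime ideal above `2`. -/
def two : Ideal O := Ideal.span {X.φ (1 + gI), 1 + X.β}

theorem two_sq : X.two ^ 2 = Ideal.span {X.φ (1 + gI)} := by
  have := congrArg (Ideal.map X.ΛM.j) (X.EM.sq_ramified_two (n := q) (by rw [X.d_M]; simp)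
    (by have := X.hq; omega))
  rw [Ideal.map_pow, Ideal.map_span, Ideal.map_span, Set.image_pair, Set.image_singleton, φ_M,
    map_add X.ΛM.j, map_one] at this
  exact this

theorem two_ne_bot : X.two ≠ ⊥ := by
  intro h
  have := X.two_sq
  rw [h, ← Ideal.zero_eq_bot, zero_pow two_ne_zero, Ideal.zero_eq_bot, eq_comm,
    Ideal.span_singleton_eq_bot] at this
  exact X.φ_ne_zero one_add_gI_ne_zero this

theorem sqRep_two : SqRep X.two (X.φ (1 + gI)) := SqRep.of_sq X.two_sq

theorem idealClass_two_ne_one : idealClass X.two ≠ 1 := by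
  rw [Ne, idealClass_eq_one_iff X.two_ne_bot]
  rintro ⟨γ, -, h⟩
  exact X.span_sq_ne γ (by rw [← h, X.two_sq])

theorem idealClass_two_sq : idealClass X.two ^ 2 = 1 := by
  rw [← idealClass_pow X.two_ne_bot, X.two_sq, idealClass_span (X.φ_ne_zero one_add_gI_ne_zero)]

theorem idealClass_of_sqRep {I : Ideal O} (hI : I ≠ ⊥) {c : ℕ}
    (h : SqRep I (X.φ ((1 + gI) ^ c))) : idealClass I = idealClass X.two ^ c := by
  rw [← idealClass_pow X.two_ne_bot]
  refine h.class_eq hI (pow_ne_zero c X.two_ne_bot) ?_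
  rw [map_pow]
  exact X.sqRep_two.pow c

variable [Module.Free ℤ RL] [Module.Finite ℤ RL] [Module.Free ℤ RM] [Module.Finite ℤ RM]
  [Module.Free ℤ Rk] [Module.Finite ℤ Rk]

theorem exists_span_L {I : Ideal O} (hI : I ≠ ⊥) {n : ℕ} (h : idealClass I ^ 2 ^ n = 1) :
    ∃ x : RL, x ≠ 0 ∧ I * I.map X.ΛL.s = Ideal.span {X.ΛL.j x} := by
  obtain ⟨B, hB0, hB, hBn⟩ := X.ΛL.exists_norm_ideal hI h
  obtain ⟨x, hx, rfl⟩ := (idealClass_eq_one_iff hB0).1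
    (X.EL.idealClass_eq_one X.rank_L X.hp X.d_L X.c_L hBn)
  exact ⟨x, hx, by rw [← hB, Ideal.map_span, Set.image_singleton]⟩

theorem exists_sqRep_M {I : Ideal O} (hI : I ≠ ⊥) {n : ℕ} (h : idealClass I ^ 2 ^ n = 1)
    {g : GaussianInt} (hg : X.galoisNorm I = Ideal.span {X.φ g})
    (hgq : ((g.norm : ℤ) : ZMod q) ≠ 0) : ∃ c, SqRep (I * I.map X.ΛM.s) (X.φ ((1 + gI) ^ c)) ∧
      quadraticChar (ZMod q) g.norm = (-1) ^ c := by
  obtain ⟨B, hB0, hB, hBn⟩ := X.ΛM.exists_norm_ideal hI h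
  have h2 := X.EM.sq_idealClass_eq_one X.rank_M X.hq X.d_M X.c_M hBn
  obtain ⟨c, hc⟩ := X.EM.exists_sqRep_pow X.rank_M X.hq X.d_M X.c_M hB0 h2
  have hg0 : g ≠ 0 := by rintro rfl; simp at hgq
  refine ⟨c, ?_, X.EM.quadraticChar_of_sqRep X.hq X.d_M hc (X.mul_map_s_M hg0 hg hB) hgq⟩
  rw [← hB, ← φ_M]
  exact hc.map X.ΛM.inj

theorem sqRep_top_gaussPrime (P : GaussPrime p) : SqRep ⊤ (X.φ P.v) := by
  have := (X.EL.sqRep_top X.hp X.d_L X.c_L P).map X.ΛL.inj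
  rwa [Ideal.map_top] at this

theorem exists_sqRep_k {I : Ideal O} (hI : I ≠ ⊥) {n : ℕ} (h : idealClass I ^ 2 ^ n = 1)
    {g : GaussianInt} (hg : X.galoisNorm I = Ideal.span {X.φ g})
    (hgq : ((g.norm : ℤ) : ZMod q) ≠ 0) :
    ∃ a c, SqRep (I * I.map X.Λk.s) (X.φ ((1 + gI) ^ c)) ∧
      quadraticChar (ZMod q) g.norm = quadraticChar (ZMod q) p ^ a * (-1) ^ c := by
  obtain ⟨P⟩ := exists_gaussPrime X.hp
  obtain ⟨B, hB0, hB, hBn⟩ := X.Λk.exists_norm_ideal hI h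
  have h2 := X.Ek.sq_idealClass_eq_one' X.rank_k X.hp X.hq X.hne X.d_k X.c_k hBn
  obtain ⟨a, b, c, hc⟩ :=
    X.Ek.exists_sqRep_pow_mul X.rank_k X.hp X.hq X.hne P X.d_k X.c_k hB0 h2
  have hg0 : g ≠ 0 := by rintro rfl; simp at hgq
  refine ⟨a + b, c, ?_,
    X.Ek.quadraticChar_of_sqRep' X.hq X.hne P X.d_k hc (X.mul_map_s_k hg0 hg hB) hgq⟩
  rw [← hB]
  have h3 := hc.map X.Λk.inj
  rw [φ_k, map_mul] at h3
  refine h3.cancel ?_ ?_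
  · exact X.φ_ne_zero (mul_ne_zero (pow_ne_zero _ P.v_ne_zero) (pow_ne_zero _ P.conj.v_ne_zero))
  · have := ((X.sqRep_top_gaussPrime P).pow a).mul ((X.sqRep_top_gaussPrime P.conj).pow b)
    rwa [← Ideal.one_eq_top, one_pow, one_pow, one_mul, ← map_pow, ← map_pow, ← map_mul,
      Ideal.one_eq_top] at this

/-- The square of a class of `2`-power order. -/
theorem exists_idealClass_sq {I : Ideal O} (hI : I ≠ ⊥) {n : ℕ} (h : idealClass I ^ 2 ^ n = 1) :
    ∃ a c : ℕ, idealClass I ^ 2 = idealClass X.two ^ c ∧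
      quadraticChar (ZMod q) p ^ a = (-1) ^ c := by
  have hq0 : Ideal.span {X.φ q} ≠ ⊥ := by
    rw [Ne, Ideal.span_singleton_eq_bot]
    exact X.φ_ne_zero (Nat.cast_ne_zero.2 (Fact.out : q.Prime).ne_zero)
  have hcop : ∀ {I : Ideal O}, I ≠ ⊥ → idealClass I ^ 2 ^ n = 1 → I ⊔ Ideal.span {X.φ q} = ⊤ →
      ∃ a c : ℕ, idealClass I ^ 2 = idealClass X.two ^ c ∧
        quadraticChar (ZMod q) p ^ a = (-1) ^ c := by
    intro I hI h hIq
    obtain ⟨g, hg⟩ := X.exists_galoisNorm I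
    have hgq := X.norm_galoisNorm_ne_zero hIq hg
    obtain ⟨x, hx, hL⟩ := X.exists_span_L hI h
    obtain ⟨c, hc, hcq⟩ := X.exists_sqRep_M hI h hg hgq
    obtain ⟨a, d, hd, hdq⟩ := X.exists_sqRep_k hI h hg hgq
    refine ⟨a, c + d, ?_, ?_⟩
    · have hy : X.ΛM.s (X.ΛL.j x) ≠ 0 := X.ΛM.s_ne_zero (X.ΛL.j_ne_zero hx)
      have h1 : Ideal.span {X.ΛM.s (X.ΛL.j x)} * I ^ 2 =
          (I * I.map X.ΛM.s) * (I * I.map X.Λk.s) := by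
        rw [← X.ΛM.map_s_span, ← hL, Ideal.map_mul, map_s_k]
        ring
      have h2 := hc.mul hd
      rw [← h1, ← map_mul, ← pow_add] at h2
      rw [← idealClass_pow hI]
      exact X.idealClass_of_sqRep (pow_ne_zero 2 hI) (h2.of_span_mul hy)
    · rw [hcq] at hdq
      have : ((-1 : ℤ) ^ d) * (-1) ^ d = 1 := by rw [← mul_pow]; simp
      rw [pow_add, hdq, mul_assoc, this, mul_one]
  obtain ⟨C, a, ha, hC, hCq⟩ := exists_mul_principal_coprime hI hq0
  have hC0 : C ≠ ⊥ := by
    rintro rfl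
    rw [Ideal.mul_bot, eq_comm, Ideal.span_singleton_eq_bot] at hC
    exact ha hC
  have hcl : idealClass I * idealClass C = 1 := by rw [← idealClass_mul hI hC0, hC, idealClass_span ha]
  have hinv : idealClass C = (idealClass I)⁻¹ := eq_inv_of_mul_eq_one_right hcl
  obtain ⟨a, c, h1, h2⟩ := hcop hC0 (by rw [hinv, inv_pow, h, inv_one]) hCq
  refine ⟨a, c, ?_, h2⟩
  rw [hinv, inv_pow, inv_eq_iff_eq_inv] at h1
  rw [h1, ← inv_pow, inv_eq_of_mul_eq_one_right (a := idealClass X.two)]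
  rw [← sq, X.idealClass_two_sq]

end Octic

/-- An ideal which, together with its conjugate, factors a ramified ideal. -/
theorem exists_mul_map_eq_span_pair {R : Type*} [CommRing R] [IsDedekindDomain R] {s s' : R ≃+* R}
    {v z a b A B : R} {t : ℤ} (hsv : s v = v) (hsA : s A = -A) (hsB : s B = B) (hv' : s' v = v)
    (hA' : s' A = A) (hB' : s' B = -B) (hA : A ^ 2 - (t : R) ^ 2 = v * z)
    (h : a * v + b * (2 * t) = 1) (hB : Ideal.span {v, B} ^ 2 = Ideal.span {v}) :
    ∃ I : Ideal R, I.map s' = I ∧ I * I.map s = Ideal.span {v, B} := by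
  refine ⟨Ideal.span {v, A - t} ⊔ Ideal.span {v, B}, ?_, ?_⟩
  · rw [Ideal.map_sup, Ideal.map_span, Ideal.map_span, Set.image_pair, Set.image_pair, map_sub,
      map_intCast, hv', hA', hB', Ideal.span_pair_neg]
  · have : (Ideal.span {v, A - t} ⊔ Ideal.span {v, B}).map s =
        Ideal.span {v, A + t} ⊔ Ideal.span {v, B} := by
      rw [Ideal.map_sup, Ideal.map_span, Ideal.map_span, Set.image_pair, Set.image_pair, map_sub,
        map_intCast, hsv, hsA, hsB, ← neg_add', Ideal.span_pair_neg]
    rw [this]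
    refine Ideal.sup_mul_sup_of_mul ?_ (Ideal.span_pair_sup_conj h)
    rw [hB, Ideal.span_pair_mul_conj hA h]

namespace Octic

variable {p q : ℕ} {RL RM Rk O : Type*} [CommRing RL] [CommRing RM] [CommRing Rk] [CommRing O]
  (X : Octic p q RL RM Rk O) [Fact p.Prime] [Fact q.Prime]

/-- A prime ideal above `q`, or the product of two such primes. -/
def ramQ (Q : GaussPrime q) : Ideal O := Ideal.span {X.φ Q.v, X.β}

/-- An ideal above `p`. -/
def ramP (P : GaussPrime p) : Ideal O := Ideal.span {X.φ P.v, X.α}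

variable [IsDedekindDomain RL] [IsDedekindDomain RM] [IsDedekindDomain Rk] [IsDedekindDomain O]

theorem ramQ_sq (Q : GaussPrime q) : X.ramQ Q ^ 2 = Ideal.span {X.φ Q.v} := by
  have := congrArg (Ideal.map X.ΛM.j) (X.EM.sq_ramified (w := Q.conj.v * -gI)
    (by rw [X.d_M, ← mul_assoc, Q.mul_conj, mul_comm]) (Q.isCoprime_of_red_ne_zero (by
      rw [map_mul, map_neg]
      exact mul_ne_zero Q.red_star_ne_zero (neg_ne_zero.2 Q.red_gI_ne_zero))))
  rwa [Ideal.map_pow, Ideal.map_span, Ideal.map_span, Set.image_pair, Set.image_singleton,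
    φ_M] at this

theorem ramP_sq (P : GaussPrime p) : X.ramP P ^ 2 = Ideal.span {X.φ P.v} := by
  have := congrArg (Ideal.map X.ΛL.j) (X.EL.sq_ramified (w := P.conj.v)
    (by rw [X.d_L, P.mul_conj]) (P.isCoprime_of_red_ne_zero P.red_star_ne_zero))
  rwa [Ideal.map_pow, Ideal.map_span, Ideal.map_span, Set.image_pair, Set.image_singleton,
    φ_L] at this

theorem ne_bot_of_pow_eq {I : Ideal O} {z : GaussianInt} (hz : z ≠ 0) {n : ℕ} (hn : n ≠ 0)
    (h : I ^ n = Ideal.span {X.φ z}) : I ≠ ⊥ := by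
  rintro rfl
  rw [← Ideal.zero_eq_bot, zero_pow hn, Ideal.zero_eq_bot, eq_comm,
    Ideal.span_singleton_eq_bot] at h
  exact X.φ_ne_zero hz h

theorem idealClass_ramQ (Q : GaussPrime q) : idealClass (X.ramQ Q) = idealClass X.two := by
  have h0 := X.ne_bot_of_pow_eq Q.v_ne_zero two_ne_zero (X.ramQ_sq Q)
  have h1 := (X.EM.sqRep_top_two X.hq X.d_M X.c_M Q).map X.ΛM.inj
  rw [Ideal.map_top, φ_M] at h1
  have h2 := (SqRep.of_sq (X.ramQ_sq Q)).mul_top h1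
  refine SqRep.class_eq h0 X.two_ne_bot (SqRep.of_mul_sq (X.φ_ne_zero Q.v_ne_zero) ?_) X.sqRep_two
  refine h2.congr ?_
  rw [map_mul]; ring

theorem mem_or_mem_of_invariant {P : Ideal O} (hP : P.IsPrime) (hP0 : P ≠ ⊥)
    (hPs : P.map X.ΛL.s = P) : (∃ B : Ideal RL, B ≠ ⊥ ∧ P = B.map X.ΛL.j) ∨
      X.φ (1 + gI) ∈ P ∨ X.φ q ∈ P := by
  by_cases h : X.ΛL.j (2 * X.EL.j (-gI * q)) ∈ P
  · right
    have hc : (P.comap X.ΛL.j).IsPrime := hP.comap _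
    have h1 : X.EL.j (2 * (-gI * q)) ∈ P.comap X.ΛL.j := by
      rwa [map_mul, map_ofNat, Ideal.mem_comap]
    refine (X.EL.mem_two hc h1).imp id fun h2 => ?_
    rw [map_mul] at h2
    refine (hc.mem_or_mem h2).resolve_left fun h3 => hc.ne_top ?_
    exact Ideal.eq_top_of_isUnit_mem _ h3 (gI_isUnit.neg.map X.EL.j)
  · left
    have h1 := X.ΛL.eq_map_comap X.σ_β (by rw [X.sq_β, φ_L]) hP hP0 hPs h
    refine ⟨_, ?_, h1⟩
    intro h2
    rw [h2, Ideal.map_bot] at h1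
    exact hP0 h1

theorem exists_mem_of_mem {P : Ideal O} (hP : P.IsPrime) (h : X.φ q ∈ P) (Q : GaussPrime q) :
    ∃ Q', (Q' = Q ∨ Q' = Q.conj) ∧ X.φ Q'.v ∈ P :=
  X.EL.mem_prime (hP.comap X.ΛL.j) Q h

variable [Module.Free ℤ O] [Module.Finite ℤ O]

theorem absNorm_ramQ (Q : GaussPrime q) : Ideal.absNorm (X.ramQ Q) = q ^ 2 := by
  have h : Ideal.absNorm (Ideal.span {X.φ Q.v}) = q ^ 4 := by
    refine absNorm_span_sq (y := X.φ Q.conj.v) (k := 4) (by rw [X.rank_O]) X.κ ?_ ?_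
    · rw [κ_φ, Q.conj_v]
    · rw [← map_mul, Q.mul_conj, map_natCast]
  rw [← ramQ_sq, map_pow, show q ^ 4 = (q ^ 2) ^ 2 by ring] at h
  exact Nat.pow_left_injective two_ne_zero h

theorem absNorm_two : Ideal.absNorm X.two = 2 ^ 2 := by
  have h : Ideal.absNorm (Ideal.span {X.φ (1 + gI)}) = 2 ^ 4 := by
    refine absNorm_span_sq (y := X.φ (star (1 + gI))) (k := 4) (by rw [X.rank_O]) X.κ ?_ ?_
    · rw [κ_φ]
    · rw [← map_mul, show (1 + gI) * star (1 + gI) = ((2 : ℕ) : GaussianInt) by decide,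
        map_natCast]
  rw [← two_sq, map_pow, show 2 ^ 4 = (2 ^ 2) ^ 2 by ring] at h
  exact Nat.pow_left_injective two_ne_zero h

theorem eq_two {P : Ideal O} (hP : P.IsPrime) (h : X.φ (1 + gI) ∈ P) : P = X.two := by
  refine eq_of_absNorm_sq Nat.prime_two X.absNorm_two hP ?_ ?_
  · refine hP.le_of_pow_le (n := 2) ?_
    rwa [two_sq, Ideal.span_singleton_le_iff_mem]
  · have hp := X.hp
    obtain ⟨m, hm⟩ : ∃ m : ℤ, (p : ℤ) = 1 + 4 * m := ⟨(p - 1) / 4, by omega⟩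
    have h2 : (2 : O) ≠ 0 := by
      have := X.φ_ne_zero (two_ne_zero : (2 : GaussianInt) ≠ 0)
      rwa [map_ofNat] at this
    obtain ⟨ω, -, hω⟩ := exists_half (θ := X.α) (m := m) h2 (by
      rw [sq_α, map_natCast, ← Int.cast_natCast, hm]; push_cast; ring)
    exact absNorm_ne_of_half (by omega) hω P

theorem eq_ramQ (hr : ¬IsSquare (p : ZMod q)) {P : Ideal O} (hP : P.IsPrime) {Q : GaussPrime q}
    (h : X.φ Q.v ∈ P) : P = X.ramQ Q := by
  refine eq_of_absNorm_sq Fact.out (X.absNorm_ramQ Q) hP ?_ ?_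
  · refine hP.le_of_pow_le (n := 2) ?_
    rwa [ramQ_sq, Ideal.span_singleton_le_iff_mem]
  · intro hN
    have hN' : (Ideal.absNorm P).Prime := by rw [hN]; exact Fact.out
    obtain ⟨n, hn⟩ := intRes_of_absNorm_prime hN' X.α
    have h1 : (((p : ℤ) - n ^ 2 : ℤ) : O) ∈ P := by
      have : (((p : ℤ) - n ^ 2 : ℤ) : O) = (X.α + n) * (X.α - n) := by
        push_cast
        rw [← map_natCast X.φ, ← sq_α]; ring
      rw [this]
      exact P.mul_mem_left _ hn
    rw [int_mem_iff_of_absNorm_prime hN', hN, ← ZMod.intCast_zmod_eq_zero_iff_dvd] at h1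
    push_cast at h1
    exact hr ⟨n, by rw [← sq]; exact sub_eq_zero.1 h1⟩

end Octic

theorem even_of_norm_form {l m : ℕ} [Fact l.Prime] [Fact m.Prime] (hl : l % 8 = 5) (hm : m % 8 = 5)
    (hne : l ≠ m) (P : GaussPrime l) {x y z : GaussianInt} {e a b c : ℕ} (hz : z ≠ 0)
    (h : x ^ 2 - (-gI * (l * m)) * y ^ 2 =
      gI ^ e * (P.v ^ a * P.conj.v ^ b * (1 + gI) ^ (2 * c)) * z ^ 2) : Even a ∧ Even b := by
  have hz' : P.v ^ (a / 2) * P.conj.v ^ (b / 2) * (1 + gI) ^ c * z ≠ 0 :=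
    mul_ne_zero (mul_ne_zero (mul_ne_zero (pow_ne_zero _ P.v_ne_zero)
      (pow_ne_zero _ P.conj.v_ne_zero)) (pow_ne_zero _ one_add_gI_ne_zero)) hz
  have h1 := trivial_of_norm hl hm hne P (a := a % 2) (b := b % 2) (c := 0) (by omega) (by omega)
    (by omega) hz' (x := x) (y := y) (e := e) (by
      rw [h]
      conv_lhs => rw [← Nat.div_add_mod a 2, ← Nat.div_add_mod b 2]
      simp only [pow_add, pow_mul', mul_pow, pow_zero]
      ring)
  exact ⟨Nat.even_iff.2 h1.1, Nat.even_iff.2 h1.2.1⟩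

namespace Octic

variable {p q : ℕ} {RL RM Rk O : Type*} [CommRing RL] [CommRing RM] [CommRing Rk] [CommRing O]
  (X : Octic p q RL RM Rk O) [IsDedekindDomain RL] [IsDedekindDomain RM] [IsDedekindDomain Rk]
  [IsDedekindDomain O]

theorem exists_galoisNorm_span (x : O) : ∃ (g : GaussianInt) (u v : GaussianInt),
    X.galoisNorm (Ideal.span {x}) = Ideal.span {X.φ g} ∧
      u ^ 2 - X.Ek.d * v ^ 2 = g * (2 * X.Ek.d) ^ 2 := by
  obtain ⟨n, hn⟩ := X.Λk.exists_norm x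
  obtain ⟨g, hg⟩ := X.Ek.exists_norm n
  obtain ⟨u, v, h⟩ := X.Ek.exists_norm_form hg
  refine ⟨g, u, v, ?_, h⟩
  have h1 := congrArg X.ΛL.s hn
  rw [map_mul, X.s_k_j, X.s_k x, X.ΛL.invol] at h1
  rw [← φ_k, hg, map_mul, hn, h1, galoisNorm, X.ΛL.map_s_span, X.ΛM.map_s_span, X.Λk.map_s_span,
    Ideal.span_singleton_mul_span_singleton, Ideal.span_singleton_mul_span_singleton,
    Ideal.span_singleton_mul_span_singleton]
  congr 2
  ring

theorem exists_norm_form_of_idealClass {J B : Ideal O} (hJ : J ≠ ⊥) (hB : B ≠ ⊥)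
    (h : idealClass J = idealClass B ^ 2) {m : GaussianInt}
    (hm : X.galoisNorm J = Ideal.span {X.φ m}) :
    ∃ (e : ℕ) (x y z : GaussianInt), z ≠ 0 ∧ x ^ 2 - X.Ek.d * y ^ 2 = gI ^ e * m * z ^ 2 := by
  rw [← idealClass_pow hB, idealClass_eq_iff hJ (pow_ne_zero 2 hB)] at h
  obtain ⟨x, y, hx, hy, h⟩ := h
  obtain ⟨g, u, v, hg, huv⟩ := X.exists_galoisNorm_span x
  obtain ⟨g', u', v', hg', huv'⟩ := X.exists_galoisNorm_span y
  obtain ⟨b, hb⟩ := X.exists_galoisNorm B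
  have h1 := congrArg X.galoisNorm h
  rw [galoisNorm_mul, galoisNorm_mul, galoisNorm_pow, hg, hg', hm, hb,
    Ideal.span_singleton_pow, Ideal.span_singleton_mul_span_singleton,
    Ideal.span_singleton_mul_span_singleton, ← map_pow, ← map_mul, ← map_mul] at h1
  obtain ⟨w, hw⟩ := X.EL.associated_of_span_eq (X.ΛL.associated_of_span_eq h1 |>
    Ideal.span_singleton_eq_span_singleton.2)
  obtain ⟨e, he⟩ := gaussianInt_isUnit w⁻¹.isUnit
  have hne : ∀ {I : Ideal O} {g : GaussianInt}, I ≠ ⊥ → X.galoisNorm I = Ideal.span {X.φ g} →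
      g ≠ 0 := by
    rintro I g hI hg rfl
    rw [map_zero, Ideal.span_singleton_eq_bot.2 rfl] at hg
    exact mul_ne_zero (mul_ne_zero hI (X.ΛL.map_s_ne_bot hI))
      (mul_ne_zero (X.ΛM.map_s_ne_bot hI) (X.Λk.map_s_ne_bot hI)) hg
  have hw' : g * m = gI ^ e * (g' * b ^ 2) := by
    rw [← he, ← hw, mul_comm (g * m), ← mul_assoc, Units.inv_mul, one_mul]
  have hd : 2 * X.Ek.d ≠ 0 := mul_ne_zero two_ne_zero X.Ek.d_ne_zero
  refine ⟨e, m * (u * u' + X.Ek.d * v * v'), m * (u * v' + u' * v), g' * b * (2 * X.Ek.d) ^ 2,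
    mul_ne_zero (mul_ne_zero (hne (Ideal.span_ne_bot hy) hg') (hne hB hb)) (pow_ne_zero 2 hd), ?_⟩
  have h3 : (u * u' + X.Ek.d * v * v') ^ 2 - X.Ek.d * (u * v' + u' * v) ^ 2 =
      (g * (2 * X.Ek.d) ^ 2) * (g' * (2 * X.Ek.d) ^ 2) := by
    rw [← huv, ← huv']; ring
  linear_combination m ^ 2 * h3 + m * g' * (2 * X.Ek.d) ^ 4 * hw'

variable [Fact p.Prime] [Fact q.Prime]

theorem galoisNorm_two : X.galoisNorm X.two = Ideal.span {X.φ ((1 + gI) ^ 2)} := by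
  apply Ideal.eq_of_sq_eq
  rw [← galoisNorm_pow, two_sq, galoisNorm, X.ΛL.map_s_span, X.ΛM.map_s_span, X.Λk.map_s_span,
    X.s_k, τ_φ, σ_φ, Ideal.span_singleton_mul_span_singleton, Ideal.span_singleton_mul_span_singleton,
    Ideal.span_singleton_pow, map_pow]
  congr 2
  ring

theorem even_of_idealClass_eq_one {I I' : Ideal O} {l m : ℕ} [Fact l.Prime] [Fact m.Prime]
    (hl : l % 8 = 5) (hm : m % 8 = 5) (hne : l ≠ m) (hd : p * q = l * m) (P : GaussPrime l)
    (hI : I ≠ ⊥) (hI' : I' ≠ ⊥) (hP : X.galoisNorm I = Ideal.span {X.φ P.v})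
    (hP' : X.galoisNorm I' = Ideal.span {X.φ P.conj.v}) {N a b c : ℕ} (hN : Odd N)
    (h : (idealClass I ^ N) ^ a * (idealClass I' ^ N) ^ b * idealClass X.two ^ c = 1) :
    Even a ∧ Even b := by
  rw [← pow_mul, ← pow_mul, ← idealClass_pow hI, ← idealClass_pow hI',
    ← idealClass_pow X.two_ne_bot, ← idealClass_mul (pow_ne_zero _ hI) (pow_ne_zero _ hI'),
    ← idealClass_mul (mul_ne_zero (pow_ne_zero _ hI) (pow_ne_zero _ hI'))
      (pow_ne_zero _ X.two_ne_bot)] at h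
  obtain ⟨e, x, y, z, hz, hxy⟩ := X.exists_norm_form_of_idealClass (B := ⊤)
    (m := P.v ^ (N * a) * P.conj.v ^ (N * b) * (1 + gI) ^ (2 * c))
    (mul_ne_zero (mul_ne_zero (pow_ne_zero _ hI) (pow_ne_zero _ hI'))
      (pow_ne_zero _ X.two_ne_bot)) top_ne_bot (by rw [h, idealClass_top, one_pow]) (by
    rw [galoisNorm_mul, galoisNorm_mul, galoisNorm_pow, galoisNorm_pow, galoisNorm_pow, hP, hP',
      galoisNorm_two, Ideal.span_singleton_pow, Ideal.span_singleton_pow, Ideal.span_singleton_pow,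
      Ideal.span_singleton_mul_span_singleton, Ideal.span_singleton_mul_span_singleton]
    simp only [map_mul, map_pow, pow_mul])
  have hd' : X.Ek.d = -gI * (l * m) := by
    rw [X.d_k, ← Nat.cast_mul, hd, Nat.cast_mul]
  rw [hd'] at hxy
  have h1 := even_of_norm_form hl hm hne P hz hxy
  rw [Nat.even_mul, Nat.even_mul, or_iff_right (Nat.not_even_iff_odd.2 hN),
    or_iff_right (Nat.not_even_iff_odd.2 hN)] at h1
  exact h1

theorem even_of_idealClass_two_pow {k : ℕ} (h : idealClass X.two ^ k = 1) : Even k := by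
  rcases Nat.even_or_odd' k with ⟨m, rfl | rfl⟩
  · exact even_two_mul m
  · rw [pow_succ, pow_mul, X.idealClass_two_sq, one_pow, one_mul] at h
    exact absurd h X.idealClass_two_ne_one

variable [Module.Free ℤ RL] [Module.Finite ℤ RL]

theorem idealClass_map_L_pow {N n : ℕ} (hL : ∀ y : ClassGroup RL, (y ^ N) ^ 2 ^ n = 1)
    {B : Ideal RL} (hB : B ≠ ⊥) : idealClass (B.map X.ΛL.j) ^ N = 1 := by
  have h := X.EL.idealClass_eq_one X.rank_L X.hp X.d_L X.c_L (I := B ^ N) (n := n)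
    (by rw [idealClass_pow hB, hL])
  obtain ⟨x, hx, hBx⟩ := (idealClass_eq_one_iff (pow_ne_zero N hB)).1 h
  rw [← idealClass_pow (X.ΛL.map_j_ne_bot hB), ← Ideal.map_pow, hBx, Ideal.map_span,
    Set.image_singleton, idealClass_span (X.ΛL.j_ne_zero hx)]

theorem idealClass_mul_map_s_pow {N n : ℕ} (hL : ∀ y : ClassGroup RL, (y ^ N) ^ 2 ^ n = 1)
    {I : Ideal O} (hI : I ≠ ⊥) : idealClass (I * I.map X.ΛL.s) ^ N = 1 := by
  obtain ⟨B, hB⟩ := X.ΛL.exists_map_eq I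
  rw [← hB]
  refine X.idealClass_map_L_pow hL ?_
  rintro rfl
  rw [Ideal.map_bot] at hB
  exact mul_ne_zero hI (X.ΛL.map_s_ne_bot hI) hB.symm

/-- Up to a power of the imaginary unit, the ideal class of `I` is that of an invariant ideal. -/
def HasType (I : Ideal O) (t : ℕ) : Prop := ∃ l γ : O, l ≠ 0 ∧ X.ΛL.s l = l ∧
  I * I.map X.ΛL.s = Ideal.span {l} ∧ I ^ 2 = Ideal.span {γ} ∧
    γ * X.ΛL.s γ = X.φ gI ^ t * l ^ 2

variable {X} in
theorem HasType.exists_invariant {I : Ideal O} (hI : I ≠ ⊥) (h : X.HasType I 0) :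
    ∃ J, J ≠ ⊥ ∧ idealClass J = idealClass I ∧ J.map X.ΛL.s = J := by
  obtain ⟨l, γ, hl, hls, h1, h2, h3⟩ := h
  obtain ⟨z, J, hz, rfl, hJ⟩ := X.ΛL.exists_invariant hI hls h1 h2 (by rw [h3, pow_zero, one_mul])
  refine ⟨_, mul_ne_zero (Ideal.span_ne_bot hz) hI, ?_, hJ⟩
  rw [idealClass_mul (Ideal.span_ne_bot hz) hI, idealClass_span hz, one_mul]

variable {X} in
theorem HasType.mul {I J : Ideal O} (hI : X.HasType I 1) (hJ : X.HasType J 1) :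
    X.HasType (I * J) 0 := by
  obtain ⟨l, γ, hl, hls, h1, h2, h3⟩ := hI
  obtain ⟨l', γ', hl', hls', h1', h2', h3'⟩ := hJ
  have hu : IsUnit (X.φ gI) := gI_isUnit.map X.φ
  refine ⟨X.φ gI * (l * l'), γ * γ', mul_ne_zero hu.ne_zero (mul_ne_zero hl hl'), ?_, ?_, ?_, ?_⟩
  · rw [map_mul, map_mul, hls, hls', σ_φ]
  · rw [Ideal.span_singleton_mul_left_unit hu, ← Ideal.span_singleton_mul_span_singleton, ← h1,
      ← h1', Ideal.map_mul]
    ring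
  · rw [mul_pow, h2, h2', Ideal.span_singleton_mul_span_singleton]
  · rw [map_mul, mul_mul_mul_comm, h3, h3']
    ring

theorem exists_hasType {I : Ideal O} (hI : I ≠ ⊥) (h : idealClass I ^ 2 = 1) :
    X.HasType I 0 ∨ X.HasType I 1 := by
  obtain ⟨l, γ, t, ht, h⟩ := X.exists_type hI h
  rcases (by omega : t = 0 ∨ t = 1) with rfl | rfl
  · exact Or.inl ⟨l, γ, h⟩
  · exact Or.inr ⟨l, γ, h⟩

end Octic

theorem GaussPrime.exists_sqrt {l : ℕ} [Fact l.Prime] (hl : l % 8 = 5) (P : GaussPrime l)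
    {d : GaussianInt} (hd : P.red d ≠ 0) (h : IsSquare (P.red d)) :
    ∃ (t : ℤ) (z a b : GaussianInt), d - (t : GaussianInt) ^ 2 = P.v * z ∧
      a * P.v + b * (2 * t) = 1 := by
  obtain ⟨r, hr⟩ := h
  have hr0 : r ≠ 0 := by
    rintro rfl
    exact hd (by rw [hr, mul_zero])
  have ht : P.red ((r.val : ℤ) : GaussianInt) = r := by
    rw [map_intCast, Int.cast_natCast, ZMod.natCast_zmod_val]
  obtain ⟨z, hz⟩ := (P.red_eq_zero (d - ((r.val : ℤ) : GaussianInt) ^ 2)).1 (by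
    rw [map_sub, map_pow, ht, hr]; ring)
  obtain ⟨a, b, hab⟩ := P.isCoprime_of_red_ne_zero (w := 2 * ((r.val : ℤ) : GaussianInt)) (by
    rw [map_mul, ht, map_ofNat]
    exact mul_ne_zero (two_ne_zero_zmod hl) hr0)
  exact ⟨r.val, z, a, b, hz, hab⟩

namespace Octic

variable {p q : ℕ} {RL RM Rk O : Type*} [CommRing RL] [CommRing RM] [CommRing Rk] [CommRing O]
  (X : Octic p q RL RM Rk O) [IsDedekindDomain RL] [IsDedekindDomain RM] [IsDedekindDomain Rk]
  [IsDedekindDomain O] [Fact p.Prime] [Fact q.Prime]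

theorem galoisNorm_of_mul_map_L {I J : Ideal O} (h : I.map X.ΛM.s = I) (hI : I * I.map X.ΛL.s = J) :
    X.galoisNorm I = J ^ 2 := by
  rw [galoisNorm, ← map_s_k', h, hI, sq]

theorem galoisNorm_of_mul_map_M {I J : Ideal O} (h : I.map X.ΛL.s = I) (hI : I * I.map X.ΛM.s = J) :
    X.galoisNorm I = J ^ 2 := by
  rw [galoisNorm, ← map_s_k, h, ← hI]
  ring

theorem ne_bot_of_galoisNorm {I : Ideal O} {g : GaussianInt} (hg : g ≠ 0)
    (h : X.galoisNorm I = Ideal.span {X.φ g}) : I ≠ ⊥ := by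
  rintro rfl
  rw [galoisNorm, Ideal.bot_mul, Ideal.bot_mul, eq_comm, Ideal.span_singleton_eq_bot] at h
  exact X.φ_ne_zero hg h

theorem exists_ideal_above_p (P : GaussPrime p) (hr : ¬IsSquare (p : ZMod q)) :
    ∃ I : Ideal O, I.map X.ΛM.s = I ∧ X.galoisNorm I = Ideal.span {X.φ P.v} := by
  have hq0 : (q : ZMod p) ≠ 0 := natCast_prime_ne_zero X.hne
  have hd : P.red (-gI * q) ≠ 0 := by
    rw [map_mul, map_neg, map_natCast]
    exact mul_ne_zero (neg_ne_zero.2 P.red_gI_ne_zero) hq0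
  have hpq : quadraticChar (ZMod p) q = -1 := by
    rw [quadraticChar_swap X.hp X.hq, quadraticChar_neg_one_iff_not_isSquare]
    exact hr
  have hs : IsSquare (P.red (-gI * q)) := by
    rw [← quadraticChar_one_iff_isSquare hd, map_mul, map_neg, map_natCast, map_mul, hpq,
      neg_eq_neg_one_mul, map_mul, quadraticChar_neg_one' X.hp, P.char_I X.hp]
    rfl
  obtain ⟨t, z, a, b, h1, h2⟩ := P.exists_sqrt X.hp hd hs
  obtain ⟨I, hI, hI'⟩ := exists_mul_map_eq_span_pair (s := X.ΛL.s) (s' := X.ΛM.s) (v := X.φ P.v)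
    (A := X.β) (B := X.α) (z := X.φ z) (a := X.φ a) (b := X.φ b) (t := t) (X.σ_φ _) X.σ_β X.σ_α
    (X.τ_φ _) X.τ_β X.τ_α
    (by rw [sq_β, ← map_intCast X.φ, ← map_pow, ← map_sub, h1, map_mul])
    (by rw [← map_intCast X.φ, ← map_ofNat X.φ, ← map_mul, ← map_mul, ← map_mul, ← map_add, h2,
      map_one])
    (X.ramP_sq P)
  exact ⟨I, hI, by rw [X.galoisNorm_of_mul_map_L hI hI', ← X.ramP_sq P, ramP]⟩

theorem exists_ideal_above_q (Q : GaussPrime q) (hr : IsSquare (p : ZMod q)) :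
    ∃ I : Ideal O, I.map X.ΛL.s = I ∧ I * I.map X.ΛM.s = X.ramQ Q := by
  have hd : Q.red p ≠ 0 := by
    rw [map_natCast]
    exact natCast_prime_ne_zero X.hne.symm
  obtain ⟨t, z, a, b, h1, h2⟩ := Q.exists_sqrt X.hq hd (by rwa [map_natCast])
  exact exists_mul_map_eq_span_pair (s := X.ΛM.s) (s' := X.ΛL.s) (v := X.φ Q.v)
    (A := X.α) (B := X.β) (z := X.φ z) (a := X.φ a) (b := X.φ b) (t := t) (X.τ_φ _) X.τ_α X.τ_β
    (X.σ_φ _) X.σ_α X.σ_β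
    (by rw [sq_α, ← map_intCast X.φ, ← map_pow, ← map_sub, h1, map_mul])
    (by rw [← map_intCast X.φ, ← map_ofNat X.φ, ← map_mul, ← map_mul, ← map_mul, ← map_add, h2,
      map_one])
    (X.ramQ_sq Q)

variable [Module.Free ℤ RL] [Module.Finite ℤ RL] [Module.Free ℤ RM] [Module.Finite ℤ RM]
  [Module.Free ℤ Rk] [Module.Finite ℤ Rk] [Module.Free ℤ O] [Module.Finite ℤ O]

theorem exists_pow_eq_of_invariant (hr : ¬IsSquare (p : ZMod q)) {N n : ℕ}
    (hL : ∀ y : ClassGroup RL, (y ^ N) ^ 2 ^ n = 1) (J : Ideal O) (hJ : J ≠ ⊥)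
    (hJs : J.map X.ΛL.s = J) : ∃ k : ℕ, idealClass J ^ N = idealClass X.two ^ k := by
  obtain ⟨Q⟩ := exists_gaussPrime X.hq
  refine X.ΛL.invariant_induction (p := fun J => ∃ k : ℕ, idealClass J ^ N = idealClass X.two ^ k)
    ⟨0, by rw [idealClass_top, one_pow, pow_zero]⟩ ?_ ?_ ?_ J hJ hJs
  · rintro I J hI hJ ⟨k, hk⟩ ⟨m, hm⟩
    exact ⟨k + m, by rw [idealClass_mul hI hJ, mul_pow, hk, hm, pow_add]⟩
  · intro P hP hP0
    exact ⟨0, by rw [X.idealClass_mul_map_s_pow hL hP0, pow_zero]⟩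
  · intro P hP hP0 hPs
    rcases X.mem_or_mem_of_invariant hP hP0 hPs with ⟨B, hB, rfl⟩ | h | h
    · exact ⟨0, by rw [X.idealClass_map_L_pow hL hB, pow_zero]⟩
    · exact ⟨N, by rw [X.eq_two hP h]⟩
    · obtain ⟨Q', -, hQ'⟩ := X.exists_mem_of_mem hP h Q
      exact ⟨N, by rw [X.eq_ramQ hr hP hQ', X.idealClass_ramQ]⟩

theorem idealClass_two_pow_of_odd {c : ℕ} (hc : Odd c) : idealClass X.two ^ c = idealClass X.two := by
  obtain ⟨m, rfl⟩ := hc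
  rw [pow_succ, pow_mul, X.idealClass_two_sq, one_pow, one_mul]

theorem sq_idealClass_pow_above_p (hr : ¬IsSquare (p : ZMod q)) {N n : ℕ} (hN : Odd N)
    (hO : ∀ x : ClassGroup O, (x ^ N) ^ 2 ^ n = 1) {P : GaussPrime p} {I : Ideal O}
    (hIs : I.map X.ΛM.s = I) (hI : X.galoisNorm I = Ideal.span {X.φ P.v}) :
    (idealClass I ^ N) ^ 2 = idealClass X.two := by
  have hI0 := X.ne_bot_of_galoisNorm P.v_ne_zero hI
  have hp0 : (p : ZMod q) ≠ 0 := natCast_prime_ne_zero X.hne.symm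
  have hnorm : (((P.v ^ N).norm : ℤ) : ZMod q) = (p : ZMod q) ^ N := by
    rw [norm_pow_gaussian, P.norm_v]; push_cast; rfl
  obtain ⟨c, h1, h2⟩ := X.exists_sqRep_M (I := I ^ N) (pow_ne_zero N hI0) (n := n)
    (by rw [idealClass_pow hI0, hO]) (g := P.v ^ N)
    (by rw [galoisNorm_pow, hI, Ideal.span_singleton_pow, map_pow])
    (by rw [hnorm]; exact pow_ne_zero N hp0)
  rw [hnorm, map_pow, quadraticChar_neg_one_iff_not_isSquare.2 hr, hN.neg_one_pow] at h2
  have hc : Odd c := by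
    by_contra hc
    rw [(Nat.not_odd_iff_even.1 hc).neg_one_pow] at h2
    exact absurd h2 (by decide)
  rw [Ideal.map_pow, hIs, ← sq] at h1
  rw [← X.idealClass_two_pow_of_odd hc, ← X.idealClass_of_sqRep _ h1, idealClass_pow,
    idealClass_pow hI0]
  · exact pow_ne_zero N hI0
  · exact pow_ne_zero 2 (pow_ne_zero N hI0)

theorem exists_generators_of_not_isSquare (X : Octic p q RL RM Rk O) (hr : ¬IsSquare (p : ZMod q))
    {N n : ℕ} (hN : Odd N) (hO : ∀ x : ClassGroup O, (x ^ N) ^ 2 ^ n = 1)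
    (hL : ∀ y : ClassGroup RL, (y ^ N) ^ 2 ^ n = 1) :
    ∃ a y : ClassGroup O, a ^ 4 = 1 ∧ y ^ 2 = 1 ∧
      (∀ i j : ℕ, y ^ i * a ^ j = 1 → Even i ∧ 4 ∣ j) ∧
      ∀ x, x ^ 2 ^ n = 1 → ∃ i j : ℕ, x = y ^ i * a ^ j := by
  obtain ⟨P⟩ := exists_gaussPrime X.hp
  obtain ⟨I, hIs, hI⟩ := X.exists_ideal_above_p P hr
  obtain ⟨I', hIs', hI'⟩ := X.exists_ideal_above_p P.conj hr
  have hI0 := X.ne_bot_of_galoisNorm P.v_ne_zero hI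
  have hI0' := X.ne_bot_of_galoisNorm P.conj.v_ne_zero hI'
  have ha := X.sq_idealClass_pow_above_p hr hN hO hIs hI
  have hb := X.sq_idealClass_pow_above_p hr hN hO hIs' hI'
  have hind := fun {a b c : ℕ} => X.even_of_idealClass_eq_one (a := a) (b := b) (c := c) X.hp X.hq
    X.hne rfl P hI0 hI0' hI hI' hN
  have hc := X.idealClass_two_sq
  have hy0 : I ^ N * I' ^ N ≠ ⊥ := mul_ne_zero (pow_ne_zero N hI0) (pow_ne_zero N hI0')
  have hy : idealClass (I ^ N * I' ^ N) = idealClass I ^ N * idealClass I' ^ N := by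
    rw [idealClass_mul (pow_ne_zero N hI0) (pow_ne_zero N hI0'), idealClass_pow hI0,
      idealClass_pow hI0']
  have hN' : ∀ x : ClassGroup O, x ^ 2 = 1 → x ^ N = x := by
    intro x hx
    obtain ⟨m, rfl⟩ := hN
    rw [pow_succ, pow_mul, hx, one_pow, one_mul]
  have htype : ∀ J : Ideal O, J ≠ ⊥ → idealClass J ^ 2 = 1 → X.HasType J 0 →
      ∃ k : ℕ, idealClass J = idealClass X.two ^ k := by
    intro J hJ hJ2 h
    obtain ⟨J', h0, h1, h2⟩ := h.exists_invariant hJ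
    obtain ⟨k, hk⟩ := X.exists_pow_eq_of_invariant hr hL J' h0 h2
    exact ⟨k, by rw [← hN' _ hJ2, ← h1, hk]⟩
  generalize hcd : idealClass X.two = c at *
  have hk' : ∀ k : ℕ, c ^ k * c ^ k = 1 := fun k => by
    rw [← mul_pow, ← sq, hc, one_pow]
  have hy2 : idealClass (I ^ N * I' ^ N) ^ 2 = 1 := by
    rw [hy, mul_pow, ha, hb, ← sq, hc]
  have hy1 : X.HasType (I ^ N * I' ^ N) 1 := by
    refine (X.exists_hasType hy0 hy2).resolve_left fun h => ?_
    obtain ⟨k, hk⟩ := htype _ hy0 hy2 h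
    have := (hind (a := 1) (b := 1) (c := k) (by rw [pow_one, pow_one, ← hy, hk, hk'])).1
    exact absurd this (by decide)
  refine ⟨idealClass I ^ N, idealClass (I ^ N * I' ^ N), ?_, hy2, ?_, ?_⟩
  · rw [show 4 = 2 * 2 from rfl, pow_mul, ha, hc]
  · intro i j hij
    obtain ⟨h1, h2⟩ := hind (a := i + j) (b := i) (c := 0) (by
      rw [pow_zero, mul_one, ← hij, hy, mul_pow, pow_add]
      simp only [mul_comm, mul_left_comm, mul_assoc])
    refine ⟨h2, ?_⟩
    obtain ⟨m, rfl⟩ := ((Nat.even_add.1 h1).1 h2).two_dvd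
    obtain ⟨i, rfl⟩ := h2.two_dvd
    rw [pow_mul, pow_mul, hy2, one_pow, one_mul, ha, ← hcd] at hij
    obtain ⟨m, rfl⟩ := (X.even_of_idealClass_two_pow hij).two_dvd
    exact ⟨m, by ring⟩
  · have main : ∀ x : ClassGroup O, x ^ 2 = 1 → ∃ i j : ℕ,
        x = idealClass (I ^ N * I' ^ N) ^ i * (idealClass I ^ N) ^ j := by
      intro x hx
      obtain ⟨J, hJ, rfl⟩ := exists_idealClass_eq x
      rcases X.exists_hasType hJ hx with h | h
      · obtain ⟨k, hk⟩ := htype J hJ hx h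
        exact ⟨0, 2 * k, by rw [hk, pow_zero, one_mul, pow_mul, ha]⟩
      · obtain ⟨k, hk⟩ := htype _ (mul_ne_zero hJ hy0)
          (by rw [idealClass_mul hJ hy0, mul_pow, hx, hy2, one_mul]) (h.mul hy1)
        refine ⟨1, 2 * k, ?_⟩
        rw [pow_mul, ha, ← hk, idealClass_mul hJ hy0, mul_left_comm, ← pow_succ, hy2, mul_one]
    intro x hx
    obtain ⟨J, hJ, rfl⟩ := exists_idealClass_eq x
    obtain ⟨-, k, hk, -⟩ := X.exists_idealClass_sq hJ hx
    rw [hcd] at hk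
    rcases Nat.even_or_odd k with h | h
    · refine main _ ?_
      obtain ⟨m, rfl⟩ := h
      rw [hk, pow_add, hk']
    · have h3 := X.idealClass_two_pow_of_odd h
      rw [hcd] at h3
      obtain ⟨i, j, hij⟩ := main (idealClass J * idealClass I ^ N) (by
        rw [mul_pow, hk, h3, ha, ← sq, hc])
      refine ⟨i, j + 3, ?_⟩
      have h4 : (idealClass I ^ N) ^ 4 = 1 := by rw [show 4 = 2 * 2 from rfl, pow_mul, ha, hc]
      rw [pow_add, ← mul_assoc, ← hij, mul_assoc, ← pow_succ', h4, mul_one]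

end Octic

namespace Octic

variable {p q : ℕ} {RL RM Rk O : Type*} [CommRing RL] [CommRing RM] [CommRing Rk] [CommRing O]
  (X : Octic p q RL RM Rk O) [IsDedekindDomain RL] [IsDedekindDomain RM] [IsDedekindDomain Rk]
  [IsDedekindDomain O] [Fact p.Prime] [Fact q.Prime]
  [Module.Free ℤ RL] [Module.Finite ℤ RL] [Module.Free ℤ RM] [Module.Finite ℤ RM]
  [Module.Free ℤ Rk] [Module.Finite ℤ Rk] [Module.Free ℤ O] [Module.Finite ℤ O]

theorem absNorm_above_q {Q : GaussPrime q} {I : Ideal O} (hI : I * I.map X.ΛM.s = X.ramQ Q) :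
    Ideal.absNorm I = q := by
  have h := X.absNorm_ramQ Q
  rw [← hI, map_mul, absNorm_map_equiv, ← sq] at h
  exact Nat.pow_left_injective two_ne_zero h

theorem eq_above_q {Q : GaussPrime q} {I P : Ideal O} (hI : I * I.map X.ΛM.s = X.ramQ Q)
    (hP : P.IsPrime) (h : X.φ Q.v ∈ P) : P = I ∨ P = I.map X.ΛM.s := by
  have hq : (Ideal.absNorm I).Prime := by rw [X.absNorm_above_q hI]; exact Fact.out
  have hmax : ∀ J : Ideal O, (Ideal.absNorm J).Prime → J ≤ P → P = J := fun J hJ hJP =>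
    (((prime_of_absNorm_prime hJ).1.isMaximal (prime_of_absNorm_prime hJ).2).eq_of_le
      hP.ne_top hJP).symm
  have h1 : X.ramQ Q ≤ P := hP.le_of_pow_le (n := 2) (by
    rwa [ramQ_sq, Ideal.span_singleton_le_iff_mem])
  rw [← hI] at h1
  refine (hP.mul_le.1 h1).imp (hmax I hq) (hmax _ ?_)
  rwa [absNorm_map_equiv]

theorem not_hasType_one {Q : GaussPrime q} {I : Ideal O} (hIs : I.map X.ΛL.s = I)
    (hI : I * I.map X.ΛM.s = X.ramQ Q) {J : Ideal O} (hJ : J ≠ ⊥) : ¬X.HasType J 1 := by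
  rintro ⟨l, γ, hl, hls, h1, h2, h3⟩
  have hq : (Ideal.absNorm I).Prime := by rw [X.absNorm_above_q hI]; exact Fact.out
  obtain ⟨n, hn⟩ := X.ΛL.exists_sq_sub_mem hJ hl hls (X.ΛL.mul_span_eq h1 h2) h3
    (prime_of_absNorm_prime hq).1 (prime_of_absNorm_prime hq).2 hIs (intRes_of_absNorm_prime hq)
  have h4 : ((n ^ 4 + 1 : ℤ) : O) ∈ I := by
    have : ((n ^ 4 + 1 : ℤ) : O) = ((n : O) ^ 2 + X.φ gI ^ 1) * ((n : O) ^ 2 - X.φ gI ^ 1) := by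
      have h5 := congrArg X.φ gI_mul_gI
      rw [map_mul, map_neg, map_one] at h5
      push_cast
      linear_combination h5
    rw [this]
    exact I.mul_mem_left _ hn
  rw [int_mem_iff_of_absNorm_prime hq, X.absNorm_above_q hI,
    ← ZMod.intCast_zmod_eq_zero_iff_dvd] at h4
  push_cast at h4
  exact zmod_pow_four_ne_neg_one X.hq _ (eq_neg_of_add_eq_zero_left h4)

theorem idealClass_sq_eq_one (X : Octic p q RL RM Rk O) (hr : IsSquare (p : ZMod q))
    {x : ClassGroup O} {n : ℕ} (hx : x ^ 2 ^ n = 1) : x ^ 2 = 1 := by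
  obtain ⟨J, hJ, rfl⟩ := exists_idealClass_eq x
  obtain ⟨a, c, h1, h2⟩ := X.exists_idealClass_sq hJ hx
  rw [quadraticChar_of_isSquare hr (natCast_prime_ne_zero X.hne.symm), one_pow] at h2
  rcases Nat.even_or_odd c with h | h
  · obtain ⟨m, rfl⟩ := h.two_dvd
    rw [h1, pow_mul, X.idealClass_two_sq, one_pow]
  · rw [h.neg_one_pow] at h2
    exact absurd h2 (by decide)

theorem exists_generators_of_isSquare (X : Octic p q RL RM Rk O) (hr : IsSquare (p : ZMod q))
    {N n : ℕ} (hN : Odd N) (hO : ∀ x : ClassGroup O, (x ^ N) ^ 2 ^ n = 1)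
    (hL : ∀ y : ClassGroup RL, (y ^ N) ^ 2 ^ n = 1) :
    ∃ a b c : ClassGroup O, a ^ 2 = 1 ∧ b ^ 2 = 1 ∧ c ^ 2 = 1 ∧
      (∀ i j k : ℕ, a ^ i * b ^ j * c ^ k = 1 → Even i ∧ Even j ∧ Even k) ∧
      ∀ x, x ^ 2 ^ n = 1 → ∃ i j k : ℕ, x = a ^ i * b ^ j * c ^ k := by
  obtain ⟨Q⟩ := exists_gaussPrime X.hq
  obtain ⟨I, hIs, hI⟩ := X.exists_ideal_above_q Q hr
  obtain ⟨I', hIs', hI'⟩ := X.exists_ideal_above_q Q.conj hr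
  have hn : X.galoisNorm I = Ideal.span {X.φ Q.v} := by
    rw [X.galoisNorm_of_mul_map_M hIs hI, ramQ_sq]
  have hn' : X.galoisNorm I' = Ideal.span {X.φ Q.conj.v} := by
    rw [X.galoisNorm_of_mul_map_M hIs' hI', ramQ_sq]
  have hI0 := X.ne_bot_of_galoisNorm Q.v_ne_zero hn
  have hI0' := X.ne_bot_of_galoisNorm Q.conj.v_ne_zero hn'
  have hsq : ∀ J : Ideal O, (idealClass J ^ N) ^ 2 = 1 := fun J =>
    X.idealClass_sq_eq_one hr (hO _)
  have hinv : ∀ J : Ideal O, J ≠ ⊥ → J.map X.ΛL.s = J → ∃ i j k : ℕ, idealClass J ^ N =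
      (idealClass I ^ N) ^ i * (idealClass I' ^ N) ^ j * idealClass X.two ^ k := by
    refine X.ΛL.invariant_induction (p := fun J => ∃ i j k : ℕ, idealClass J ^ N =
      (idealClass I ^ N) ^ i * (idealClass I' ^ N) ^ j * idealClass X.two ^ k) ?_ ?_ ?_ ?_
    · exact ⟨0, 0, 0, by simp only [idealClass_top, one_pow, pow_zero, mul_one]⟩
    · rintro J J' hJ hJ' ⟨i, j, k, h⟩ ⟨i', j', k', h'⟩
      refine ⟨i + i', j + j', k + k', ?_⟩
      rw [idealClass_mul hJ hJ', mul_pow, h, h', pow_add, pow_add, pow_add]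
      simp only [mul_left_comm, mul_assoc]
    · intro P hP hP0
      exact ⟨0, 0, 0, by simp only [X.idealClass_mul_map_s_pow hL hP0, pow_zero, mul_one]⟩
    · intro P hP hP0 hPs
      have hconj : ∀ {Q : GaussPrime q} {I : Ideal O}, I ≠ ⊥ → I * I.map X.ΛM.s = X.ramQ Q →
          idealClass (I.map X.ΛM.s) ^ N = idealClass I ^ N * idealClass X.two ^ N := by
        intro Q I hI0 hI
        rw [← X.idealClass_ramQ Q, ← hI, idealClass_mul hI0 (X.ΛM.map_s_ne_bot hI0), mul_pow,
          ← mul_assoc, ← sq, hsq, one_mul]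
      rcases X.mem_or_mem_of_invariant hP hP0 hPs with ⟨B, hB, rfl⟩ | h | h
      · exact ⟨0, 0, 0, by simp only [X.idealClass_map_L_pow hL hB, pow_zero, mul_one]⟩
      · exact ⟨0, 0, N, by simp only [X.eq_two hP h, pow_zero, one_mul]⟩
      · obtain ⟨Q', rfl | rfl, hQ'⟩ := X.exists_mem_of_mem hP h Q
        · rcases X.eq_above_q hI hP hQ' with rfl | rfl
          · exact ⟨1, 0, 0, by simp only [pow_zero, pow_one, mul_one]⟩
          · exact ⟨1, 0, N, by simp only [hconj hI0 hI, pow_zero, pow_one, mul_one]⟩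
        · rcases X.eq_above_q hI' hP hQ' with rfl | rfl
          · exact ⟨0, 1, 0, by simp only [pow_zero, pow_one, mul_one, one_mul]⟩
          · exact ⟨0, 1, N, by simp only [hconj hI0' hI', pow_zero, pow_one, one_mul]⟩
  refine ⟨idealClass I ^ N, idealClass I' ^ N, idealClass X.two, hsq I, hsq I',
    X.idealClass_two_sq, ?_, ?_⟩
  · intro i j k h
    obtain ⟨⟨i, rfl⟩, ⟨j, rfl⟩⟩ := X.even_of_idealClass_eq_one X.hq X.hp X.hne.symm
      (mul_comm p q) Q hI0 hI0' hn hn' hN h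
    rw [← two_mul, ← two_mul, pow_mul, pow_mul, hsq, hsq, one_pow, one_pow, one_mul, one_mul] at h
    exact ⟨Even.add_self i, Even.add_self j, X.even_of_idealClass_two_pow h⟩
  · intro x hx
    have hx2 := X.idealClass_sq_eq_one hr hx
    obtain ⟨J, hJ, rfl⟩ := exists_idealClass_eq x
    obtain ⟨J', h0, h1, h2⟩ := ((X.exists_hasType hJ hx2).resolve_right
      (X.not_hasType_one hIs hI hJ)).exists_invariant hJ
    obtain ⟨i, j, k, h⟩ := hinv J' h0 h2
    refine ⟨i, j, k, ?_⟩
    rw [← h, h1]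
    obtain ⟨m, rfl⟩ := hN
    rw [pow_succ, pow_mul, hx2, one_pow, one_mul]

end Octic

section AddGroup

variable {A : Type*} [AddCommGroup A]

/-- The homomorphism from `ZMod n` sending `1` to an element killed by `n`. -/
def zmodHom (n : ℕ) (a : A) (h : n • a = 0) : ZMod n →+ A :=
  ZMod.lift n ⟨zmultiplesHom A a, by simpa using h⟩

theorem zmodHom_natCast {n : ℕ} {a : A} (h : n • a = 0) (k : ℕ) :
    zmodHom n a h (k : ZMod n) = k • a := by
  have := ZMod.lift_coe n ⟨zmultiplesHom A a, by simpa using h⟩ (k : ℤ)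
  simpa [zmodHom] using this

theorem nonempty_addEquiv_prod {m n : ℕ} [NeZero m] [NeZero n] {a b : A} (ha : m • a = 0)
    (hb : n • b = 0) (hind : ∀ i j : ℕ, i • a + j • b = 0 → m ∣ i ∧ n ∣ j)
    (hsurj : ∀ x, ∃ i j : ℕ, x = i • a + j • b) : Nonempty (A ≃+ ZMod m × ZMod n) := by
  let f : ZMod m × ZMod n →+ A := (zmodHom m a ha).coprod (zmodHom n b hb)
  have hf : ∀ i j : ℕ, f ((i : ZMod m), (j : ZMod n)) = i • a + j • b := fun i j => by
    rw [AddMonoidHom.coprod_apply, zmodHom_natCast, zmodHom_natCast]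
  refine ⟨(AddEquiv.ofBijective f ⟨(injective_iff_map_eq_zero f).2 ?_, fun x => ?_⟩).symm⟩
  · rintro ⟨x, y⟩ h
    obtain ⟨i, rfl⟩ := ZMod.natCast_zmod_surjective x
    obtain ⟨j, rfl⟩ := ZMod.natCast_zmod_surjective y
    rw [hf] at h
    obtain ⟨h1, h2⟩ := hind i j h
    rw [(ZMod.natCast_eq_zero_iff i m).2 h1, (ZMod.natCast_eq_zero_iff j n).2 h2]
    rfl
  · obtain ⟨i, j, rfl⟩ := hsurj x
    exact ⟨_, hf i j⟩

theorem nonempty_addEquiv_prod_prod {l m n : ℕ} [NeZero l] [NeZero m] [NeZero n] {a b c : A}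
    (ha : l • a = 0) (hb : m • b = 0) (hc : n • c = 0)
    (hind : ∀ i j k : ℕ, i • a + j • b + k • c = 0 → l ∣ i ∧ m ∣ j ∧ n ∣ k)
    (hsurj : ∀ x, ∃ i j k : ℕ, x = i • a + j • b + k • c) :
    Nonempty (A ≃+ ZMod l × ZMod m × ZMod n) := by
  let f : ZMod l × ZMod m × ZMod n →+ A :=
    (zmodHom l a ha).coprod ((zmodHom m b hb).coprod (zmodHom n c hc))
  have hf : ∀ i j k : ℕ, f ((i : ZMod l), (j : ZMod m), (k : ZMod n)) =
      i • a + j • b + k • c := fun i j k => by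
    rw [AddMonoidHom.coprod_apply, AddMonoidHom.coprod_apply, zmodHom_natCast, zmodHom_natCast,
      zmodHom_natCast, add_assoc]
  refine ⟨(AddEquiv.ofBijective f ⟨(injective_iff_map_eq_zero f).2 ?_, fun x => ?_⟩).symm⟩
  · rintro ⟨x, y, z⟩ h
    obtain ⟨i, rfl⟩ := ZMod.natCast_zmod_surjective x
    obtain ⟨j, rfl⟩ := ZMod.natCast_zmod_surjective y
    obtain ⟨k, rfl⟩ := ZMod.natCast_zmod_surjective z
    rw [hf] at h
    obtain ⟨h1, h2, h3⟩ := hind i j k h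
    rw [(ZMod.natCast_eq_zero_iff i l).2 h1, (ZMod.natCast_eq_zero_iff j m).2 h2,
      (ZMod.natCast_eq_zero_iff k n).2 h3]
    rfl
  · obtain ⟨i, j, k, rfl⟩ := hsurj x
    exact ⟨_, hf i j k⟩

end AddGroup

section Sylow

variable {G : Type*} [CommGroup G]

theorem Sylow.mem_of_pow_eq_one {p : ℕ} [Fact p.Prime] (P : Sylow p G) {x : G} {n : ℕ}
    (h : x ^ p ^ n = 1) : x ∈ P := by
  have hz : IsPGroup p (Subgroup.zpowers x) := by
    rintro ⟨y, hy⟩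
    obtain ⟨k, rfl⟩ := Subgroup.mem_zpowers_iff.1 hy
    refine ⟨n, Subtype.ext ?_⟩
    change (x ^ k) ^ p ^ n = 1
    rw [← zpow_natCast, zpow_comm, zpow_natCast, h, one_zpow]
  have h1 := P.is_maximal' (P.isPGroup'.to_sup_of_normal_right hz) le_sup_left
  have h2 : x ∈ (P : Subgroup G) ⊔ Subgroup.zpowers x :=
    Subgroup.mem_sup_right (Subgroup.mem_zpowers x)
  have h3 : x ∈ (P : Subgroup G) := by rw [← h1]; exact h2
  exact h3

theorem Sylow.pow_eq_one_of_mem {p : ℕ} [Fact p.Prime] (P : Sylow p G) {x : G} {n N : ℕ}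
    (hN : p.Coprime N) (h : (x ^ N) ^ p ^ n = 1) (hx : x ∈ P) : x ^ p ^ n = 1 := by
  obtain ⟨k, hk⟩ := P.isPGroup' ⟨x, hx⟩
  have hk' : x ^ p ^ k = 1 := congrArg Subtype.val hk
  rw [← pow_mul] at h
  refine orderOf_dvd_iff_pow_eq_one.1 (Nat.Coprime.dvd_of_dvd_mul_left ?_
    (orderOf_dvd_of_pow_eq_one h))
  exact (hN.pow_left k).coprime_dvd_left (orderOf_dvd_of_pow_eq_one hk')

end Sylow

namespace Octic

variable {p q : ℕ} {RL RM Rk O : Type*} [CommRing RL] [CommRing RM] [CommRing Rk] [CommRing O]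
  [IsDedekindDomain RL] [IsDedekindDomain RM] [IsDedekindDomain Rk]
  [IsDedekindDomain O] [Fact p.Prime] [Fact q.Prime]
  [Module.Free ℤ RL] [Module.Finite ℤ RL] [Module.Free ℤ RM] [Module.Finite ℤ RM]
  [Module.Free ℤ Rk] [Module.Finite ℤ Rk] [Module.Free ℤ O] [Module.Finite ℤ O]
  [Finite (ClassGroup O)] [Finite (ClassGroup RL)]

theorem exists_exponents (G H : Type*) [CommGroup G] [CommGroup H] [Finite G] [Finite H] :
    ∃ n N : ℕ, Odd N ∧ (∀ x : G, (x ^ N) ^ 2 ^ n = 1) ∧ ∀ y : H, (y ^ N) ^ 2 ^ n = 1 := by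
  obtain ⟨n, N, hN, h⟩ := Nat.exists_eq_two_pow_mul_odd (n := Nat.card G * Nat.card H)
    (mul_ne_zero Nat.card_pos.ne' Nat.card_pos.ne')
  refine ⟨n, N, hN, fun x => ?_, fun y => ?_⟩
  · rw [← pow_mul, mul_comm, ← h, pow_mul, pow_card_eq_one', one_pow]
  · rw [← pow_mul, mul_comm, ← h, mul_comm, pow_mul, pow_card_eq_one', one_pow]

theorem sylow_of_isSquare (X : Octic p q RL RM Rk O) (hr : IsSquare (p : ZMod q))
    (P : Sylow 2 (ClassGroup O)) : Nonempty (Additive P ≃+ (ZMod 2 × ZMod 2 × ZMod 2)) := by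
  obtain ⟨n, N, hN, hO, hL⟩ := exists_exponents (ClassGroup O) (ClassGroup RL)
  obtain ⟨a, b, c, ha, hb, hc, hind, hsurj⟩ := X.exists_generators_of_isSquare hr hN hO hL
  have hmem : ∀ {x : ClassGroup O}, x ^ 2 = 1 → x ∈ P := fun {x} hx =>
    P.mem_of_pow_eq_one (n := 1) (by rw [pow_one, hx])
  refine nonempty_addEquiv_prod_prod (a := Additive.ofMul (⟨a, hmem ha⟩ : P))
    (b := Additive.ofMul (⟨b, hmem hb⟩ : P)) (c := Additive.ofMul (⟨c, hmem hc⟩ : P))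
    (Subtype.ext ha) (Subtype.ext hb) (Subtype.ext hc) ?_ ?_
  · intro i j k h
    obtain ⟨h1, h2, h3⟩ := hind i j k (congrArg Subtype.val (congrArg Additive.toMul h))
    exact ⟨h1.two_dvd, h2.two_dvd, h3.two_dvd⟩
  · intro x
    obtain ⟨i, j, k, h⟩ := hsurj x.toMul
      (P.pow_eq_one_of_mem (Nat.coprime_two_left.2 hN) (hO _) x.toMul.2)
    exact ⟨i, j, k, Subtype.ext h⟩

theorem sylow_of_not_isSquare (X : Octic p q RL RM Rk O) (hr : ¬IsSquare (p : ZMod q))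
    (P : Sylow 2 (ClassGroup O)) : Nonempty (Additive P ≃+ (ZMod 2 × ZMod 4)) := by
  obtain ⟨n, N, hN, hO, hL⟩ := exists_exponents (ClassGroup O) (ClassGroup RL)
  obtain ⟨a, y, ha, hy, hind, hsurj⟩ := X.exists_generators_of_not_isSquare hr hN hO hL
  have hmem : ∀ {x : ClassGroup O} {n : ℕ}, x ^ 2 ^ n = 1 → x ∈ P := P.mem_of_pow_eq_one
  refine nonempty_addEquiv_prod (a := Additive.ofMul (⟨y, hmem (n := 1) hy⟩ : P))
    (b := Additive.ofMul (⟨a, hmem (n := 2) ha⟩ : P)) (Subtype.ext hy) (Subtype.ext ha) ?_ ?_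
  · intro i j h
    obtain ⟨h1, h2⟩ := hind i j (congrArg Subtype.val (congrArg Additive.toMul h))
    exact ⟨h1.two_dvd, h2⟩
  · intro x
    obtain ⟨i, j, h⟩ := hsurj x.toMul
      (P.pow_eq_one_of_mem (Nat.coprime_two_left.2 hN) (hO _) x.toMul.2)
    exact ⟨i, j, Subtype.ext h⟩

end Octic

section Kummer

variable {K : Type*} [Field K] [NumberField K]

theorem mem_sup_adjoin_simple {F : IntermediateField ℚ K} {x y : K} (hx : x ^ 2 ∈ F)
    (hy : y ∈ F ⊔ ℚ⟮x⟯) : ∃ u ∈ F, ∃ v ∈ F, y = u + v * x := by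
  let S : Subalgebra ℚ K :=
    { carrier := {z | ∃ u ∈ F, ∃ v ∈ F, z = u + v * x}
      mul_mem' := by
        rintro _ _ ⟨u, hu, v, hv, rfl⟩ ⟨u', hu', v', hv', rfl⟩
        exact ⟨u * u' + v * v' * x ^ 2,
          add_mem (mul_mem hu hu') (mul_mem (mul_mem hv hv') hx),
          u * v' + v * u', add_mem (mul_mem hu hv') (mul_mem hv hu'), by ring⟩
      add_mem' := by
        rintro _ _ ⟨u, hu, v, hv, rfl⟩ ⟨u', hu', v', hv', rfl⟩
        exact ⟨u + u', add_mem hu hu', v + v', add_mem hv hv', by ring⟩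
      algebraMap_mem' := fun r ↦ ⟨_, F.algebraMap_mem r, 0, zero_mem F, by simp⟩ }
  have hle : F ⊔ ℚ⟮x⟯ ≤ S.toIntermediateField
      (fun z hz ↦ S.inv_mem_of_algebraic (x := ⟨z, hz⟩) (Algebra.IsAlgebraic.isAlgebraic z)) := by
    refine sup_le (fun z hz ↦ ⟨z, hz, 0, zero_mem F, by simp⟩) ?_
    rw [adjoin_simple_le_iff]
    exact ⟨0, zero_mem F, 1, one_mem F, by simp⟩
  exact hle hy

theorem mem_or_mul_mem_of_mem_sup {F : IntermediateField ℚ K} {x y : K} (hx : x ^ 2 ∈ F)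
    (hy2 : y ^ 2 ∈ F) (hy : y ∈ F ⊔ ℚ⟮x⟯) : y ∈ F ∨ y * x ∈ F := by
  obtain ⟨u, hu, v, hv, rfl⟩ := mem_sup_adjoin_simple hx hy
  by_cases hxF : x ∈ F
  · exact Or.inl (add_mem hu (mul_mem hv hxF))
  have huv : 2 * (u * v) = 0 := by
    by_contra h
    refine hxF ?_
    have : x = ((u + v * x) ^ 2 - u ^ 2 - v ^ 2 * x ^ 2) * (2 * (u * v))⁻¹ := by
      rw [eq_mul_inv_iff_mul_eq₀ h]
      ring
    rw [this]
    exact mul_mem (sub_mem (sub_mem hy2 (pow_mem hu 2)) (mul_mem (pow_mem hv 2) hx))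
      (inv_mem (mul_mem (ofNat_mem F 2) (mul_mem hu hv)))
  rcases mul_eq_zero.1 ((mul_eq_zero.1 huv).resolve_left two_ne_zero) with h | h
  · refine Or.inr ?_
    rw [h, zero_add, mul_assoc, ← pow_two]
    exact mul_mem hv hx
  · exact Or.inl (by simpa [h] using hu)

theorem not_mem_bot_of_sq_eq {y : K} {A : ℚ} (hy : y ^ 2 = algebraMap ℚ K A) (hA : ¬ IsSquare A) :
    y ∉ (⊥ : IntermediateField ℚ K) := by
  rintro ⟨r, rfl⟩
  refine hA ⟨r, (algebraMap ℚ K).injective ?_⟩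
  rw [← hy, ← pow_two]
  exact (map_pow (algebraMap ℚ K) r 2).symm

theorem not_mem_sup_adjoin {a b c : K} {A B C : ℚ} (ha : a ^ 2 = algebraMap ℚ K A)
    (hb : b ^ 2 = algebraMap ℚ K B) (hc : c ^ 2 = algebraMap ℚ K C) (hA : ¬ IsSquare A)
    (hAB : ¬ IsSquare (A * B)) (hAC : ¬ IsSquare (A * C)) (hABC : ¬ IsSquare (A * B * C)) :
    a ∉ (⊥ ⊔ ℚ⟮b⟯ ⊔ ℚ⟮c⟯ : IntermediateField ℚ K) := by
  intro h
  rcases mem_or_mul_mem_of_mem_sup (by rw [hc]; exact IntermediateField.algebraMap_mem _ _)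
    (by rw [ha]; exact IntermediateField.algebraMap_mem _ _) h with h | h
  · rcases mem_or_mul_mem_of_mem_sup (by rw [hb]; exact IntermediateField.algebraMap_mem _ _)
      (by rw [ha]; exact IntermediateField.algebraMap_mem _ _) h with h | h
    · exact not_mem_bot_of_sq_eq ha hA h
    · exact not_mem_bot_of_sq_eq (by rw [mul_pow, ha, hb, map_mul]) hAB h
  · rcases mem_or_mul_mem_of_mem_sup (by rw [hb]; exact IntermediateField.algebraMap_mem _ _)
      (by rw [mul_pow, ha, hc, ← map_mul]; exact IntermediateField.algebraMap_mem _ _) h with h | h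
    · exact not_mem_bot_of_sq_eq (by rw [mul_pow, ha, hc, map_mul]) hAC h
    · exact not_mem_bot_of_sq_eq (A := A * B * C)
        (by rw [mul_pow, mul_pow, ha, hb, hc, map_mul, map_mul]; ring) hABC h

theorem exists_algEquiv_neg [IsGalois ℚ K] {a b c : K} {A B C : ℚ} (ha : a ^ 2 = algebraMap ℚ K A)
    (hb : b ^ 2 = algebraMap ℚ K B) (hc : c ^ 2 = algebraMap ℚ K C) (hA : ¬ IsSquare A)
    (hAB : ¬ IsSquare (A * B)) (hAC : ¬ IsSquare (A * C)) (hABC : ¬ IsSquare (A * B * C)) :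
    ∃ g : K ≃ₐ[ℚ] K, g a = -a ∧ g b = b ∧ g c = c := by
  set E : IntermediateField ℚ K := ⊥ ⊔ ℚ⟮b⟯ ⊔ ℚ⟮c⟯ with hE
  have hab : a ∉ E := not_mem_sup_adjoin ha hb hc hA hAB hAC hABC
  have hbE : b ∈ E := (le_sup_right.trans le_sup_left : ℚ⟮b⟯ ≤ E) (mem_adjoin_simple_self ℚ b)
  have hcE : c ∈ E := (le_sup_right : ℚ⟮c⟯ ≤ E) (mem_adjoin_simple_self ℚ c)
  have hbot : a ∉ (⊥ : IntermediateField E K) := by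
    rintro ⟨r, rfl⟩
    exact hab r.2
  rw [IsGalois.mem_bot_iff_fixed] at hbot
  push Not at hbot
  obtain ⟨g, hg⟩ := hbot
  refine ⟨g.restrictScalars ℚ, ?_, g.commutes ⟨b, hbE⟩, g.commutes ⟨c, hcE⟩⟩
  have h2 : (g a) ^ 2 = a ^ 2 := by
    rw [← map_pow, ha]
    exact (g.restrictScalars ℚ).commutes A
  exact (sq_eq_sq_iff_eq_or_eq_neg.1 h2).resolve_left hg

theorem isGalois_of_adjoin_eq_top {S : Set K} (hS : adjoin ℚ S = ⊤)
    (h : ∀ x ∈ S, ∃ A : ℚ, x ^ 2 = algebraMap ℚ K A) : IsGalois ℚ K := by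
  have : Normal ℚ K := by
    refine normal_iff.2 fun x ↦ ⟨Algebra.IsIntegral.isIntegral x, ?_⟩
    have hx : x ∈ adjoin ℚ S := hS ▸ mem_top
    refine splits_of_mem_adjoin ℚ K (S := S)
      (fun y hy ↦ ⟨Algebra.IsIntegral.isIntegral y, ?_⟩) hx
    obtain ⟨A, hA⟩ := h y hy
    have hf : (Polynomial.X ^ 2 - Polynomial.C A : Polynomial ℚ) ≠ 0 :=
      Polynomial.X_pow_sub_C_ne_zero two_pos A
    have hmap : (Polynomial.X ^ 2 - Polynomial.C A : Polynomial ℚ).map (algebraMap ℚ K)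
        = (Polynomial.X - Polynomial.C y) * (Polynomial.X - Polynomial.C (-y)) := by
      simp only [Polynomial.map_sub, Polynomial.map_pow, Polynomial.map_X, Polynomial.map_C, ← hA,
        map_neg, map_pow]
      ring
    refine Polynomial.Splits.of_dvd (hmap ▸ (Polynomial.Splits.X_sub_C y).mul
      (Polynomial.Splits.X_sub_C (-y))) (Polynomial.map_ne_zero hf)
      (Polynomial.map_dvd _ (minpoly.dvd ℚ y ?_))
    simp [hA]
  exact ⟨⟩

theorem algEquiv_ext_of_adjoin_eq_top {S : Set K} (hS : adjoin ℚ S = ⊤) {f g : K ≃ₐ[ℚ] K}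
    (h : ∀ x ∈ S, f x = g x) : f = g := by
  refine AlgEquiv.ext fun x ↦ ?_
  have hx : x ∈ adjoin ℚ S := hS ▸ mem_top
  induction hx using adjoin_induction with
  | mem x hx => exact h x hx
  | algebraMap x => simp
  | add x y _ _ hx hy => rw [map_add, map_add, hx, hy]
  | inv x _ hx => rw [map_inv₀, map_inv₀, hx]
  | mul x y _ _ hx hy => rw [map_mul, map_mul, hx, hy]

end Kummer

section NumberField

variable {K : Type*} [Field K] [NumberField K]

theorem units_of_finrank_eq_four {i : K} (hi : i ^ 2 = -1) (h4 : Module.finrank ℚ K = 4) :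
    ∃ t h : (𝓞 K)ˣ, ∀ u, ∃ a b : ℤ, u = t ^ a * h ^ b := by
  have hreal : InfinitePlace.nrRealPlaces K = 0 := by
    classical
    rw [InfinitePlace.nrRealPlaces, Fintype.card_eq_zero_iff]
    refine ⟨fun ⟨w, hw⟩ ↦ ?_⟩
    have h2 : (InfinitePlace.embedding_of_isReal hw i) ^ 2 = -1 := by
      rw [← map_pow, hi, map_neg, map_one]
    nlinarith [sq_nonneg (InfinitePlace.embedding_of_isReal hw i)]
  have hcard := InfinitePlace.card_add_two_mul_card_eq_rank K
  have hcard' := InfinitePlace.card_eq_nrRealPlaces_add_nrComplexPlaces K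
  have hrank : Units.rank K = 1 := by
    rw [Units.rank]
    omega
  obtain ⟨t, ht⟩ := IsCyclic.exists_generator (α := Units.torsion K)
  have : Unique (Fin (Units.rank K)) := by
    rw [hrank]
    infer_instance
  refine ⟨t, Units.fundSystem K default, fun u ↦ ?_⟩
  obtain ⟨⟨z, e⟩, he, -⟩ := Units.exist_unique_eq_mul_prod K u
  obtain ⟨a, ha⟩ := Subgroup.mem_zpowers_iff.1 (ht z)
  refine ⟨a, e default, ?_⟩
  rw [he, ← ha, Fintype.prod_unique]
  simp

/-- The fixed field of a single automorphism. -/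
abbrev fixedBy (g : K ≃ₐ[ℚ] K) : IntermediateField ℚ K := fixedField (Subgroup.zpowers g)

theorem mem_fixedBy {g : K ≃ₐ[ℚ] K} {x : K} : x ∈ fixedBy g ↔ g x = x := by
  rw [mem_fixedField_iff]
  refine ⟨fun h ↦ h g (Subgroup.mem_zpowers g), fun h f hf ↦ ?_⟩
  have : Subgroup.zpowers g ≤ MulAction.stabilizer (K ≃ₐ[ℚ] K) x := by
    rw [Subgroup.zpowers_le]
    exact h
  exact this hf

theorem finrank_fixedBy {g : K ≃ₐ[ℚ] K} (hg : ∀ x, g (g x) = x) (hne : g ≠ 1) :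
    2 * Module.finrank ℚ (fixedBy g) = Module.finrank ℚ K := by
  rw [← Module.finrank_mul_finrank ℚ (fixedBy g) K, mul_comm]
  congr 1
  rw [finrank_fixedField_eq_card, Nat.card_zpowers]
  exact (orderOf_eq_prime (by ext x; simp [pow_two, hg]) hne).symm

/-- The restriction of an involution to the fixed field of an automorphism commuting with it. -/
def restrictFixedBy (g f : K ≃ₐ[ℚ] K) (h : ∀ x, g (f x) = f (g x)) (hf : ∀ x, f (f x) = x) :
    fixedBy g ≃+* fixedBy g where
  toFun x := ⟨f x, mem_fixedBy.2 (by rw [h, mem_fixedBy.1 x.2])⟩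
  invFun x := ⟨f x, mem_fixedBy.2 (by rw [h, mem_fixedBy.1 x.2])⟩
  left_inv x := Subtype.ext (hf x)
  right_inv x := Subtype.ext (hf x)
  map_mul' x y := Subtype.ext (map_mul f (x : K) y)
  map_add' x y := Subtype.ext (map_add f (x : K) y)

theorem isIntegral_algebraMap_rat {r : ℚ} (h : IsIntegral ℤ (algebraMap ℚ K r)) :
    ∃ n : ℤ, (n : ℚ) = r :=
  IsIntegrallyClosed.isIntegral_iff.1
    ((isIntegral_algebraMap_iff (algebraMap ℚ K).injective).1 h)

/-- The layer of rings of integers over the fixed field of an involution. -/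
noncomputable def fixedByLayer (g : K ≃ₐ[ℚ] K) (hg : ∀ x, g (g x) = x) :
    Layer (𝓞 (fixedBy g)) (𝓞 K) where
  j := RingOfIntegers.mapRingHom (fixedBy g).val.toRingHom
  s := RingOfIntegers.mapRingEquiv g.toRingEquiv
  inj x y h := RingOfIntegers.ext (Subtype.ext (congrArg (fun z : 𝓞 K ↦ (z : K)) h))
  invol x := RingOfIntegers.ext (hg x)
  fix x := RingOfIntegers.ext (mem_fixedBy.1 (x : fixedBy g).2)
  desc x hx := by
    have hgx : g x = x := congrArg (fun z : 𝓞 K ↦ (z : K)) hx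
    refine ⟨⟨⟨x, mem_fixedBy.2 hgx⟩, ?_⟩, RingOfIntegers.ext rfl⟩
    exact (isIntegral_algebraMap_iff (B := K) (R := ℤ)
      (algebraMap (fixedBy g) K).injective).1 x.isIntegral_coe

end NumberField

/-- Commuting involutions `g`, `s`, `κ` of a number field `K ∋ i` whose common fixed field is `ℚ`. -/
structure Frame (K : Type*) [Field K] [NumberField K] where
  g : K ≃ₐ[ℚ] K
  s : K ≃ₐ[ℚ] K
  κ : K ≃ₐ[ℚ] K
  i : K
  g_g : ∀ x, g (g x) = x
  s_s : ∀ x, s (s x) = x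
  κ_κ : ∀ x, κ (κ x) = x
  g_s : ∀ x, g (s x) = s (g x)
  g_κ : ∀ x, g (κ x) = κ (g x)
  κ_s : ∀ x, κ (s x) = s (κ x)
  i_sq : i ^ 2 = -1
  g_i : g i = i
  s_i : s i = i
  κ_i : κ i = -i
  rat : ∀ x, g x = x → s x = x → κ x = x → ∃ r : ℚ, algebraMap ℚ K r = x

namespace Frame

variable {K : Type*} [Field K] [NumberField K] (F : Frame K)

/-- The square root of `-1` in the ring of integers of the fixed field. -/
noncomputable def I : 𝓞 (fixedBy F.g) :=
  ⟨⟨F.i, mem_fixedBy.2 F.g_i⟩, IsIntegral.of_pow two_pos (by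
    rw [show (⟨F.i, mem_fixedBy.2 F.g_i⟩ : fixedBy F.g) ^ 2 = -1 from Subtype.ext F.i_sq]
    exact isIntegral_one.neg)⟩

@[simp]
theorem coe_I : ((F.I : fixedBy F.g) : K) = F.i := rfl

theorem I_mul_I : F.I * F.I = ((-1 : ℤ) : 𝓞 (fixedBy F.g)) :=
  RingOfIntegers.ext (Subtype.ext (by
    have := F.i_sq
    rw [pow_two] at this
    simpa [-RingOfIntegers.map_mk] using this))

/-- The embedding of the Gaussian integers. -/
noncomputable def j : GaussianInt →+* 𝓞 (fixedBy F.g) := Zsqrtd.lift ⟨F.I, F.I_mul_I⟩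

theorem coe_j (z : GaussianInt) : (((F.j z : 𝓞 (fixedBy F.g)) : fixedBy F.g) : K)
    = z.re + z.im * F.i := by
  simp [j]

theorem exists_rat (x : K) (hg : F.g x = x) (hs : F.s x = x) :
    ∃ a b : ℚ, x + F.κ x = algebraMap ℚ K a ∧ -F.i * (x - F.κ x) = algebraMap ℚ K b := by
  obtain ⟨a, ha⟩ := F.rat (x + F.κ x) (by rw [map_add, F.g_κ, hg])
    (by rw [map_add, ← F.κ_s, hs]) (by rw [map_add, F.κ_κ, add_comm])
  obtain ⟨b, hb⟩ := F.rat (-F.i * (x - F.κ x)) (by simp [F.g_κ, hg, F.g_i])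
    (by simp [← F.κ_s, hs, F.s_i]) (by simp only [map_mul, map_neg, map_sub, F.κ_κ, F.κ_i]; ring)
  exact ⟨a, b, ha.symm, hb.symm⟩

theorem isIntegral_i : IsIntegral ℤ F.i :=
  IsIntegral.of_pow two_pos (by rw [F.i_sq]; exact isIntegral_one.neg)

theorem exists_gaussianInt (x : K) (hx : IsIntegral ℤ x) (hg : F.g x = x) (hs : F.s x = x) :
    ∃ z : GaussianInt, (z.re + z.im * F.i : K) = x := by
  have hκ : IsIntegral ℤ (F.κ x) := hx.map (F.κ.toRingEquiv.toRingHom.toIntAlgHom)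
  obtain ⟨a, b, ha, hb⟩ := F.exists_rat x hg hs
  obtain ⟨m, rfl⟩ := isIntegral_algebraMap_rat (ha ▸ hx.add hκ)
  obtain ⟨l, rfl⟩ := isIntegral_algebraMap_rat (hb ▸ F.isIntegral_i.neg.mul (hx.sub hκ))
  have hi := F.i_sq
  simp only [map_intCast] at ha hb
  have h4 : ((m ^ 2 + l ^ 2 : ℚ)) = 4 * ((m ^ 2 + l ^ 2) / 4) := by ring
  obtain ⟨n, hn⟩ := isIntegral_algebraMap_rat (K := K) (r := (m ^ 2 + l ^ 2) / 4) (by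
    have : algebraMap ℚ K ((m ^ 2 + l ^ 2) / 4) = x * F.κ x := by
      simp only [map_div₀, map_add, map_pow, map_intCast, map_ofNat, ← ha, ← hb]
      linear_combination (x - F.κ x) ^ 2 / 4 * hi
    rw [this]
    exact hx.mul hκ)
  have hml : m ^ 2 + l ^ 2 = 4 * n := by
    rw [← hn] at h4
    exact_mod_cast h4
  obtain ⟨m', rfl | rfl⟩ := Int.even_or_odd' m <;> obtain ⟨l', rfl | rfl⟩ := Int.even_or_odd' l <;>
    ring_nf at hml <;> try omega
  refine ⟨⟨m', l'⟩, ?_⟩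
  push_cast at ha hb ⊢
  linear_combination (-1 / 2 : K) * ha - F.i / 2 * hb - (x - F.κ x) / 2 * hi

/-- The quartic layer attached to a frame and a square root `θ` of a Gaussian integer. -/
noncomputable def quartic (θ : K) (d c : GaussianInt) (D : ℕ) (hd : d ≠ 0) (hcd : c ^ 2 * d = D)
    (hg : F.g θ = θ) (hs : F.s θ = -θ) (hθ : θ ^ 2 = d.re + d.im * F.i)
    (hκ : F.κ ((c.re + c.im * F.i) * θ) = (c.re + c.im * F.i) * θ) :
    Quartic (𝓞 (fixedBy F.g)) where
  j := F.j
  s := RingOfIntegers.mapRingEquiv (restrictFixedBy F.g F.s F.g_s F.s_s)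
  κ := RingOfIntegers.mapRingEquiv (restrictFixedBy F.g F.κ F.g_κ F.κ_κ)
  θ := ⟨⟨θ, mem_fixedBy.2 hg⟩, IsIntegral.of_pow two_pos (by
    rw [show (⟨θ, mem_fixedBy.2 hg⟩ : fixedBy F.g) ^ 2 = (F.j d : fixedBy F.g) from
      Subtype.ext (hθ.trans (F.coe_j d).symm)]
    exact (F.j d).isIntegral_coe)⟩
  d := d
  c := c
  D := D
  inj x y h := by
    have h1 : (x.re + x.im * F.i : K) = y.re + y.im * F.i := by rw [← coe_j, ← coe_j, h]
    have h2 := congrArg F.κ h1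
    simp only [map_add, map_mul, map_intCast, F.κ_i] at h2
    have hi0 : F.i ≠ 0 := fun h ↦ by simpa [h] using F.i_sq
    have h3 : (x.im : K) = y.im := by
      refine mul_right_cancel₀ hi0 (mul_left_cancel₀ (two_ne_zero (α := K)) ?_)
      linear_combination h1 - h2
    have h4 : (x.re : K) = y.re := by linear_combination h1 - F.i * h3
    exact Zsqrtd.ext (Int.cast_injective h4) (Int.cast_injective h3)
  invol x := RingOfIntegers.ext (Subtype.ext (F.s_s _))
  fix x := RingOfIntegers.ext (Subtype.ext (by
    change F.s (F.j x : fixedBy F.g) = (F.j x : fixedBy F.g)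
    rw [coe_j]
    simp [F.s_i]))
  desc x hx := by
    obtain ⟨z, hz⟩ := F.exists_gaussianInt ((x : fixedBy F.g) : K)
      (x.isIntegral_coe.map (fixedBy F.g).val.toRingHom.toIntAlgHom)
      (mem_fixedBy.1 (x : fixedBy F.g).2)
      (congrArg (fun y : 𝓞 (fixedBy F.g) ↦ ((y : fixedBy F.g) : K)) hx)
    exact ⟨z, RingOfIntegers.ext (Subtype.ext ((F.coe_j z).trans hz))⟩
  d_ne_zero := hd
  s_θ := RingOfIntegers.ext (Subtype.ext hs)
  sq_θ := RingOfIntegers.ext (Subtype.ext (hθ.trans (F.coe_j d).symm))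
  κ_j z := RingOfIntegers.ext (Subtype.ext (by
    change F.κ (F.j z : fixedBy F.g) = (F.j (star z) : fixedBy F.g)
    rw [coe_j, coe_j]
    simp [F.κ_i]))
  κ_s x := RingOfIntegers.ext (Subtype.ext (F.κ_s _))
  κ_δ := RingOfIntegers.ext (Subtype.ext (by
    change F.κ ((F.j c : fixedBy F.g) * θ) = (F.j c : fixedBy F.g) * θ
    rw [coe_j, hκ]))
  sq_c := hcd

end Frame

/-- The field `ℚ(√p, √(2q), i)` with its three basic automorphisms. -/
structure Triquadratic (p q : ℕ) (K : Type*) [Field K] [NumberField K] where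
  hp : p % 8 = 5
  hq : q % 8 = 5
  hne : p ≠ q
  a : K
  b : K
  i : K
  σ : K ≃ₐ[ℚ] K
  τ : K ≃ₐ[ℚ] K
  κ : K ≃ₐ[ℚ] K
  a_sq : a ^ 2 = p
  b_sq : b ^ 2 = 2 * q
  i_sq : i ^ 2 = -1
  gen : adjoin ℚ {a, b, i} = ⊤
  gal : IsGalois ℚ K
  σ_a : σ a = a
  σ_b : σ b = -b
  σ_i : σ i = i
  τ_a : τ a = -a
  τ_b : τ b = b
  τ_i : τ i = i
  κ_a : κ a = a
  κ_b : κ b = b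
  κ_i : κ i = -i

namespace Triquadratic

variable {p q : ℕ} {K : Type*} [Field K] [NumberField K] (T : Triquadratic p q K)

include T in
theorem ext_gen {f g : K ≃ₐ[ℚ] K} (ha : f T.a = g T.a) (hb : f T.b = g T.b) (hi : f T.i = g T.i)
    (x : K) : f x = g x := by
  rw [algEquiv_ext_of_adjoin_eq_top T.gen (f := f) (g := g)]
  rintro x (rfl | rfl | rfl) <;> assumption

theorem σ_σ (x : K) : T.σ (T.σ x) = x :=
  T.ext_gen (f := T.σ * T.σ) (g := 1) (by simp [T.σ_a]) (by simp [T.σ_b]) (by simp [T.σ_i]) x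

theorem τ_τ (x : K) : T.τ (T.τ x) = x :=
  T.ext_gen (f := T.τ * T.τ) (g := 1) (by simp [T.τ_a]) (by simp [T.τ_b]) (by simp [T.τ_i]) x

theorem κ_κ (x : K) : T.κ (T.κ x) = x :=
  T.ext_gen (f := T.κ * T.κ) (g := 1) (by simp [T.κ_a]) (by simp [T.κ_b]) (by simp [T.κ_i]) x

theorem σ_τ (x : K) : T.σ (T.τ x) = T.τ (T.σ x) :=
  T.ext_gen (f := T.σ * T.τ) (g := T.τ * T.σ) (by simp [T.σ_a, T.τ_a])
    (by simp [T.σ_b, T.τ_b]) (by simp [T.σ_i, T.τ_i]) x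

theorem κ_σ (x : K) : T.κ (T.σ x) = T.σ (T.κ x) :=
  T.ext_gen (f := T.κ * T.σ) (g := T.σ * T.κ) (by simp [T.σ_a, T.κ_a])
    (by simp [T.σ_b, T.κ_b]) (by simp [T.σ_i, T.κ_i]) x

theorem κ_τ (x : K) : T.κ (T.τ x) = T.τ (T.κ x) :=
  T.ext_gen (f := T.κ * T.τ) (g := T.τ * T.κ) (by simp [T.τ_a, T.κ_a])
    (by simp [T.τ_b, T.κ_b]) (by simp [T.τ_i, T.κ_i]) x

theorem a_ne_zero : T.a ≠ 0 := fun h ↦ by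
  have h1 := T.a_sq
  have h2 := T.hp
  rw [h, zero_pow two_ne_zero, eq_comm, Nat.cast_eq_zero] at h1
  omega

theorem b_ne_zero : T.b ≠ 0 := fun h ↦ by
  have h1 := T.b_sq
  have h2 := T.hq
  rw [h, zero_pow two_ne_zero, eq_comm, mul_eq_zero, Nat.cast_eq_zero] at h1
  have := h1.resolve_left two_ne_zero
  omega

theorem i_ne_zero : T.i ≠ 0 := fun h ↦ by
  have := T.i_sq
  simp_all

theorem ne_neg {x : K} (hx : x ≠ 0) : x ≠ -x := fun h ↦ hx (self_eq_neg.1 h)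

theorem sign (f : K ≃ₐ[ℚ] K) : (f T.a = T.a ∨ f T.a = -T.a) ∧ (f T.b = T.b ∨ f T.b = -T.b) ∧
    (f T.i = T.i ∨ f T.i = -T.i) := by
  refine ⟨sq_eq_sq_iff_eq_or_eq_neg.1 ?_, sq_eq_sq_iff_eq_or_eq_neg.1 ?_,
    sq_eq_sq_iff_eq_or_eq_neg.1 ?_⟩
  · rw [← map_pow, T.a_sq, map_natCast]
  · rw [← map_pow, T.b_sq, map_mul, map_natCast, map_ofNat]
  · rw [← map_pow, T.i_sq, map_neg, map_one]

theorem exists_eq_mul (f : K ≃ₐ[ℚ] K) : ∃ g ∈ ({1, T.τ} : Set (K ≃ₐ[ℚ] K)),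
    ∃ h ∈ ({1, T.σ} : Set (K ≃ₐ[ℚ] K)), ∃ k ∈ ({1, T.κ} : Set (K ≃ₐ[ℚ] K)),
      f = g * (h * k) := by
  classical
  obtain ⟨ha, hb, hi⟩ := T.sign f
  refine ⟨if f T.a = T.a then 1 else T.τ, by split_ifs <;> simp,
    if f T.b = T.b then 1 else T.σ, by split_ifs <;> simp,
    if f T.i = T.i then 1 else T.κ, by split_ifs <;> simp, ?_⟩
  have ha' := (ne_neg T.a_ne_zero).symm
  have hb' := (ne_neg T.b_ne_zero).symm
  have hi' := (ne_neg T.i_ne_zero).symm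
  rcases ha with ha | ha <;> rcases hb with hb | hb <;> rcases hi with hi | hi <;>
    simp only [ha, hb, hi, ha', hb', hi', if_true, if_false] <;>
    refine AlgEquiv.ext (T.ext_gen ?_ ?_ ?_) <;>
    simp [ha, hb, hi, T.σ_a, T.σ_b, T.σ_i, T.τ_a, T.τ_b, T.τ_i, T.κ_a, T.κ_b, T.κ_i]

theorem exists_rat (x : K) (hσ : T.σ x = x) (hτ : T.τ x = x) (hκ : T.κ x = x) :
    ∃ r : ℚ, algebraMap ℚ K r = x := by
  have := T.gal
  have hx : x ∈ (⊥ : IntermediateField ℚ K) := by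
    rw [IsGalois.mem_bot_iff_fixed]
    intro f
    obtain ⟨g, hg, h, hh, k, hk, rfl⟩ := T.exists_eq_mul f
    rcases hg with rfl | rfl <;> rcases hh with rfl | rfl <;> rcases hk with rfl | rfl <;>
      simp [hσ, hτ, hκ]
  exact hx

include T in
theorem finrank_eq : Module.finrank ℚ K = 8 := by
  have := T.gal
  classical
  rw [← IsGalois.card_aut_eq_finrank]
  have hb : Function.Bijective (fun f : K ≃ₐ[ℚ] K ↦
      (decide (f T.a = T.a), decide (f T.b = T.b), decide (f T.i = T.i))) := by
    have ha' := (ne_neg T.a_ne_zero).symm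
    have hb' := (ne_neg T.b_ne_zero).symm
    have hi' := (ne_neg T.i_ne_zero).symm
    constructor
    · intro f g h
      simp only [Prod.mk.injEq, decide_eq_decide] at h
      obtain ⟨ha, hb, hi⟩ := T.sign f
      obtain ⟨ga, gb, gi⟩ := T.sign g
      refine AlgEquiv.ext (T.ext_gen ?_ ?_ ?_)
      · rcases ha with ha | ha <;> rcases ga with ga | ga <;> simp_all
      · rcases hb with ha | ha <;> rcases gb with ga | ga <;> simp_all
      · rcases hi with ha | ha <;> rcases gi with ga | ga <;> simp_all
    · rintro ⟨x, y, z⟩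
      refine ⟨(if x then 1 else T.τ) * ((if y then 1 else T.σ) * (if z then 1 else T.κ)), ?_⟩
      cases x <;> cases y <;> cases z <;>
        simp [T.σ_a, T.σ_b, T.σ_i, T.τ_a, T.τ_b, T.τ_i, T.κ_a, T.κ_b, T.κ_i, ha', hb', hi']
  rw [Nat.card_eq_of_bijective _ hb]
  simp

/-- The frame of the subfield fixed by `σ`. -/
def frameL : Frame K where
  g := T.σ
  s := T.τ
  κ := T.κ
  i := T.i
  g_g := T.σ_σ
  s_s := T.τ_τ
  κ_κ := T.κ_κ
  g_s := T.σ_τ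
  g_κ x := (T.κ_σ x).symm
  κ_s := T.κ_τ
  i_sq := T.i_sq
  g_i := T.σ_i
  s_i := T.τ_i
  κ_i := T.κ_i
  rat x hg hs hκ := T.exists_rat x hg hs hκ

/-- The frame of the subfield fixed by `τ`. -/
def frameM : Frame K where
  g := T.τ
  s := T.σ
  κ := T.κ
  i := T.i
  g_g := T.τ_τ
  s_s := T.σ_σ
  κ_κ := T.κ_κ
  g_s x := (T.σ_τ x).symm
  g_κ x := (T.κ_τ x).symm
  κ_s := T.κ_σ
  i_sq := T.i_sq
  g_i := T.τ_i
  s_i := T.σ_i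
  κ_i := T.κ_i
  rat x hg hs hκ := T.exists_rat x hs hg hκ

/-- The frame of the subfield fixed by `σ τ`. -/
def frameK : Frame K where
  g := T.σ * T.τ
  s := T.σ
  κ := T.κ
  i := T.i
  g_g x := by simp [← T.σ_τ, T.σ_σ, T.τ_τ]
  s_s := T.σ_σ
  κ_κ := T.κ_κ
  g_s x := by simp [← T.σ_τ]
  g_κ x := by simp [← T.κ_τ, ← T.κ_σ]
  κ_s := T.κ_σ
  i_sq := T.i_sq
  g_i := by simp [T.σ_i, T.τ_i]
  s_i := T.σ_i
  κ_i := T.κ_i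
  rat x hg hs hκ := T.exists_rat x hs (by
    have : T.σ (T.τ x) = x := hg
    rwa [T.σ_τ, hs] at this) hκ

theorem one_add_i_ne_zero : 1 + T.i ≠ 0 := fun h ↦ by
  have h2 : (2 : K) = 0 := by linear_combination (1 - T.i) * h + T.i_sq
  exact two_ne_zero h2

theorem θM_sq : (T.b / (1 + T.i)) ^ 2 = -T.i * q := by
  rw [div_pow, T.b_sq, div_eq_iff (pow_ne_zero 2 T.one_add_i_ne_zero)]
  linear_combination (q * T.i + 2 * q) * T.i_sq

theorem neg_gI_mul_ne_zero {n : ℕ} (hn : n ≠ 0) : -gI * (n : GaussianInt) ≠ 0 := fun h ↦ by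
  have := congrArg Zsqrtd.im h
  simp at this
  exact hn this

theorem sq_one_add_gI_mul (n : ℕ) : (1 + gI) ^ 2 * (-gI * (n : GaussianInt)) = (2 * n : ℕ) := by
  have : (1 + gI) ^ 2 * -gI = 2 := by decide
  rw [← mul_assoc, this]
  push_cast
  rfl

theorem units_fixedBy {g : K ≃ₐ[ℚ] K} (hg : ∀ x, g (g x) = x) (hne : g ≠ 1) (hi : g T.i = T.i) :
    ∃ t h : (𝓞 (fixedBy g))ˣ, ∀ u, ∃ a b : ℤ, u = t ^ a * h ^ b := by
  refine units_of_finrank_eq_four (i := ⟨T.i, mem_fixedBy.2 hi⟩) (Subtype.ext T.i_sq) ?_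
  have := finrank_fixedBy hg hne
  rw [T.finrank_eq] at this
  omega

include T in
theorem rank_fixedBy {g : K ≃ₐ[ℚ] K} (hg : ∀ x, g (g x) = x) (hne : g ≠ 1) :
    Module.finrank ℤ (𝓞 (fixedBy g)) = 4 := by
  have := finrank_fixedBy hg hne
  rw [T.finrank_eq] at this
  rw [RingOfIntegers.rank]
  omega

theorem σ_ne_one : T.σ ≠ 1 := fun h ↦ ne_neg T.b_ne_zero (by
  have := T.σ_b
  rwa [h] at this)

theorem τ_ne_one : T.τ ≠ 1 := fun h ↦ ne_neg T.a_ne_zero (by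
  have := T.τ_a
  rwa [h] at this)

theorem σ_mul_τ_ne_one : T.σ * T.τ ≠ 1 := fun h ↦ ne_neg T.a_ne_zero (by
  have : T.σ (T.τ T.a) = T.a := congrArg (fun f : K ≃ₐ[ℚ] K ↦ f T.a) h
  rw [T.τ_a, map_neg, T.σ_a] at this
  exact this.symm)

/-- The tower of rings of integers attached to `ℚ(√p, √(2q), i)`. -/
noncomputable def octic : Octic p q (𝓞 (fixedBy T.frameL.g)) (𝓞 (fixedBy T.frameM.g))
    (𝓞 (fixedBy T.frameK.g)) (𝓞 K) where
  hp := T.hp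
  hq := T.hq
  hne := T.hne
  EL := T.frameL.quartic T.a p 1 p (by
      have := T.hp
      intro h
      have := congrArg Zsqrtd.re h
      simp at this
      omega) (by simp) T.σ_a T.τ_a (by simp [T.a_sq])
    (by simp [frameL, T.κ_a])
  EM := T.frameM.quartic (T.b / (1 + T.i)) (-gI * q) (1 + gI) (2 * q)
    (neg_gI_mul_ne_zero (by have := T.hq; omega)) (sq_one_add_gI_mul q)
    (by simp [frameM, T.τ_b, T.τ_i]) (by simp [frameM, T.σ_b, T.σ_i, neg_div])
    (by rw [T.θM_sq]; simp [frameM]; ring)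
    (by
      have : ((1 : K) + T.i) * (T.b / (1 + T.i)) = T.b := mul_div_cancel₀ _ T.one_add_i_ne_zero
      simp [frameM, -map_mul, this, T.κ_b])
  Ek := T.frameK.quartic (T.a * (T.b / (1 + T.i))) (-gI * (p * q)) (1 + gI) (2 * (p * q))
    (by exact_mod_cast neg_gI_mul_ne_zero (n := p * q)
          (by have := T.hq; have := T.hp; exact mul_ne_zero (by omega) (by omega)))
    (by exact_mod_cast sq_one_add_gI_mul (p * q))
    (by simp [frameK, T.τ_b, T.τ_i, T.τ_a, T.σ_a, T.σ_b, T.σ_i, neg_div])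
    (by simp [frameK, T.σ_b, T.σ_i, T.σ_a, neg_div])
    (by rw [mul_pow, T.θM_sq, T.a_sq]; simp [frameK]; ring)
    (by
      have : ((1 : K) + T.i) * (T.a * (T.b / (1 + T.i))) = T.a * T.b := by
        rw [mul_left_comm, mul_div_cancel₀ _ T.one_add_i_ne_zero]
      simp [frameK, -map_mul, this]
      rw [map_mul, T.κ_a, T.κ_b])
  ΛL := fixedByLayer T.frameL.g T.frameL.g_g
  ΛM := fixedByLayer T.frameM.g T.frameM.g_g
  Λk := fixedByLayer T.frameK.g T.frameK.g_g
  j_M z := RingOfIntegers.ext ((T.frameM.coe_j z).trans (T.frameL.coe_j z).symm)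
  j_k z := RingOfIntegers.ext ((T.frameK.coe_j z).trans (T.frameL.coe_j z).symm)
  s_comm x := RingOfIntegers.ext (T.σ_τ x)
  s_k x := RingOfIntegers.ext rfl
  s_L_j x := RingOfIntegers.ext rfl
  s_M_j x := RingOfIntegers.ext rfl
  s_k_j x := RingOfIntegers.ext rfl
  κ := RingOfIntegers.mapRingEquiv T.κ.toRingEquiv
  κ_L x := RingOfIntegers.ext rfl
  κ_M x := RingOfIntegers.ext rfl
  κ_k x := RingOfIntegers.ext rfl
  d_L := rfl
  c_L := rfl
  d_M := rfl
  c_M := rfl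
  d_k := rfl
  c_k := rfl
  units_L := T.units_fixedBy T.frameL.g_g T.σ_ne_one T.σ_i
  units_M := T.units_fixedBy T.frameM.g_g T.τ_ne_one T.τ_i
  units_k := T.units_fixedBy T.frameK.g_g T.σ_mul_τ_ne_one T.frameK.g_i
  rank_L := T.rank_fixedBy T.frameL.g_g T.σ_ne_one
  rank_M := T.rank_fixedBy T.frameM.g_g T.τ_ne_one
  rank_k := T.rank_fixedBy T.frameK.g_g T.σ_mul_τ_ne_one
  rank_O := by rw [RingOfIntegers.rank, T.finrank_eq]

end Triquadratic

theorem Rat.not_isSquare_intCast {n : ℤ} (h : ¬ IsSquare n) : ¬ IsSquare (n : ℚ) := by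
  rwa [Rat.isSquare_intCast_iff]

theorem Int.not_isSquare_of_emod_eight {n : ℤ} (h : n % 8 = 2 ∨ n % 8 = 3 ∨ n % 8 = 5 ∨ n % 8 = 6) :
    ¬ IsSquare n := by
  rintro ⟨r, rfl⟩
  have : r % 8 = 0 ∨ r % 8 = 1 ∨ r % 8 = 2 ∨ r % 8 = 3 ∨ r % 8 = 4 ∨ r % 8 = 5 ∨ r % 8 = 6 ∨
    r % 8 = 7 := by omega
  rcases this with e | e | e | e | e | e | e | e <;> simp [Int.mul_emod, e] at h

theorem nonempty_triquadratic {p q : ℕ} (hp : p % 8 = 5) (hq : q % 8 = 5) (hne : p ≠ q)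
    {K : Type*} [Field K] [NumberField K] {a b i : K} (ha : a ^ 2 = p) (hb : b ^ 2 = 2 * q)
    (hi : i ^ 2 = -1) (hgen : adjoin ℚ {a, b, i} = ⊤) : Nonempty (Triquadratic p q K) := by
  have ha' : a ^ 2 = algebraMap ℚ K p := by simp [ha]
  have hb' : b ^ 2 = algebraMap ℚ K (2 * q) := by simp [hb]
  have hi' : i ^ 2 = algebraMap ℚ K (-1) := by simp [hi]
  have hgal : IsGalois ℚ K := isGalois_of_adjoin_eq_top hgen (by
    rintro x (rfl | rfl | rfl)
    exacts [⟨_, ha'⟩, ⟨_, hb'⟩, ⟨_, hi'⟩])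
  have hpq : (p : ℤ) * (2 * q) % 8 = 2 := by
    rw [Int.mul_emod, Int.mul_emod 2, show (p : ℤ) % 8 = 5 by omega, show (q : ℤ) % 8 = 5 by omega]
    rfl
  have h1 : ¬ IsSquare (p : ℚ) := by
    exact_mod_cast Rat.not_isSquare_intCast (Int.not_isSquare_of_emod_eight (n := p) (by omega))
  have h2 : ¬ IsSquare (2 * q : ℚ) := by
    exact_mod_cast Rat.not_isSquare_intCast (Int.not_isSquare_of_emod_eight (n := 2 * q) (by omega))
  have h3 : ¬ IsSquare (p * (2 * q) : ℚ) := by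
    exact_mod_cast Rat.not_isSquare_intCast
      (Int.not_isSquare_of_emod_eight (n := p * (2 * q)) (by omega))
  have neg {x : ℚ} (hx : x < 0) : ¬ IsSquare x := fun h ↦ hx.not_ge h.nonneg
  have hp0 : (0 : ℚ) < p := by exact_mod_cast (by omega : 0 < p)
  have hq0 : (0 : ℚ) < 2 * q := by exact_mod_cast (by omega : 0 < 2 * q)
  have hpq0 := mul_pos hp0 hq0
  obtain ⟨σ, hσb, hσa, hσi⟩ := exists_algEquiv_neg hb' ha' hi' h2 (by rwa [mul_comm])
    (neg (by linarith)) (neg (by linarith))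
  obtain ⟨τ, hτa, hτb, hτi⟩ := exists_algEquiv_neg ha' hb' hi' h1 h3
    (neg (by linarith)) (neg (by linarith))
  obtain ⟨κ, hκi, hκa, hκb⟩ := exists_algEquiv_neg hi' ha' hb' (neg (by norm_num))
    (neg (by linarith)) (neg (by linarith)) (neg (by linarith))
  exact ⟨⟨hp, hq, hne, a, b, i, σ, τ, κ, ha, hb, hi, hgen, hgal, hσa, hσb, hσi, hτa, hτb, hτi,
    hκa, hκb, hκi⟩⟩

theorem nonempty_triquadratic_adjoin {p q : ℕ} (hp : p % 8 = 5) (hq : q % 8 = 5) (hne : p ≠ q)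
    (K : IntermediateField ℚ ℂ) [NumberField K]
    (hK : K = ℚ⟮((Real.sqrt (p : ℝ) : ℝ) : ℂ), ((Real.sqrt (2 * (q : ℝ)) : ℝ) : ℂ), Complex.I⟯) :
    Nonempty (Triquadratic p q K) := by
  have ha : ((Real.sqrt (p : ℝ) : ℝ) : ℂ) ∈ K := hK ▸ subset_adjoin ℚ _ (Or.inl rfl)
  have hb : ((Real.sqrt (2 * (q : ℝ)) : ℝ) : ℂ) ∈ K :=
    hK ▸ subset_adjoin ℚ _ (Or.inr (Or.inl rfl))
  have hi : Complex.I ∈ K := hK ▸ subset_adjoin ℚ _ (Or.inr (Or.inr rfl))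
  refine nonempty_triquadratic hp hq hne (a := ⟨_, ha⟩) (b := ⟨_, hb⟩) (i := ⟨Complex.I, hi⟩)
    (Subtype.ext ?_) (Subtype.ext ?_) (Subtype.ext Complex.I_sq) ?_
  · change ((Real.sqrt (p : ℝ) : ℝ) : ℂ) ^ 2 = _
    rw [← Complex.ofReal_pow, Real.sq_sqrt (by positivity)]
    simp
  · change ((Real.sqrt (2 * (q : ℝ)) : ℝ) : ℂ) ^ 2 = _
    rw [← Complex.ofReal_pow, Real.sq_sqrt (by positivity), Complex.ofReal_mul,
      Complex.ofReal_natCast]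
    rfl
  · rw [show (DivisionRing.toRatAlgebra : Algebra ℚ K) = K.algebra' from Subsingleton.elim _ _]
    refine map_injective K.val ?_
    rw [adjoin_map, ← AlgHom.fieldRange_eq_map, fieldRange_val]
    refine Eq.trans ?_ hK.symm
    congr 1
    simp [Set.image_insert_eq]

theorem isSquare_iff_isSquare {p q : ℕ} [Fact p.Prime] [Fact q.Prime] (hp : p % 8 = 5)
    (hq : q % 8 = 5) : IsSquare (p : ZMod q) ↔ IsSquare (q : ZMod p) := by
  rw [← not_iff_not, ← quadraticChar_neg_one_iff_not_isSquare, ← quadraticChar_swap hp hq,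
    quadraticChar_neg_one_iff_not_isSquare]

theorem Triquadratic.sylow {p q : ℕ} [Fact p.Prime] [Fact q.Prime] {K : Type*} [Field K]
    [NumberField K] (T : Triquadratic p q K) (P : Sylow 2 (ClassGroup (𝓞 K))) :
    (IsSquare (p : ZMod q) → Nonempty (Additive P ≃+ (ZMod 2 × ZMod 2 × ZMod 2))) ∧
      (¬ IsSquare (p : ZMod q) → Nonempty (Additive P ≃+ (ZMod 2 × ZMod 4))) :=
  ⟨fun h ↦ T.octic.sylow_of_isSquare h P, fun h ↦ T.octic.sylow_of_not_isSquare h P⟩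

/-- Let `K₁ = ℚ(√p₁, √(2p₂), i)` and `K₂ = ℚ(√p₂, √(2p₁), i)`.  If `p₁` is
a quadratic residue mod `p₂`, then `Cl₂(K₁) ≃ Cl₂(K₂) ≃ ℤ/2ℤ × ℤ/2ℤ × ℤ/2ℤ`; if `p₁` is a
quadratic non-residue mod `p₂`, then `Cl₂(K₁) ≃ Cl₂(K₂) ≃ ℤ/2ℤ × ℤ/4ℤ`. -/
theorem stmt_16 (p₁ p₂ : ℕ) (hp₁ : p₁.Prime) (hp₂ : p₂.Prime) (hne : p₁ ≠ p₂)
    (hm₁ : p₁ % 8 = 5) (hm₂ : p₂ % 8 = 5)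
    (K₁ K₂ : IntermediateField ℚ ℂ)
    (hK₁ : K₁ = ℚ⟮((Real.sqrt (p₁ : ℝ) : ℝ) : ℂ), ((Real.sqrt (2 * (p₂ : ℝ)) : ℝ) : ℂ),
      Complex.I⟯)
    (hK₂ : K₂ = ℚ⟮((Real.sqrt (p₂ : ℝ) : ℝ) : ℂ), ((Real.sqrt (2 * (p₁ : ℝ)) : ℝ) : ℂ),
      Complex.I⟯)
    [NumberField K₁] [NumberField K₂] :
    (IsSquare ((p₁ : ZMod p₂)) →
      (∀ P : Sylow 2 (ClassGroup (RingOfIntegers K₁)),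
        Nonempty (Additive P ≃+ (ZMod 2 × ZMod 2 × ZMod 2))) ∧
      (∀ P : Sylow 2 (ClassGroup (RingOfIntegers K₂)),
        Nonempty (Additive P ≃+ (ZMod 2 × ZMod 2 × ZMod 2)))) ∧
    (¬ IsSquare ((p₁ : ZMod p₂)) →
      (∀ P : Sylow 2 (ClassGroup (RingOfIntegers K₁)),
        Nonempty (Additive P ≃+ (ZMod 2 × ZMod 4))) ∧
      (∀ P : Sylow 2 (ClassGroup (RingOfIntegers K₂)),
        Nonempty (Additive P ≃+ (ZMod 2 × ZMod 4)))) := by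
  have : Fact p₁.Prime := ⟨hp₁⟩
  have : Fact p₂.Prime := ⟨hp₂⟩
  obtain ⟨T₁⟩ := nonempty_triquadratic_adjoin hm₁ hm₂ hne K₁ hK₁
  obtain ⟨T₂⟩ := nonempty_triquadratic_adjoin hm₂ hm₁ hne.symm K₂ hK₂
  have hiff := isSquare_iff_isSquare hm₁ hm₂
  exact ⟨fun h ↦ ⟨fun P ↦ (T₁.sylow P).1 h, fun P ↦ (T₂.sylow P).1 (hiff.1 h)⟩,
    fun h ↦ ⟨fun P ↦ (T₁.sylow P).2 h, fun P ↦ (T₂.sylow P).2 (hiff.not.1 h)⟩⟩
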